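/- (Alt–Caffarelli–Friedman monotonicity formula.) Let u₊ and u₋ be continuous, locally Lipschitz functions on B₁ ⊂ ℝⁿ (n ≥ 2) such that u₊ ≥ 0, u₋ ≥ 0, u₊·u₋ = 0 in B₁, and each u_± is subharmonic in B₁ (in the distributional sense: ∫_{B₁} u_± Δφ dx ≥ 0 for every nonnegative φ ∈ C_c^∞(B₁)). Then the function Φ(r) = r^{-4} · (∫_{B_r} |∇u₊(x)|²/|x|^{n−2} dx) · (∫_{B_r} |∇u₋(x)|²/|x|^{n−2} dx) is nondecreasing for 0 < r < 1. -/

import Mathlib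

/- Setting: the double obstacle problem
   Δu = f·χ_{Ω(u)∩{u<ψ}} + Δψ·χ_{Ω(u)∩{u=ψ}},  u ≤ ψ,
   following "Regularity of the free boundary for the double obstacle problem". -/

open Set Metric MeasureTheory Filter
open scoped RealInnerProductSpace NNReal

noncomputable section

/-- Euclidean space `ℝⁿ`. -/
abbrev E (n : ℕ) := EuclideanSpace ℝ (Fin n)

variable {n : ℕ}

/-- Pointwise Laplacian, via iterated `fderiv` along the coordinate directions
(defined a.e. for `C^{1,1}` functions, junk value elsewhere). -/
def lap (u : E n → ℝ) (x : E n) : ℝ :=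
  ∑ i : Fin n, fderiv ℝ (fun y => fderiv ℝ u y (EuclideanSpace.single i 1)) x
    (EuclideanSpace.single i 1)

/-- `Λ(v) = {x ∈ D : v(x) = 0, ∇v(x) = 0}`. -/
def Lam (D : Set (E n)) (v : E n → ℝ) : Set (E n) :=
  {x ∈ D | v x = 0 ∧ gradient v x = 0}

/-- `Ω(v) = D \ Λ(v)`. -/
def Om (D : Set (E n)) (v : E n → ℝ) : Set (E n) := D \ Lam D v

/-- `Γ(v) = ∂Λ(v) ∩ D`. -/
def Gam (D : Set (E n)) (v : E n → ℝ) : Set (E n) := frontier (Lam D v) ∩ D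

/-- `Λ^ψ(u) = {x ∈ D : u(x) = ψ(x)}`. -/
def LamPsi (D : Set (E n)) (u ψ : E n → ℝ) : Set (E n) := {x ∈ D | u x = ψ x}

/-- `Γ^ψ(u) = ∂Λ^ψ(u) ∩ D`. -/
def GamPsi (D : Set (E n)) (u ψ : E n → ℝ) : Set (E n) := frontier (LamPsi D u ψ) ∩ D

/-- The unit ball `B₁`. -/
def B1 (n : ℕ) : Set (E n) := ball 0 1

/-- The class `P₁(M)`: `f ∈ C^{0,1}(B₁)`, `ψ ∈ C^{1,1}(B₁) ∩ C^{2,1}(closure Ω(ψ))`,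
`u ∈ C^{1,1}(B₁)` with `‖D²u‖_{L^∞(B₁)} ≤ M`, `u ≤ ψ` in `B₁`,
`Δu = f·χ_{Ω(u)∩{u<ψ}} + Δψ·χ_{Ω(u)∩{u=ψ}}` a.e. in `B₁`, and `0 ∈ Γ^d(u)`. -/
structure P1 (n : ℕ) (M : ℝ) (u ψ f : E n → ℝ) : Prop where
  f_lip : ∃ K : ℝ≥0, LipschitzOnWith K f (B1 n)
  psi_c1 : ContDiffOn ℝ 1 ψ (B1 n)
  psi_c11 : ∃ K : ℝ≥0, LipschitzOnWith K (fderiv ℝ ψ) (B1 n)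
  psi_c2 : ContDiffOn ℝ 2 ψ (Om (B1 n) ψ)
  psi_c21 : ∃ K : ℝ≥0, LipschitzOnWith K (fderiv ℝ (fderiv ℝ ψ)) (closure (Om (B1 n) ψ))
  u_c1 : ContDiffOn ℝ 1 u (B1 n)
  u_c11 : LipschitzOnWith (Real.toNNReal M) (fderiv ℝ u) (B1 n)
  u_le : ∀ x ∈ B1 n, u x ≤ ψ x
  u_eq : ∀ᵐ x : E n, x ∈ B1 n →
    lap u x = (Om (B1 n) u ∩ {y | u y < ψ y}).indicator f x
      + (Om (B1 n) u ∩ {y | u y = ψ y}).indicator (lap ψ) x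
  zero_mem : (0 : E n) ∈ Gam (B1 n) u ∩ GamPsi (B1 n) u ψ

/-- Minimal diameter: least distance between two parallel hyperplanes whose
enclosed slab contains `A`. -/
def MD (A : Set (E n)) : ℝ :=
  sInf {d : ℝ | 0 ≤ d ∧ ∃ (e : E n) (b : ℝ), ‖e‖ = 1 ∧
    ∀ x ∈ A, b ≤ ⟪x, e⟫ ∧ ⟪x, e⟫ ≤ b + d}

/-- Thickness `δ_r(v) = MD(Λ(v) ∩ B_r)/r` (centered at the origin). -/
def thick (D : Set (E n)) (v : E n → ℝ) (r : ℝ) : ℝ := MD (Lam D v ∩ ball (0 : E n) r) / r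

/-- `v` is subharmonic on `D` in the distributional sense:
`∫_D v Δφ ≥ 0` for every nonnegative smooth `φ` compactly supported in `D`. -/
def SubharmonicOn (D : Set (E n)) (v : E n → ℝ) : Prop :=
  ∀ φ : E n → ℝ, ContDiff ℝ (⊤ : ℕ∞) φ → HasCompactSupport φ → tsupport φ ⊆ D →
    (∀ x, 0 ≤ φ x) → 0 ≤ ∫ x in D, v x * lap φ x

/-- The Alt–Caffarelli–Friedman functional
`Φ(r) = r⁻⁴ (∫_{B_r} |∇u₊|²/|x|^{n-2}) (∫_{B_r} |∇u₋|²/|x|^{n-2})`. -/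
def ACF (n : ℕ) (up um : E n → ℝ) (r : ℝ) : ℝ :=
  1 / r ^ 4 * (∫ x in ball (0 : E n) r, ‖gradient up x‖ ^ 2 / ‖x‖ ^ (n - 2))
    * (∫ x in ball (0 : E n) r, ‖gradient um x‖ ^ 2 / ‖x‖ ^ (n - 2))

set_option linter.unusedSectionVars false
set_option linter.unusedVariables false

namespace ACFproof

open Topology Module

section Gauss

variable {V : Type*} [NormedAddCommGroup V] [InnerProductSpace ℝ V] [FiniteDimensional ℝ V]
  [MeasurableSpace V] [BorelSpace V]

/-- unnormalised Gaussian weight -/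
def gw (x : V) : ℝ := Real.exp (-(1/2) * ‖x‖ ^ 2)

/-- normalising constant -/
def gc (V : Type*) [NormedAddCommGroup V] [InnerProductSpace ℝ V] [FiniteDimensional ℝ V]
  [MeasurableSpace V] [BorelSpace V] : ℝ := (∫ x : V, gw x)⁻¹

lemma gw_pos (x : V) : 0 < gw x := Real.exp_pos _

lemma gw_cont : Continuous (gw : V → ℝ) := by unfold gw; fun_prop

lemma gw_integral_pos : 0 < ∫ x : V, gw x := by
  unfold gw
  rw [GaussianFourier.integral_rexp_neg_mul_sq_norm (by norm_num)]
  positivity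

lemma gc_pos : 0 < gc V := inv_pos.2 gw_integral_pos

lemma gw_integrable : Integrable (gw : V → ℝ) := by
  by_contra h
  have := gw_integral_pos (V := V)
  rw [integral_undef h] at this
  exact lt_irrefl _ this

lemma gw2_integrable : Integrable (fun x : V => ‖x‖ ^ 2 * gw x) := by
  have h4 : Integrable (fun x : V => 4 * Real.exp (-(1/4) * ‖x‖ ^ 2)) := by
    apply Integrable.const_mul
    by_contra h
    have := GaussianFourier.integral_rexp_neg_mul_sq_norm (V := V) (b := 1/4) (by norm_num)
    rw [integral_undef h] at this
    have h2 : (0:ℝ) < (Real.pi / (1/4)) ^ ((finrank ℝ V : ℝ) / 2) := by positivity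
    linarith
  refine h4.mono' ?_ ?_
  · exact ((continuous_norm.pow 2).mul gw_cont).aestronglyMeasurable
  · refine ae_of_all _ fun x => ?_
    have e : gw x = Real.exp (-(1/4) * ‖x‖ ^ 2) * Real.exp (-(1/4) * ‖x‖ ^ 2) := by
      rw [gw, ← Real.exp_add]; ring_nf
    rw [Real.norm_of_nonneg (mul_nonneg (by positivity) (gw_pos x).le), e, ← mul_assoc]
    refine mul_le_mul_of_nonneg_right ?_ (Real.exp_pos _).le
    have h1 := Real.add_one_le_exp ((1/4) * ‖x‖ ^ 2)
    have h3 : Real.exp ((1/4) * ‖x‖ ^ 2) * Real.exp (-(1/4) * ‖x‖ ^ 2) = 1 := by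
      rw [← Real.exp_add]; ring_nf; simp
    have h5 := Real.exp_pos (-(1/4) * ‖x‖ ^ 2)
    nlinarith

variable (V) in
/-- standard Gaussian probability measure -/
def gm : Measure V := volume.withDensity (fun x => ENNReal.ofReal (gc V * gw x))

lemma gm_integral (f : V → ℝ) : ∫ x, f x ∂(gm V) = ∫ x, (gc V * gw x) * f x := by
  unfold gm
  rw [integral_withDensity_eq_integral_toReal_smul]
  · refine integral_congr_ae (ae_of_all _ fun x => ?_)
    have := mul_pos (gc_pos (V := V)) (gw_pos x)
    simp [ENNReal.toReal_ofReal this.le]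
  · exact (ENNReal.continuous_ofReal.comp (continuous_const.mul gw_cont)).measurable
  · exact ae_of_all _ fun x => ENNReal.ofReal_lt_top

lemma gm_integrable_iff (f : V → ℝ) :
    Integrable f (gm V) ↔ Integrable (fun x => (gc V * gw x) * f x) := by
  unfold gm
  rw [integrable_withDensity_iff_integrable_smul₀']
  · refine integrable_congr (ae_of_all _ fun x => ?_)
    have := mul_pos (gc_pos (V := V)) (gw_pos x)
    simp [ENNReal.toReal_ofReal this.le]
  · exact (ENNReal.continuous_ofReal.comp (continuous_const.mul gw_cont)).measurable.aemeasurable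
  · exact ae_of_all _ fun x => ENNReal.ofReal_lt_top

instance : IsProbabilityMeasure (gm V) := by
  constructor
  unfold gm
  rw [withDensity_apply _ MeasurableSet.univ, Measure.restrict_univ,
    ← ofReal_integral_eq_lintegral_ofReal]
  · rw [integral_const_mul, gc, inv_mul_cancel₀ gw_integral_pos.ne', ENNReal.ofReal_one]
  · exact gw_integrable.const_mul _
  · exact ae_of_all _ fun x => (mul_pos (gc_pos (V := V)) (gw_pos x)).le

lemma gm_sq_integrable : Integrable (fun x : V => ‖x‖ ^ 2) (gm V) := by
  rw [gm_integrable_iff]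
  refine (gw2_integrable.const_mul (gc V)).congr (ae_of_all _ fun x => ?_)
  simp only; ring

lemma gw_hasFDeriv (x v : V) : HasFDerivAt (gw : V → ℝ) (-(gw x) • (innerSL ℝ x)) x := by
  unfold gw
  have h1 : HasFDerivAt (fun y : V => ‖y‖ ^ 2) (2 • (innerSL ℝ x)) x :=
    (hasStrictFDerivAt_norm_sq x).hasFDerivAt
  have h := ((h1.const_mul (-(1/2) : ℝ))).exp
  refine h.congr_fderiv ?_
  ext y
  simp

lemma gm_inner_sq (v : V) : ∫ z, ⟪v, z⟫ ^ 2 ∂(gm V) = ‖v‖ ^ 2 := by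
  have key := integral_mul_fderiv_eq_neg_fderiv_mul_of_integrable (μ := (volume : Measure V))
    (f := fun z : V => ⟪v, z⟫) (g := (gw : V → ℝ)) (v := v)
    ?_ ?_ ?_ ?_ ?_
  · have e1 : ∀ z : V, fderiv ℝ (gw : V → ℝ) z v = -(gw z * ⟪v, z⟫) := by
      intro z
      rw [(gw_hasFDeriv z v).fderiv]
      simp [real_inner_comm]
    have e2 : ∀ z : V, fderiv ℝ (fun z : V => ⟪v, z⟫) z v = ‖v‖ ^ 2 := by
      intro z
      have : HasFDerivAt (fun z : V => ⟪v, z⟫) (innerSL ℝ v) z := (innerSL ℝ v).hasFDerivAt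
      rw [this.fderiv]; simp
    simp only [e1, e2] at key
    rw [gm_integral]
    have : ∫ x : V, (gc V * gw x) * ⟪v, x⟫ ^ 2 = - (gc V * ∫ x : V, ⟪v, x⟫ * -(gw x * ⟪v, x⟫)) := by
      rw [← integral_const_mul, ← integral_neg]
      congr 1; ext x; ring
    rw [this, key, integral_const_mul, gc]
    have := gw_integral_pos (V := V)
    field_simp
  · -- integrable fderiv f * g
    have e2 : ∀ z : V, fderiv ℝ (fun z : V => ⟪v, z⟫) z v = ‖v‖ ^ 2 := by
      intro z
      have : HasFDerivAt (fun z : V => ⟪v, z⟫) (innerSL ℝ v) z := (innerSL ℝ v).hasFDerivAt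
      rw [this.fderiv]; simp
    simp only [e2]
    exact gw_integrable.const_mul _
  · have e1 : ∀ z : V, fderiv ℝ (gw : V → ℝ) z v = -(gw z * ⟪v, z⟫) := by
      intro z
      rw [(gw_hasFDeriv z v).fderiv]
      simp [real_inner_comm]
    simp only [e1]
    refine (gw2_integrable.const_mul (‖v‖ ^ 2)).mono' ?_ ?_
    · exact Continuous.aestronglyMeasurable (by have := gw_cont (V := V); fun_prop)
    · refine ae_of_all _ fun z => ?_
      have h1 := abs_real_inner_le_norm v z
      have h2 : ⟪v, z⟫ ^ 2 ≤ (‖v‖ * ‖z‖) ^ 2 := sq_le_sq' (by linarith [neg_abs_le ⟪v, z⟫]) (by linarith [le_abs_self ⟪v, z⟫])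
      have h3 := gw_pos z
      rw [Real.norm_eq_abs, show ⟪v, z⟫ * -(gw z * ⟪v, z⟫) = -(⟪v, z⟫ ^ 2 * gw z) by ring, abs_neg,
        abs_of_nonneg (by positivity)]
      nlinarith
  · refine ((gw_integrable.add gw2_integrable).const_mul ‖v‖).mono' ?_ ?_
    · exact Continuous.aestronglyMeasurable (by have := gw_cont (V := V); fun_prop)
    · refine ae_of_all _ fun z => ?_
      have h1 := abs_real_inner_le_norm v z
      have h3 := gw_pos z
      rw [Real.norm_eq_abs, abs_mul, abs_of_pos h3]
      simp only [Pi.add_apply]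
      have h4 : ‖z‖ ≤ 1 + ‖z‖ ^ 2 := by nlinarith [sq_nonneg (‖z‖ - 1)]
      calc |⟪v, z⟫| * gw z ≤ (‖v‖ * ‖z‖) * gw z := by gcongr
        _ ≤ (‖v‖ * (1 + ‖z‖ ^ 2)) * gw z := by gcongr
        _ = _ := by ring
  · exact fun x _ => (innerSL ℝ v).differentiableAt
  · exact fun x _ => (gw_hasFDeriv x v).differentiableAt

/-- the heat operator with standard deviation `s` -/
def hs (s : ℝ) (f : V → ℝ) (x : V) : ℝ := ∫ z, f (x + s • z) ∂(gm V)

variable (V) in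
/-- heat kernel with standard deviation `s` -/
def hk (s : ℝ) (v : V) : ℝ := (s ^ finrank ℝ V)⁻¹ * gc V * Real.exp (-(‖v‖ ^ 2 / (2 * s ^ 2)))

lemma hs_eq {s : ℝ} (h : 0 < s) (f : V → ℝ) (x : V) :
    hs s f x = ∫ y, f y * hk V s (y - x) := by
  unfold hs
  rw [gm_integral]
  have e1 : ∀ z : V, (gc V * gw z) * f (x + s • z)
      = (fun y : V => gc V * Real.exp (-(‖y‖ ^ 2 / (2 * s ^ 2))) * f (x + y)) (s • z) := by
    intro z
    simp only [gw, norm_smul, Real.norm_of_nonneg h.le]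
    congr 3
    field_simp
  rw [integral_congr_ae (ae_of_all _ e1)]
  refine (Measure.integral_comp_smul volume
    (fun y : V => gc V * Real.exp (-(‖y‖ ^ 2 / (2 * s ^ 2))) * f (x + y)) s).trans ?_
  rw [← integral_sub_right_eq_self _ x, smul_eq_mul, ← integral_const_mul]
  congr 1; ext y
  simp only [hk]
  rw [abs_of_pos (by positivity)]
  rw [show x + (y - x) = y by abel]
  ring

lemma hs_nonneg {s : ℝ} {f : V → ℝ} (hf : ∀ x, 0 ≤ f x) (x : V) : 0 ≤ hs s f x :=
  integral_nonneg fun _ => hf _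

lemma bdd_integrable {f : V → ℝ} (hf : Continuous f) {M : ℝ} (hM : ∀ x, |f x| ≤ M)
    (x : V) (s : ℝ) : Integrable (fun z => f (x + s • z)) (gm V) := by
  refine Integrable.of_bound (C := M) ?_ (ae_of_all _ fun z => hM _)
  exact Continuous.aestronglyMeasurable (by fun_prop)

lemma hs_cont {f : V → ℝ} (hf : Continuous f) {M : ℝ} (hM : ∀ x, |f x| ≤ M) :
    Continuous (fun p : ℝ × V => hs p.1 f p.2) := by
  unfold hs
  refine continuous_of_dominated (bound := fun _ => M) ?_ ?_ ?_ ?_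
  · exact fun p => Continuous.aestronglyMeasurable (by fun_prop)
  · exact fun p => ae_of_all _ fun z => hM _
  · exact integrable_const _
  · exact ae_of_all _ fun z => by fun_prop

lemma hs_zero (f : V → ℝ) (x : V) : hs 0 f x = f x := by
  simp [hs]

lemma hs_mono {f g : V → ℝ} (hf : Continuous f) {M : ℝ} (hM : ∀ x, |f x| ≤ M)
    (hg : Continuous g) {M' : ℝ} (hM' : ∀ x, |g x| ≤ M') (h : ∀ x, f x ≤ g x) (s : ℝ) (x : V) :
    hs s f x ≤ hs s g x :=
  integral_mono (bdd_integrable hf hM x s) (bdd_integrable hg hM' x s) fun z => h _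

lemma hs_le {f : V → ℝ} (hf : Continuous f) {M : ℝ} (h0 : ∀ x, 0 ≤ f x) (hM : ∀ x, f x ≤ M)
    (s : ℝ) (x : V) : hs s f x ≤ M := by
  have := integral_mono (bdd_integrable hf (fun x => by rw [abs_of_nonneg (h0 x)]; exact hM x) x s)
    (integrable_const (μ := gm V) M) fun z => hM _
  simpa [hs] using this

variable (V) in
/-- second moment -/
def m2 : ℝ := ∫ z : V, ‖z‖ ^ 2 ∂(gm V)

lemma m2_nonneg : 0 ≤ m2 V := integral_nonneg fun _ => by positivity

lemma hs_markov {f : V → ℝ} (hf : Continuous f) {M : ℝ} (h0 : ∀ x, 0 ≤ f x) (hM : ∀ x, f x ≤ M)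
    {η : ℝ} (hη : 0 < η) (s : ℝ) (x : V) (hd : ∀ y, f y ≠ 0 → η ≤ ‖y - x‖) :
    hs s f x ≤ M * (m2 V * s ^ 2 / η ^ 2) := by
  have hM0 : 0 ≤ M := (h0 0).trans (hM 0)
  have h1 : ∀ z : V, f (x + s • z) ≤ (M * (s ^ 2 / η ^ 2)) * ‖z‖ ^ 2 := by
    intro z
    by_cases h : f (x + s • z) = 0
    · rw [h]; positivity
    · have := hd _ h
      rw [add_sub_cancel_left, norm_smul] at this
      have h2 : η ^ 2 ≤ (‖s‖ * ‖z‖) ^ 2 := by gcongr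
      rw [mul_pow, Real.norm_eq_abs, sq_abs] at h2
      calc f (x + s • z) ≤ M * 1 := by rw [mul_one]; exact hM _
        _ ≤ M * (s ^ 2 * ‖z‖ ^ 2 / η ^ 2) := by
          gcongr
          rw [le_div_iff₀ (by positivity)]; linarith
        _ = _ := by ring
  have := integral_mono (bdd_integrable hf (fun x => by rw [abs_of_nonneg (h0 x)]; exact hM x) x s)
    (gm_sq_integrable.const_mul _) h1
  rw [integral_const_mul] at this
  calc hs s f x ≤ _ := this
    _ = _ := by unfold m2; ring

end Gauss

end ACFproof

namespace ACFproof

open Topology Module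

section Heat

variable {V : Type*} [NormedAddCommGroup V] [InnerProductSpace ℝ V] [FiniteDimensional ℝ V]
  [MeasurableSpace V] [BorelSpace V]

lemma cs_integrable {f : V → ℝ} (hf : Continuous f) (hc : HasCompactSupport f) {k : V → ℝ}
    (hk : Continuous k) : Integrable (fun y => f y * k y) :=
  (hf.mul hk).integrable_of_hasCompactSupport hc.mul_right

lemma param_deriv {f : V → ℝ} (hf : Continuous f) (hc : HasCompactSupport f)
    {k k' : ℝ → V → ℝ} {a ε : ℝ} (hε : 0 < ε)
    (hk : ∀ t ∈ ball a ε, ∀ y, HasDerivAt (fun t => k t y) (k' t y) t)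
    (hkc : ∀ t ∈ ball a ε, Continuous (k t))
    (hkc' : ContinuousOn (fun p : ℝ × V => k' p.1 p.2) (ball a ε ×ˢ univ)) :
    HasDerivAt (fun t => ∫ y, f y * k t y) (∫ y, f y * k' a y) a := by
  have hK : IsCompact (closedBall a (ε/2) ×ˢ tsupport f) :=
    (isCompact_closedBall a (ε/2)).prod hc
  have hsub : (closedBall a (ε/2) ×ˢ tsupport f) ⊆ ball a ε ×ˢ univ :=
    prod_mono (closedBall_subset_ball (by linarith)) (subset_univ _)
  obtain ⟨C, hC⟩ := hK.exists_bound_of_continuousOn (hkc'.mono hsub)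
  have hk'a : Continuous (k' a) := by
    have : Continuous ((ball a ε ×ˢ univ).domRestrict (fun p : ℝ × V => k' p.1 p.2) ∘
        fun y : V => (⟨(a, y), by simp [hε]⟩ : (ball a ε ×ˢ univ : Set (ℝ × V)))) :=
      hkc'.domRestrict.comp (by fun_prop)
    exact this
  refine (hasDerivAt_integral_of_dominated_loc_of_deriv_le (F := fun t y => f y * k t y)
    (F' := fun t y => f y * k' t y) (bound := fun y => |C| * |f y|) (s := ball a (ε/2))
    (ball_mem_nhds a (by positivity)) ?_ ?_ ?_ ?_ ?_ ?_).2
  · filter_upwards [ball_mem_nhds a hε] with t ht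
    exact (hf.mul (hkc t ht)).aestronglyMeasurable
  · exact cs_integrable hf hc (hkc a (mem_ball_self hε))
  · exact (hf.mul hk'a).aestronglyMeasurable
  · refine ae_of_all _ fun y t ht => ?_
    rw [norm_mul, Real.norm_eq_abs, mul_comm]
    by_cases h : y ∈ tsupport f
    · have h1 := hC (t, y) ⟨ball_subset_closedBall ht, h⟩
      exact mul_le_mul_of_nonneg_right (h1.trans (le_abs_self C)) (abs_nonneg _)
    · rw [image_eq_zero_of_notMem_tsupport h]; simp
  · exact ((hf.abs).integrable_of_hasCompactSupport hc.norm).const_mul _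
  · refine ae_of_all _ fun y t ht => ?_
    exact (hk t (ball_subset_ball (by linarith) ht) y).const_mul _

variable (V) in
def kT (σ : ℝ) (v : V) : ℝ := hk V σ v * (‖v‖ ^ 2 / σ ^ 3 - finrank ℝ V / σ)
def k1 (σ : ℝ) (w v : V) : ℝ := hk V σ v * (⟪v, w⟫ / σ ^ 2)
def k2 (σ : ℝ) (w v : V) : ℝ := hk V σ v * (⟪v, w⟫ ^ 2 / σ ^ 4 - ‖w‖ ^ 2 / σ ^ 2)

def DT (σ : ℝ) (f : V → ℝ) (x : V) : ℝ := ∫ y, f y * kT V σ (y - x)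
def D1 (σ : ℝ) (f : V → ℝ) (w x : V) : ℝ := ∫ y, f y * k1 σ w (y - x)
def D2 (σ : ℝ) (f : V → ℝ) (w x : V) : ℝ := ∫ y, f y * k2 σ w (y - x)

lemma hk_cont (σ : ℝ) : Continuous (hk V σ) := by unfold hk; fun_prop

lemma hk_contOn {a ε : ℝ} (h : 0 < a - ε) :
    ContinuousOn (fun p : ℝ × V => hk V p.1 p.2) (ball a ε ×ˢ univ) := by
  unfold hk
  have h0 : ∀ p ∈ (ball a ε ×ˢ univ : Set (ℝ × V)), p.1 ≠ 0 := by
    rintro p ⟨hp, -⟩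
    rw [Real.ball_eq_Ioo] at hp
    exact (h.trans hp.1).ne'
  refine ContinuousOn.mul (ContinuousOn.mul (ContinuousOn.inv₀ (by fun_prop) ?_) (by fun_prop)) ?_
  · intro p hp; exact pow_ne_zero _ (h0 p hp)
  · refine Real.continuous_exp.comp_continuousOn (ContinuousOn.neg (ContinuousOn.div (by fun_prop) (by fun_prop) ?_))
    intro p hp; have := h0 p hp; positivity

lemma hk_derivT {σ : ℝ} (hσ : 0 < σ) (v : V) :
    HasDerivAt (fun σ => hk V σ v) (kT V σ v) σ := by
  unfold hk kT hk
  have h1 : HasDerivAt (fun σ : ℝ => (σ ^ finrank ℝ V)⁻¹) (-(finrank ℝ V * σ ^ (finrank ℝ V - 1)) / (σ ^ finrank ℝ V) ^ 2) σ :=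
    (hasDerivAt_pow _ σ).inv (by positivity)
  have h2 : HasDerivAt (fun σ : ℝ => -(‖v‖ ^ 2 / (2 * σ ^ 2))) (‖v‖ ^ 2 / σ ^ 3) σ := by
    have := (((hasDerivAt_pow 2 σ).const_mul 2).inv (by positivity)).const_mul (-‖v‖ ^ 2)
    refine (this.congr_deriv ?_).congr_of_eventuallyEq (Eventually.of_forall fun t => ?_)
    · field_simp; norm_num
    · simp only [div_eq_mul_inv, Pi.inv_apply]; ring
  refine ((h1.mul_const (gc V)).mul h2.exp).congr_deriv ?_
  have h3 : (-(finrank ℝ V * σ ^ (finrank ℝ V - 1)) / (σ ^ finrank ℝ V) ^ 2 : ℝ)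
     = - (finrank ℝ V / σ) * (σ ^ finrank ℝ V)⁻¹ := by
    rcases Nat.eq_zero_or_pos (finrank ℝ V) with h | h
    · rw [h]; simp
    · obtain ⟨m, hm⟩ := Nat.exists_eq_succ_of_ne_zero h.ne'
      rw [hm, Nat.succ_sub_one, Nat.succ_eq_add_one, pow_succ]
      field_simp
      rw [pow_succ]
  rw [h3]; ring

lemma hk_deriv1 {σ : ℝ} (hσ : 0 < σ) (w v : V) (t : ℝ) :
    HasDerivAt (fun t : ℝ => hk V σ (v - t • w)) (k1 σ w (v - t • w)) t := by
  unfold k1 hk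
  have h0 : HasDerivAt (fun t : ℝ => v - t • w) (-w) t := by
    simpa using ((hasDerivAt_id t).smul_const w).const_sub v
  have h2 := (h0.norm_sq).div_const (2 * σ ^ 2)
  refine ((h2.neg.exp).const_mul _).congr_deriv ?_
  rw [inner_neg_right]; simp only [Pi.neg_apply]; field_simp

lemma hk_deriv2 {σ : ℝ} (hσ : 0 < σ) (w v : V) (t : ℝ) :
    HasDerivAt (fun t : ℝ => k1 σ w (v - t • w)) (k2 σ w (v - t • w)) t := by
  have h0 : HasDerivAt (fun t : ℝ => v - t • w) (-w) t := by
    simpa using ((hasDerivAt_id t).smul_const w).const_sub v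
  have h1 : HasDerivAt (fun t : ℝ => ⟪v - t • w, w⟫ / σ ^ 2) (-‖w‖ ^ 2 / σ ^ 2) t := by
    have := (h0.inner ℝ (hasDerivAt_const t w)).div_const (σ ^ 2)
    simpa [inner_neg_left, real_inner_self_eq_norm_sq] using this
  refine ((hk_deriv1 hσ w v t).mul h1).congr_deriv ?_
  unfold k1 k2; field_simp; ring

lemma hs_derivT {f : V → ℝ} (hf : Continuous f) (hc : HasCompactSupport f) {σ : ℝ} (hσ : 0 < σ)
    (x : V) : HasDerivAt (fun σ => hs σ f x) (DT σ f x) σ := by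
  have h := param_deriv hf hc (k := fun σ y => hk V σ (y - x)) (k' := fun σ y => kT V σ (y - x))
    (a := σ) (ε := σ/2) (by positivity) ?_ ?_ ?_
  · refine h.congr_of_eventuallyEq ?_
    filter_upwards [lt_mem_nhds hσ] with t ht
    exact hs_eq ht f x
  · intro t ht y
    rw [Real.ball_eq_Ioo] at ht
    exact hk_derivT (by linarith [ht.1]) _
  · intro t ht; exact (hk_cont t).comp (by fun_prop)
  · have h1 : ContinuousOn (fun p : ℝ × V => kT V p.1 p.2) (ball σ (σ/2) ×ˢ univ) := by
      have h0 : ∀ p ∈ (ball σ (σ/2) ×ˢ univ : Set (ℝ × V)), p.1 ≠ 0 := by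
        rintro p ⟨hp, -⟩
        rw [Real.ball_eq_Ioo] at hp
        have := hp.1
        intro h; rw [h] at this; linarith
      unfold kT
      refine (hk_contOn (by linarith)).mul (ContinuousOn.sub (ContinuousOn.div (by fun_prop) (by fun_prop) ?_)
        (ContinuousOn.div (by fun_prop) (by fun_prop) ?_))
      · intro p hp; exact pow_ne_zero _ (h0 p hp)
      · intro p hp; exact h0 p hp
    exact h1.comp (f := fun p : ℝ × V => (p.1, p.2 - x)) (by fun_prop)
      (fun p hp => ⟨hp.1, mem_univ _⟩)

lemma k1_cont (σ : ℝ) (w : V) : Continuous (k1 σ w) := by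
  have := hk_cont (V := V) σ
  unfold k1; fun_prop
lemma k2_cont (σ : ℝ) (w : V) : Continuous (k2 σ w) := by
  have := hk_cont (V := V) σ
  unfold k2; fun_prop

lemma hs_deriv1 {f : V → ℝ} (hf : Continuous f) (hc : HasCompactSupport f) {σ : ℝ} (hσ : 0 < σ)
    (x w : V) (t : ℝ) : HasDerivAt (fun t : ℝ => hs σ f (x + t • w)) (D1 σ f w (x + t • w)) t := by
  simp only [hs_eq hσ, D1]
  have e : ∀ (t : ℝ) (y : V), y - (x + t • w) = (y - x) - t • w := fun t y => by abel
  simp only [e]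
  refine param_deriv hf hc (k := fun t y => hk V σ (y - x - t • w))
    (k' := fun t y => k1 σ w (y - x - t • w)) zero_lt_one ?_ ?_ ?_
  · intro s _ y; exact hk_deriv1 hσ w _ s
  · intro t _; exact (hk_cont σ).comp (by fun_prop)
  · exact ((k1_cont σ w).comp (by fun_prop)).continuousOn

lemma hs_deriv2 {f : V → ℝ} (hf : Continuous f) (hc : HasCompactSupport f) {σ : ℝ} (hσ : 0 < σ)
    (x w : V) (t : ℝ) : HasDerivAt (fun t : ℝ => D1 σ f w (x + t • w)) (D2 σ f w (x + t • w)) t := by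
  simp only [D2, D1]
  have e : ∀ (t : ℝ) (y : V), y - (x + t • w) = (y - x) - t • w := fun t y => by abel
  simp only [e]
  refine param_deriv hf hc (k := fun t y => k1 σ w (y - x - t • w))
    (k' := fun t y => k2 σ w (y - x - t • w)) zero_lt_one ?_ ?_ ?_
  · intro s _ y; exact hk_deriv2 hσ w _ s
  · intro t _; exact (k1_cont σ w).comp (by fun_prop)
  · exact ((k2_cont σ w).comp (by fun_prop)).continuousOn

lemma sum_D2 {f : V → ℝ} (hf : Continuous f) (hc : HasCompactSupport f) {σ : ℝ} (hσ : 0 < σ)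
    {ι : Type*} [Fintype ι] (b : OrthonormalBasis ι ℝ V) (x : V) :
    σ * ∑ i, D2 σ f (b i) x = DT σ f x := by
  unfold D2 DT
  rw [← integral_finsetSum, ← integral_const_mul]
  · congr 1; ext y
    rw [← Finset.mul_sum]
    unfold k2 kT
    rw [← Finset.mul_sum, Finset.sum_sub_distrib, ← Finset.sum_div, b.sum_sq_inner_left]
    simp only [b.norm_eq_one]
    have : (finrank ℝ V : ℝ) = Fintype.card ι := by rw [finrank_eq_card_basis b.toBasis]
    rw [this]
    simp
    field_simp
  · intro i _
    exact cs_integrable hf hc ((k2_cont σ (b i)).comp (by fun_prop))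

/-- second derivative test -/
lemma second_test {φ φ1 : ℝ → ℝ} {c : ℝ} (h1 : ∀ t, HasDerivAt φ (φ1 t) t)
    (h2 : HasDerivAt φ1 c 0) (hm : IsLocalMax φ 0) : φ1 0 = 0 ∧ c ≤ 0 := by
  have e : deriv φ = φ1 := funext fun t => (h1 t).deriv
  have h0 : φ1 0 = 0 := by rw [← e]; exact hm.deriv_eq_zero
  refine ⟨h0, ?_⟩
  by_contra hcon
  push Not at hcon
  have hmin : IsLocalMin φ 0 :=
    isLocalMin_of_deriv_deriv_pos (by rw [e, h2.deriv]; exact hcon) (by rw [e, h0])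
      (h1 0).continuousAt
  have hconst : φ =ᶠ[𝓝 0] fun _ => φ 0 := by
    filter_upwards [hmin, hm] with t a b
    exact le_antisymm b a
  have hd : φ1 =ᶠ[𝓝 0] fun _ => 0 := by
    filter_upwards [hconst.eventuallyEq_nhds] with t ht
    rw [← e, ht.deriv_eq]; simp
  have : c = 0 := by
    rw [← h2.deriv, hd.deriv_eq]; simp
  linarith

lemma line_cont (x w : V) : Continuous (fun t : ℝ => x + t • w) := by fun_prop

lemma core {f g : V → ℝ} (hf : Continuous f) (hfc : HasCompactSupport f)
    (hg : Continuous g) (hgc : HasCompactSupport g) {σ : ℝ} (hσ : 0 < σ) {x y : V} (hxy : x ≠ y)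
    {M : ℝ} (hM : 0 < M)
    (hle : ∀ᶠ p : V × V in 𝓝 (x, y), hs σ f p.1 * hs σ g p.2 ≤ M * ‖p.1 - p.2‖ ^ 2)
    (heq : hs σ f x * hs σ g y = M * ‖x - y‖ ^ 2) :
    DT σ f x * hs σ g y + hs σ f x * DT σ g y ≤ 0 := by
  set D := x - y with hD
  have hD0 : D ≠ 0 := sub_ne_zero.2 hxy
  have hd : 0 < ‖D‖ ^ 2 := by positivity
  have line : ∀ w v : V,
      (D1 σ f w x * hs σ g y + hs σ f x * D1 σ g v y = M * (2 * ⟪D, w - v⟫)) ∧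
      D2 σ f w x * hs σ g y + 2 * (D1 σ f w x * D1 σ g v y) + hs σ f x * D2 σ g v y
        ≤ M * (2 * ‖w - v‖ ^ 2) := by
    intro w v
    have ev : ∀ᶠ t : ℝ in 𝓝 0, hs σ f (x + t • w) * hs σ g (y + t • v)
        ≤ M * ‖(x + t • w) - (y + t • v)‖ ^ 2 := by
      have : Tendsto (fun t : ℝ => (x + t • w, y + t • v)) (𝓝 0) (𝓝 (x, y)) := by
        have : Continuous (fun t : ℝ => (x + t • w, y + t • v)) := by fun_prop
        simpa using this.tendsto 0
      exact this.eventually hle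
    have en : ∀ t : ℝ, ‖(x + t • w) - (y + t • v)‖ ^ 2
        = ‖D‖ ^ 2 + 2 * ⟪D, w - v⟫ * t + ‖w - v‖ ^ 2 * t ^ 2 := by
      intro t
      rw [show (x + t • w) - (y + t • v) = D + t • (w - v) by rw [hD, smul_sub]; abel,
        norm_add_sq_real, inner_smul_right, norm_smul, mul_pow, Real.norm_eq_abs, sq_abs]
      ring
    have t1 := second_test
      (φ := fun t : ℝ => hs σ f (x + t • w) * hs σ g (y + t • v)
        - M * (‖D‖ ^ 2 + 2 * ⟪D, w - v⟫ * t + ‖w - v‖ ^ 2 * t ^ 2))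
      (φ1 := fun t : ℝ => (D1 σ f w (x + t • w) * hs σ g (y + t • v)
        + hs σ f (x + t • w) * D1 σ g v (y + t • v))
        - M * (2 * ⟪D, w - v⟫ + ‖w - v‖ ^ 2 * (2 * t)))
      (c := ((D2 σ f w x * hs σ g y + D1 σ f w x * D1 σ g v y)
        + (D1 σ f w x * D1 σ g v y + hs σ f x * D2 σ g v y)) - M * (‖w - v‖ ^ 2 * 2))
      ?_ ?_ ?_
    · obtain ⟨a, b⟩ := t1
      simp at a
      constructor
      · linarith
      · linarith
    · intro t
      refine (((hs_deriv1 hf hfc hσ x w t).mul (hs_deriv1 hg hgc hσ y v t))).sub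
        (HasDerivAt.const_mul M ?_)
      have := ((hasDerivAt_id t).const_mul (2 * ⟪D, w - v⟫)).const_add (‖D‖ ^ 2)
      have h2 := this.add ((hasDerivAt_pow 2 t).const_mul (‖w - v‖ ^ 2))
      refine h2.congr_deriv ?_
      simp
    · have a1 := hs_deriv1 hf hfc hσ x w 0
      have a2 := hs_deriv2 hf hfc hσ x w 0
      have b1 := hs_deriv1 hg hgc hσ y v 0
      have b2 := hs_deriv2 hg hgc hσ y v 0
      have := ((a2.mul b1).add (a1.mul b2)).sub
        ((((hasDerivAt_id (0:ℝ)).const_mul 2).const_mul (‖w - v‖ ^ 2)).const_add (2 * ⟪D, w - v⟫)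
          |>.const_mul M)
      refine this.congr_deriv ?_
      simp
    · filter_upwards [ev] with t ht
      rw [en] at ht
      simp only [zero_smul, add_zero, heq]
      linarith
  have F0 : hs σ f x * hs σ g y ≠ 0 := by rw [heq]; positivity
  have hf0 : hs σ f x ≠ 0 := left_ne_zero_of_mul F0
  have hg0 : hs σ g y ≠ 0 := right_ne_zero_of_mul F0
  have z1 : ∀ u : V → ℝ, ∀ x, D1 σ u 0 x = 0 := by intro u x; simp [D1, k1]
  have L1 : ∀ w, D1 σ f w x * hs σ g y = M * (2 * ⟪D, w⟫) := by
    intro w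
    have := (line w 0).1
    rw [z1] at this
    simpa using this
  have L2 : ∀ v, hs σ f x * D1 σ g v y = - (M * (2 * ⟪D, v⟫)) := by
    intro v
    have := (line 0 v).1
    rw [z1] at this
    simpa using this
  set R := (ℝ ∙ D)ᗮ.reflection with hR
  have hRw : ∀ w, R w = w - (2 * ⟪D, w⟫ / ‖D‖ ^ 2) • D := by
    intro w
    rw [hR, Submodule.reflection_orthogonal_apply, Submodule.reflection_singleton_apply]
    simp only [neg_sub, RCLike.ofReal_real_eq_id, id]
    module
  have key : ∀ w, D2 σ f w x * hs σ g y + hs σ f x * D2 σ g (R w) y ≤ 0 := by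
    intro w
    have h := (line w (R w)).2
    have a := L1 w
    have b := L2 (R w)
    have c : ⟪D, R w⟫ = - ⟪D, w⟫ := by
      rw [hRw, inner_sub_right, inner_smul_right, real_inner_self_eq_norm_sq]
      field_simp; ring
    have e : ‖w - R w‖ ^ 2 = 4 * ⟪D, w⟫ ^ 2 / ‖D‖ ^ 2 := by
      rw [hRw, sub_sub_cancel, norm_smul, mul_pow, Real.norm_eq_abs, sq_abs]
      field_simp; ring
    have p : (D1 σ f w x * D1 σ g (R w) y) * (M * ‖D‖ ^ 2) = (M * (2 * ⟪D, w⟫)) * (M * (2 * ⟪D, w⟫)) := by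
      rw [← heq]
      rw [c] at b
      calc _ = (D1 σ f w x * hs σ g y) * (hs σ f x * D1 σ g (R w) y) := by ring
        _ = _ := by rw [a, b]; ring
    have p' : D1 σ f w x * D1 σ g (R w) y = M * (4 * ⟪D, w⟫ ^ 2 / ‖D‖ ^ 2) := by
      field_simp
      have h5 : M * ((D1 σ f w x * D1 σ g (R w) y) * ‖D‖ ^ 2) = M * (M * 4 * ⟪D, w⟫ ^ 2) := by linarith
      have := mul_left_cancel₀ hM.ne' h5
      linarith
    rw [e, p'] at h
    linarith
  let b := stdOrthonormalBasis ℝ V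
  have s1 := sum_D2 hf hfc hσ b x
  have s2 := sum_D2 hg hgc hσ (b.map R) y
  have : σ * ∑ i, (D2 σ f (b i) x * hs σ g y + hs σ f x * D2 σ g (R (b i)) y) ≤ 0 :=
    mul_nonpos_of_nonneg_of_nonpos hσ.le (Finset.sum_nonpos fun i _ => key _)
  rw [Finset.sum_add_distrib, ← Finset.sum_mul, ← Finset.mul_sum] at this
  rw [← s1, ← s2]
  simp only [OrthonormalBasis.map_apply]
  linarith

lemma left_test {ζ : ℝ → ℝ} {c a : ℝ} (h : HasDerivAt ζ c a)
    (hl : ∀ᶠ t in 𝓝[<] a, ζ t ≤ ζ a) : 0 ≤ c := by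
  have h1 : Tendsto (slope ζ a) (𝓝[<] a) (𝓝 c) :=
    (hasDerivAt_iff_tendsto_slope.1 h).mono_left (nhdsWithin_mono _ fun t ht => ne_of_lt ht)
  refine ge_of_tendsto h1 ?_
  filter_upwards [hl, self_mem_nhdsWithin] with t ht hta
  rw [slope_def_field]
  exact div_nonneg_of_nonpos (by linarith) (by have : t < a := hta; linarith)

lemma cs_bound {f : V → ℝ} (hf : Continuous f) (hc : HasCompactSupport f) :
    ∃ M, 0 < M ∧ ∀ x, |f x| ≤ M := by
  obtain ⟨M, hM⟩ := hc.exists_bound_of_continuous hf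
  exact ⟨|M| + 1, by positivity, fun x => ((hM x).trans (le_abs_self M)).trans (by linarith)⟩

lemma heat_lemma {f g : V → ℝ} (hf : Continuous f) (hfc : HasCompactSupport f)
    (hg : Continuous g) (hgc : HasCompactSupport g) (hf0 : ∀ x, 0 ≤ f x) (hg0 : ∀ x, 0 ≤ g x)
    {δ τ : ℝ} (hδ : 0 < δ)
    (h0 : ∀ x y, f x * g y ≤ ‖x - y‖ ^ 2)
    (h1 : ∀ σ ∈ Icc 0 τ, ∀ x y : V, ‖x - y‖ ≤ δ → hs σ f x * hs σ g y ≤ δ ^ 2) :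
    ∀ σ ∈ Icc 0 τ, ∀ x y : V, δ ≤ ‖x - y‖ → hs σ f x * hs σ g y ≤ ‖x - y‖ ^ 2 := by
  intro σ1 hσ1 x1 y1 hd1
  by_contra hcon
  push Not at hcon
  obtain ⟨Mf, hMf0, hMf⟩ := cs_bound hf hfc
  obtain ⟨Mg, hMg0, hMg⟩ := cs_bound hg hgc
  have hMf' : ∀ x, f x ≤ Mf := fun x => (le_abs_self _).trans (hMf x)
  have hMg' : ∀ x, g x ≤ Mg := fun x => (le_abs_self _).trans (hMg x)
  -- continuity
  have hFc : Continuous (fun p : ℝ × V × V => hs p.1 f p.2.1 * hs p.1 g p.2.2) :=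
    ((hs_cont hf hMf).comp (f := fun p : ℝ × V × V => (p.1, p.2.1)) (by fun_prop)).mul
      ((hs_cont hg hMg).comp (f := fun p : ℝ × V × V => (p.1, p.2.2)) (by fun_prop))
  -- epsilon
  obtain ⟨ε, hε, hεc⟩ : ∃ ε > 0, ‖x1 - y1‖ ^ 2 < Real.exp (-(ε * σ1)) * (hs σ1 f x1 * hs σ1 g y1) := by
    have : Tendsto (fun ε : ℝ => Real.exp (-(ε * σ1)) * (hs σ1 f x1 * hs σ1 g y1)) (𝓝[>] 0)
        (𝓝 (hs σ1 f x1 * hs σ1 g y1)) := by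
      have hc : Continuous (fun ε : ℝ => Real.exp (-(ε * σ1)) * (hs σ1 f x1 * hs σ1 g y1)) := by
        fun_prop
      have := hc.tendsto 0
      simp only [zero_mul, neg_zero, Real.exp_zero, one_mul] at this
      exact this.mono_left nhdsWithin_le_nhds
    obtain ⟨ε, h, h'⟩ := ((this.eventually (lt_mem_nhds hcon)).and self_mem_nhdsWithin).exists
    exact ⟨ε, h', h⟩
  -- radius
  obtain ⟨R0, hR0⟩ : ∃ R0, tsupport f ∪ tsupport g ⊆ ball 0 R0 :=
    (hfc.isBounded.union hgc.isBounded).subset_ball 0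
  set η : ℝ := 1 + Mf * Mg * m2 V * τ ^ 2 / δ ^ 2 with hη
  have hm2 := m2_nonneg (V := V)
  have hη1 : 1 ≤ η := by
    have : 0 ≤ Mf * Mg * m2 V * τ ^ 2 / δ ^ 2 := by positivity
    linarith
  have hηb : Mf * Mg * (m2 V * τ ^ 2 / η ^ 2) ≤ δ ^ 2 := by
    have h2 : Mf * Mg * m2 V * τ ^ 2 / δ ^ 2 ≤ η ^ 2 := by nlinarith
    rw [div_le_iff₀ (by positivity)] at h2
    calc Mf * Mg * (m2 V * τ ^ 2 / η ^ 2) = (Mf * Mg * m2 V * τ ^ 2) / η ^ 2 := by ring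
      _ ≤ _ := by rw [div_le_iff₀ (by positivity)]; linarith
  set ρ : ℝ := max (R0 + η) (max (‖x1‖ + 1) (‖y1‖ + 1)) with hρ
  have hρ1 : R0 + η ≤ ρ := le_max_left _ _
  have hρ2 : ‖x1‖ + 1 ≤ ρ := (le_max_left _ _).trans (le_max_right _ _)
  have hρ3 : ‖y1‖ + 1 ≤ ρ := (le_max_right _ _).trans (le_max_right _ _)
  have far : ∀ {u : V → ℝ}, tsupport u ⊆ ball 0 R0 → ∀ x : V, ρ ≤ ‖x‖ → ∀ y, u y ≠ 0 → η ≤ ‖y - x‖ := by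
    intro u hu x hx y hy
    have h3 : y ∈ ball (0:V) R0 := hu (subset_tsupport _ hy)
    rw [mem_ball_zero_iff] at h3
    have := norm_sub_norm_le x y
    rw [norm_sub_rev] at this
    linarith
  have out : ∀ σ ∈ Icc 0 τ, ∀ x y : V, ρ ≤ ‖x‖ ∨ ρ ≤ ‖y‖ → hs σ f x * hs σ g y ≤ δ ^ 2 := by
    intro σ hσ x y hxy
    have hσ2 : σ ^ 2 ≤ τ ^ 2 := by have := hσ.1; have := hσ.2; gcongr
    rcases hxy with h | h
    · have a := hs_markov hf hf0 hMf' (by linarith : 0 < η) σ x (far (subset_union_left.trans hR0) x h)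
      have b := hs_le hg hg0 hMg' σ y
      have c := hs_nonneg hg0 y (s := σ)
      calc hs σ f x * hs σ g y ≤ (Mf * (m2 V * σ ^ 2 / η ^ 2)) * Mg := by gcongr
        _ ≤ (Mf * (m2 V * τ ^ 2 / η ^ 2)) * Mg := by gcongr
        _ ≤ _ := by linarith
    · have a := hs_markov hg hg0 hMg' (by linarith : 0 < η) σ y (far (subset_union_right.trans hR0) y h)
      have b := hs_le hf hf0 hMf' σ x
      have c := hs_nonneg hg0 y (s := σ)
      calc hs σ f x * hs σ g y ≤ Mf * (Mg * (m2 V * σ ^ 2 / η ^ 2)) := by gcongr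
        _ ≤ Mf * (Mg * (m2 V * τ ^ 2 / η ^ 2)) := by gcongr
        _ ≤ _ := by linarith
  -- compact set
  set K : Set (ℝ × V × V) := (Icc 0 τ ×ˢ (closedBall 0 ρ ×ˢ closedBall 0 ρ)) ∩ {p | δ ≤ ‖p.2.1 - p.2.2‖}
    with hK
  have hKc : IsCompact K := by
    refine (isCompact_Icc.prod ((isCompact_closedBall _ _).prod (isCompact_closedBall _ _))).inter_right ?_
    exact isClosed_le (by fun_prop) (by fun_prop)
  have hp1 : ((σ1, x1, y1) : ℝ × V × V) ∈ K := by
    refine ⟨⟨hσ1, ?_, ?_⟩, hd1⟩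
    · simp; linarith
    · simp; linarith
  obtain ⟨⟨σ0, x0, y0⟩, hp0, hmax⟩ := hKc.exists_isMaxOn ⟨_, hp1⟩
    (f := fun p : ℝ × V × V => Real.exp (-(ε * p.1)) * (hs p.1 f p.2.1 * hs p.1 g p.2.2) / ‖p.2.1 - p.2.2‖ ^ 2)
    (by
      refine ContinuousOn.div (Continuous.continuousOn ?_) (by fun_prop) ?_
      · exact (Continuous.mul (by fun_prop) hFc)
      · rintro p ⟨-, hp⟩
        have : 0 < ‖p.2.1 - p.2.2‖ := hδ.trans_le hp
        positivity)
  obtain ⟨⟨hσ0, hx0, hy0⟩, hd0⟩ := hp0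
  simp only [mem_ofPred_eq, mem_closedBall_zero_iff] at hσ0 hx0 hy0 hd0
  have hd0' : 0 < ‖x0 - y0‖ := hδ.trans_le hd0
  have hgt1 : 1 < Real.exp (-(ε * σ0)) * (hs σ0 f x0 * hs σ0 g y0) / ‖x0 - y0‖ ^ 2 := by
    refine lt_of_lt_of_le ?_ (hmax hp1)
    have : 0 < ‖x1 - y1‖ := hδ.trans_le hd1
    simp only
    rw [lt_div_iff₀ (by positivity), one_mul]
    exact hεc
  have hFpos : ‖x0 - y0‖ ^ 2 < hs σ0 f x0 * hs σ0 g y0 := by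
    rw [lt_div_iff₀ (by positivity), one_mul] at hgt1
    refine hgt1.trans_le ?_
    have a : Real.exp (-(ε * σ0)) ≤ 1 := Real.exp_le_one_iff.2 (by have := hσ0.1; have := mul_nonneg hε.le hσ0.1; linarith)
    have b : 0 ≤ hs σ0 f x0 * hs σ0 g y0 := mul_nonneg (hs_nonneg hf0 _) (hs_nonneg hg0 _)
    nlinarith
  have hδF : δ ^ 2 < hs σ0 f x0 * hs σ0 g y0 := lt_of_le_of_lt (by gcongr) hFpos
  have hx0' : ‖x0‖ < ρ := by
    by_contra h; push Not at h
    exact absurd (out σ0 hσ0 x0 y0 (Or.inl h)) (not_le.2 hδF)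
  have hy0' : ‖y0‖ < ρ := by
    by_contra h; push Not at h
    exact absurd (out σ0 hσ0 x0 y0 (Or.inr h)) (not_le.2 hδF)
  have hd0'' : δ < ‖x0 - y0‖ := by
    by_contra h; push Not at h
    exact absurd (h1 σ0 hσ0 x0 y0 h) (not_le.2 hδF)
  have hσ0' : 0 < σ0 := by
    rcases hσ0.1.eq_or_lt with h | h
    · rw [← h, hs_zero, hs_zero] at hFpos
      exact absurd (h0 x0 y0) (not_le.2 hFpos)
    · exact h
  set F0 := hs σ0 f x0 * hs σ0 g y0 with hF0
  have hF0pos : 0 < F0 := (by positivity : 0 < δ ^ 2).trans hδF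
  have hcore : DT σ0 f x0 * hs σ0 g y0 + hs σ0 f x0 * DT σ0 g y0 ≤ 0 := by
    refine core hf hfc hg hgc hσ0' (by rintro rfl; simp at hd0') (M := F0 / ‖x0 - y0‖ ^ 2) (by positivity) ?_ ?_
    · have e1 : ∀ᶠ p : V × V in 𝓝 (x0, y0), ‖p.1‖ < ρ :=
        (continuous_fst.norm).tendsto (x0, y0) |>.eventually (gt_mem_nhds hx0')
      have e2 : ∀ᶠ p : V × V in 𝓝 (x0, y0), ‖p.2‖ < ρ :=
        (continuous_snd.norm).tendsto (x0, y0) |>.eventually (gt_mem_nhds hy0')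
      have e3 : ∀ᶠ p : V × V in 𝓝 (x0, y0), δ < ‖p.1 - p.2‖ :=
        ((continuous_fst.sub continuous_snd).norm).tendsto (x0, y0) |>.eventually (lt_mem_nhds hd0'')
      filter_upwards [e1, e2, e3] with p a b c
      have := hmax (show (σ0, p.1, p.2) ∈ K from ⟨⟨hσ0, by simpa using a.le, by simpa using b.le⟩, c.le⟩)
      simp only [mem_ofPred_eq] at this
      have hp : 0 < ‖p.1 - p.2‖ := hδ.trans c
      have this2 : Real.exp (-(ε * σ0)) * (hs σ0 f p.1 * hs σ0 g p.2 / ‖p.1 - p.2‖ ^ 2) ≤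
          Real.exp (-(ε * σ0)) * (F0 / ‖x0 - y0‖ ^ 2) := by
        rw [← mul_div_assoc, ← mul_div_assoc]; exact this
      have := le_of_mul_le_mul_left this2 (Real.exp_pos _)
      rwa [div_le_iff₀ (by positivity)] at this
    · field_simp; rfl
  have hder : HasDerivAt (fun σ => Real.exp (-(ε * σ)) * (hs σ f x0 * hs σ g y0))
      (Real.exp (-(ε * σ0)) * (-ε) * F0 + Real.exp (-(ε * σ0)) * (DT σ0 f x0 * hs σ0 g y0 + hs σ0 f x0 * DT σ0 g y0)) σ0 := by
    have a : HasDerivAt (fun σ : ℝ => -(ε * σ)) (-ε) σ0 := by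
      have := ((hasDerivAt_id σ0).const_mul ε).neg
      rw [mul_one] at this
      exact this
    exact a.exp.mul ((hs_derivT hf hfc hσ0' x0).mul (hs_derivT hg hgc hσ0' y0))
  have := left_test hder (by
    have : ∀ᶠ t in 𝓝[<] σ0, 0 < t := nhdsWithin_le_nhds (lt_mem_nhds hσ0')
    filter_upwards [this, self_mem_nhdsWithin] with t ht ht'
    have := hmax (show (t, x0, y0) ∈ K from ⟨⟨⟨ht.le, (le_of_lt ht').trans hσ0.2⟩, by simpa using hx0, by simpa using hy0⟩, hd0⟩)
    simp only [mem_ofPred_eq] at this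
    exact (div_le_div_iff_of_pos_right (by positivity)).1 this)
  have e := Real.exp_pos (-(ε * σ0))
  have : Real.exp (-(ε * σ0)) * (-ε) * F0 < 0 := by
    have := mul_pos (mul_pos e hε) hF0pos
    linarith
  nlinarith

end Heat

end ACFproof

namespace ACFproof

open Topology Module

section OU

variable {V : Type*} [NormedAddCommGroup V] [InnerProductSpace ℝ V] [FiniteDimensional ℝ V]
  [MeasurableSpace V] [BorelSpace V]

/-- Ornstein-Uhlenbeck type operator -/
def Pou (s : ℝ) (f : V → ℝ) (x : V) : ℝ := hs s f (√(1 - s ^ 2) • x)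

lemma Pou_cont {f : V → ℝ} (hf : Continuous f) {M : ℝ} (hM : ∀ x, |f x| ≤ M) (s : ℝ) :
    Continuous (Pou s f) := by
  unfold Pou
  exact (hs_cont hf hM).comp (f := fun x : V => (s, √(1 - s ^ 2) • x)) (by fun_prop)

lemma hk_le {s : ℝ} (hs : 0 < s) (v : V) : hk V s v ≤ (s ^ finrank ℝ V)⁻¹ * gc V := by
  unfold hk
  have : Real.exp (-(‖v‖ ^ 2 / (2 * s ^ 2))) ≤ 1 := Real.exp_le_one_iff.2 (by
    have : 0 ≤ ‖v‖ ^ 2 / (2 * s ^ 2) := by positivity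
    linarith)
  have h2 : 0 < (s ^ finrank ℝ V)⁻¹ * gc V := mul_pos (by positivity) gc_pos
  nlinarith

lemma hk_nonneg {s : ℝ} (hs : 0 < s) (v : V) : 0 ≤ hk V s v := by
  unfold hk
  have := gc_pos (V := V)
  positivity

lemma ou_kernel_symm {s : ℝ} (h0 : 0 < s) (h1 : s < 1) (x y : V) :
    gw x * hk V s (y - √(1 - s ^ 2) • x) = gw y * hk V s (x - √(1 - s ^ 2) • y) := by
  set c := √(1 - s ^ 2) with hc
  have hc2 : c ^ 2 = 1 - s ^ 2 := Real.sq_sqrt (by nlinarith)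
  unfold gw hk
  have e : ∀ x y : V, -(1/2) * ‖x‖ ^ 2 + -(‖y - c • x‖ ^ 2 / (2 * s ^ 2))
      = - ((‖x‖ ^ 2 + ‖y‖ ^ 2 - 2 * c * ⟪x, y⟫) / (2 * s ^ 2)) := by
    intro x y
    rw [norm_sub_sq_real, inner_smul_right, norm_smul, mul_pow, Real.norm_eq_abs, sq_abs, hc2,
      real_inner_comm]
    field_simp
    ring
  have e2 : ∀ x y : V, Real.exp (-(1/2) * ‖x‖ ^ 2) * ((s ^ finrank ℝ V)⁻¹ * gc V * Real.exp (-(‖y - c • x‖ ^ 2 / (2 * s ^ 2))))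
      = (s ^ finrank ℝ V)⁻¹ * gc V * Real.exp (- ((‖x‖ ^ 2 + ‖y‖ ^ 2 - 2 * c * ⟪x, y⟫) / (2 * s ^ 2))) := by
    intro x y
    rw [← e x y, Real.exp_add]; ring
  rw [e2, e2, real_inner_comm x y]
  ring_nf

lemma Pou_symm {s : ℝ} (h0 : 0 < s) (h1 : s < 1) {u v : V → ℝ} (hu : Continuous u)
    (huc : HasCompactSupport u) (hv : Continuous v) {M : ℝ} (hM : ∀ x, |v x| ≤ M) :
    ∫ x, Pou s u x * v x ∂(gm V) = ∫ x, u x * Pou s v x ∂(gm V) := by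
  set c := √(1 - s ^ 2) with hc
  have hM0 : 0 ≤ M := (abs_nonneg _).trans (hM 0)
  have hgc := gc_pos (V := V)
  have hcont := hk_cont (V := V) s
  have hgw := gw_cont (V := V)
  have hui : Integrable u := hu.integrable_of_hasCompactSupport huc
  rw [gm_integral, gm_integral]
  have e1 : ∀ x, (gc V * gw x) * (Pou s u x * v x)
      = ∫ y, (gc V * gw x) * (v x * (u y * hk V s (y - c • x))) := by
    intro x
    rw [Pou, hs_eq h0, integral_const_mul, integral_const_mul]; ring
  have e2 : ∀ y, (gc V * gw y) * (u y * Pou s v y)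
      = ∫ x, (gc V * gw x) * (v x * (u y * hk V s (y - c • x))) := by
    intro y
    rw [Pou, hs_eq h0, ← integral_const_mul, ← integral_const_mul]
    congr 1; ext x
    have := ou_kernel_symm h0 h1 x y
    rw [← hc] at this ⊢
    calc _ = gc V * u y * v x * (gw y * hk V s (x - c • y)) := by ring
      _ = _ := by rw [← this]; ring
  simp_rw [e1, e2]
  apply integral_integral_swap
  have hb : Integrable (fun p : V × V => (gw p.1) * (u p.2)) (volume.prod volume) :=
    gw_integrable.mul_prod hui
  refine (hb.norm.const_mul (gc V * (M * ((s ^ finrank ℝ V)⁻¹ * gc V)))).mono' ?_ ?_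
  · refine Continuous.aestronglyMeasurable ?_
    simp only [Function.uncurry_def]
    fun_prop
  · refine ae_of_all _ fun p => ?_
    simp only [Function.uncurry_def, norm_mul, Real.norm_eq_abs, abs_of_pos hgc, abs_of_pos (gw_pos p.1),
      abs_of_nonneg (hk_nonneg h0 _)]
    have a := hM p.1
    have b := hk_le h0 (p.2 - c • p.1)
    have hg := gw_pos p.1
    have hk0 := hk_nonneg h0 (p.2 - c • p.1)
    calc gc V * gw p.1 * (|v p.1| * (|u p.2| * hk V s (p.2 - c • p.1)))
        ≤ gc V * gw p.1 * (M * (|u p.2| * ((s ^ finrank ℝ V)⁻¹ * gc V))) := by gcongr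
      _ = _ := by ring

lemma Pou_one (s : ℝ) (x : V) : Pou s (fun _ => 1) x = 1 := by
  simp [Pou, hs]

/-- truncated operator -/
def Tou (s : ℝ) (χ f : V → ℝ) (x : V) : ℝ := χ x * Pou s (fun y => χ y * f y) x

lemma Tou_cs {s : ℝ} {χ f : V → ℝ} (hχ : Continuous χ) (hχc : HasCompactSupport χ)
    (hf : Continuous f) : Continuous (Tou s χ f) ∧ HasCompactSupport (Tou s χ f) := by
  obtain ⟨M, -, hM⟩ := cs_bound (hχ.mul hf) hχc.mul_right
  exact ⟨hχ.mul (Pou_cont (hχ.mul hf) hM s), hχc.mul_right⟩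

lemma Tou_symm {s : ℝ} (h0 : 0 < s) (h1 : s < 1) {χ u v : V → ℝ} (hχ : Continuous χ)
    (hχc : HasCompactSupport χ) (hu : Continuous u) (hv : Continuous v) :
    ∫ x, Tou s χ u x * v x ∂(gm V) = ∫ x, u x * Tou s χ v x ∂(gm V) := by
  obtain ⟨M, -, hM⟩ := cs_bound (hχ.mul hv) hχc.mul_right
  have := Pou_symm h0 h1 (hχ.mul hu) hχc.mul_right (hχ.mul hv) hM
  calc _ = ∫ x, Pou s (fun y => χ y * u y) x * (χ x * v x) ∂(gm V) := by
        congr 1; ext x; unfold Tou; ring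
    _ = _ := this
    _ = _ := by congr 1; ext x; unfold Tou; simp only [Pi.mul_apply]; ring_nf; rfl

lemma Tou_iter_cs {s : ℝ} {χ f : V → ℝ} (hχ : Continuous χ) (hχc : HasCompactSupport χ)
    (hf : Continuous f) (hfc : HasCompactSupport f) (m : ℕ) :
    Continuous ((Tou s χ)^[m] f) ∧ HasCompactSupport ((Tou s χ)^[m] f) := by
  induction m with
  | zero => exact ⟨hf, hfc⟩
  | succ m ih => rw [Function.iterate_succ_apply']; exact Tou_cs hχ hχc ih.1

lemma Tou_iter_symm {s : ℝ} (h0 : 0 < s) (h1 : s < 1) {χ u v : V → ℝ} (hχ : Continuous χ)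
    (hχc : HasCompactSupport χ) (hu : Continuous u) (hv : Continuous v) (huc : HasCompactSupport u)
    (hvc : HasCompactSupport v) (m : ℕ) :
    ∫ x, (Tou s χ)^[m] u x * v x ∂(gm V) = ∫ x, u x * (Tou s χ)^[m] v x ∂(gm V) := by
  induction m generalizing v with
  | zero => rfl
  | succ m ih =>
    rw [Function.iterate_succ_apply', Tou_symm h0 h1 hχ hχc (Tou_iter_cs hχ hχc hu huc m).1 hv,
      ih (Tou_cs hχ hχc hv).1 (Tou_cs hχ hχc hv).2, ← Function.iterate_succ_apply]

lemma gm_cs_int {f : V → ℝ} (hf : Continuous f) (hc : HasCompactSupport f) : Integrable f (gm V) := by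
  obtain ⟨M, -, hM⟩ := cs_bound hf hc
  exact Integrable.of_bound hf.aestronglyMeasurable M (ae_of_all _ hM)

lemma cs_sq {f : V → ℝ} (hc : HasCompactSupport f) : HasCompactSupport (fun x => f x ^ 2) :=
  hc.comp_left (g := fun t : ℝ => t ^ 2) (by simp)

lemma gm_cauchy {u f : V → ℝ} (hu : Continuous u) (huc : HasCompactSupport u)
    (hf : Continuous f) (hfc : HasCompactSupport f) (ha : 0 < ∫ x, f x ^ 2 ∂(gm V)) :
    (∫ x, u x * f x ∂(gm V)) ^ 2 ≤ (∫ x, u x ^ 2 ∂(gm V)) * ∫ x, f x ^ 2 ∂(gm V) := by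
  set a := ∫ x, f x ^ 2 ∂(gm V)
  set N := ∫ x, u x * f x ∂(gm V) with hN
  have i1 : Integrable (fun x => u x ^ 2) (gm V) := gm_cs_int (by fun_prop) (cs_sq huc)
  have i2 : Integrable (fun x => f x ^ 2) (gm V) := gm_cs_int (by fun_prop) (cs_sq hfc)
  have i3 : Integrable (fun x => u x * f x) (gm V) := gm_cs_int (by fun_prop) huc.mul_right
  have h : 0 ≤ ∫ x, (u x - N / a * f x) ^ 2 ∂(gm V) := integral_nonneg fun x => sq_nonneg _
  have e : ∫ x, (u x - N / a * f x) ^ 2 ∂(gm V) = (∫ x, u x ^ 2 ∂(gm V)) - 2 * (N / a) * N + (N / a) ^ 2 * a := by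
    have e0 : ∀ x, (u x - N / a * f x) ^ 2 = u x ^ 2 - 2 * (N / a) * (u x * f x) + (N / a) ^ 2 * f x ^ 2 := by
      intro x; ring
    simp_rw [e0]
    have i4 : Integrable (fun x => u x ^ 2 - 2 * (N / a) * (u x * f x)) (gm V) := i1.sub (i3.const_mul _)
    rw [integral_add i4 (i2.const_mul _), integral_sub i1 (i3.const_mul _),
      integral_const_mul, integral_const_mul]
  rw [e] at h
  have h2 : (∫ x, u x ^ 2 ∂(gm V)) - 2 * (N / a) * N + (N / a) ^ 2 * a = (∫ x, u x ^ 2 ∂(gm V)) - N ^ 2 / a := by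
    field_simp; ring
  rw [h2] at h
  have := (div_le_iff₀ ha).1 (sub_nonneg.1 h)
  linarith

lemma power_ineq {s : ℝ} (h0 : 0 < s) (h1 : s < 1) {χ f : V → ℝ} (hχ : Continuous χ)
    (hχc : HasCompactSupport χ) (hf : Continuous f) (hfc : HasCompactSupport f)
    (ha : 0 < ∫ x, f x ^ 2 ∂(gm V)) (hN : 0 ≤ ∫ x, Tou s χ f x * f x ∂(gm V)) (k : ℕ) :
    (∫ x, f x ^ 2 ∂(gm V)) * (∫ x, Tou s χ f x * f x ∂(gm V)) ^ (2 ^ k)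
      ≤ (∫ x, (Tou s χ)^[2 ^ k] f x * f x ∂(gm V)) * (∫ x, f x ^ 2 ∂(gm V)) ^ (2 ^ k) := by
  set a := ∫ x, f x ^ 2 ∂(gm V) with hadef
  induction k with
  | zero => simp; linarith
  | succ k ih =>
    set N1 := ∫ x, Tou s χ f x * f x ∂(gm V)
    set N := ∫ x, (Tou s χ)^[2 ^ k] f x * f x ∂(gm V)
    obtain ⟨c1, c2⟩ := Tou_iter_cs (s := s) hχ hχc hf hfc (2 ^ k)
    have e : ∫ x, (Tou s χ)^[2 ^ (k+1)] f x * f x ∂(gm V) = ∫ x, ((Tou s χ)^[2 ^ k] f x) ^ 2 ∂(gm V) := by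
      rw [pow_succ, mul_two, Function.iterate_add_apply, Tou_iter_symm h0 h1 hχ hχc c1 hf c2 hfc]
      simp [sq]
    have cs := gm_cauchy c1 c2 hf hfc ha
    rw [← e, ← hadef] at cs
    set N2 := ∫ x, (Tou s χ)^[2 ^ (k+1)] f x * f x ∂(gm V)
    have hsq : (a * N1 ^ 2 ^ k) ^ 2 ≤ (N * a ^ 2 ^ k) ^ 2 := by
      have : 0 ≤ a * N1 ^ 2 ^ k := by positivity
      gcongr
    have h3 : a * (a * N1 ^ 2 ^ (k+1)) ≤ a * (N2 * a ^ 2 ^ (k+1)) := by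
      have e1 : N1 ^ 2 ^ (k+1) = (N1 ^ 2 ^ k) ^ 2 := by rw [← pow_mul, pow_succ]
      have e2 : a ^ 2 ^ (k+1) = (a ^ 2 ^ k) ^ 2 := by rw [← pow_mul, pow_succ]
      rw [e1, e2]
      calc _ = (a * N1 ^ 2 ^ k) ^ 2 := by ring
        _ ≤ (N * a ^ 2 ^ k) ^ 2 := hsq
        _ = N ^ 2 * (a ^ 2 ^ k) ^ 2 := by ring
        _ ≤ (N2 * a) * (a ^ 2 ^ k) ^ 2 := by gcongr
        _ = _ := by ring
    exact le_of_mul_le_mul_left h3 ha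

/-- one step of the flow for separated supports -/
lemma one_step {A B : Set V} {δ D : ℝ} (hδ : 0 < δ) (hD : 0 < D)
    (hAB : ∀ x ∈ A, ∀ y ∈ B, δ ≤ ‖x - y‖) (hAB' : ∀ x ∈ A, ∀ y ∈ B, ‖x - y‖ ≤ D)
    {s : ℝ} (h0 : 0 < s) (h1 : s ≤ 1/2) (hsm : s * (8 * D * (m2 V + 1)) ≤ δ ^ 2)
    {f g : V → ℝ} (hf : Continuous f) (hfc : HasCompactSupport f)
    (hg : Continuous g) (hgc : HasCompactSupport g) (hf0 : ∀ x, 0 ≤ f x) (hg0 : ∀ x, 0 ≤ g x)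
    (hfA : ∀ x, f x ≠ 0 → x ∈ A) (hgB : ∀ x, g x ≠ 0 → x ∈ B)
    {C : ℝ} (hC : 0 < C) (hfg : ∀ x y, f x * g y ≤ C * ‖x - y‖ ^ 2) :
    ∀ x ∈ A, ∀ y ∈ B, Pou s f x * Pou s g y ≤ C * (1 - s ^ 2) * ‖x - y‖ ^ 2 := by
  have hm2 := m2_nonneg (V := V)
  -- maxima
  obtain ⟨x1, hx1⟩ : ∃ x1, ∀ x, f x ≤ f x1 := by
    obtain ⟨x1, h⟩ := hf.exists_forall_ge_of_hasCompactSupport hfc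
    exact ⟨x1, h⟩
  obtain ⟨y1, hy1⟩ : ∃ y1, ∀ x, g x ≤ g y1 := by
    obtain ⟨x1, h⟩ := hg.exists_forall_ge_of_hasCompactSupport hgc
    exact ⟨x1, h⟩
  have hmax : f x1 * g y1 ≤ C * D ^ 2 := by
    by_cases a : f x1 = 0
    · rw [a, zero_mul]; positivity
    by_cases b : g y1 = 0
    · rw [b, mul_zero]; positivity
    have := hAB' x1 (hfA _ a) y1 (hgB _ b)
    exact (hfg x1 y1).trans (by gcongr)
  have small : C * D ^ 2 * (m2 V * s ^ 2 / (δ/4) ^ 2) ≤ C * (δ/2) ^ 2 := by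
    have q : (s * (8 * D * (m2 V + 1))) ^ 2 ≤ (δ ^ 2) ^ 2 := by gcongr
    have q2 : m2 V ≤ (m2 V + 1) ^ 2 := by nlinarith
    have q3 : 64 * D ^ 2 * s ^ 2 * m2 V ≤ δ ^ 4 := by
      calc 64 * D ^ 2 * s ^ 2 * m2 V ≤ 64 * D ^ 2 * s ^ 2 * (m2 V + 1) ^ 2 := by gcongr
        _ = (s * (8 * D * (m2 V + 1))) ^ 2 := by ring
        _ ≤ _ := q
        _ = _ := by ring
    rw [mul_assoc]
    refine mul_le_mul_of_nonneg_left ?_ hC.le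
    rw [mul_div_assoc', div_le_iff₀ (by positivity)]
    nlinarith
  have H := heat_lemma (f := fun x => C⁻¹ * f x) (g := g) (by fun_prop) hfc.mul_left hg hgc
    (fun x => mul_nonneg (by positivity) (hf0 x)) hg0 (δ := δ / 2) (τ := s) (by positivity) ?_ ?_
  · have hsC : ∀ σ x, hs σ (fun x => C⁻¹ * f x) x = C⁻¹ * hs σ f x := by
      intro σ x; simp only [hs]; rw [integral_const_mul]
    intro x hx y hy
    have hc2 : √(1 - s ^ 2) ^ 2 = 1 - s ^ 2 := Real.sq_sqrt (by nlinarith)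
    have hc : 1/2 ≤ √(1 - s ^ 2) := Real.le_sqrt_of_sq_le (by nlinarith)
    have e : ‖√(1 - s ^ 2) • x - √(1 - s ^ 2) • y‖ = √(1 - s ^ 2) * ‖x - y‖ := by
      rw [← smul_sub, norm_smul, Real.norm_of_nonneg (by positivity)]
    have h3 := H s ⟨h0.le, le_rfl⟩ (√(1 - s ^ 2) • x) (√(1 - s ^ 2) • y) (by
      rw [e]
      have := hAB x hx y hy
      nlinarith)
    rw [e, mul_pow, hc2, hsC] at h3
    unfold Pou
    have h4 : C * (C⁻¹ * hs s f (√(1 - s ^ 2) • x) * hs s g (√(1 - s ^ 2) • y)) ≤ C * ((1 - s ^ 2) * ‖x - y‖ ^ 2) := by gcongr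
    have e5 : C * (C⁻¹ * hs s f (√(1 - s ^ 2) • x) * hs s g (√(1 - s ^ 2) • y)) = hs s f (√(1 - s ^ 2) • x) * hs s g (√(1 - s ^ 2) • y) := by
      field_simp
    rw [e5] at h4
    linarith
  · intro x y
    have := hfg x y
    calc C⁻¹ * f x * g y = C⁻¹ * (f x * g y) := by ring
      _ ≤ C⁻¹ * (C * ‖x - y‖ ^ 2) := by gcongr
      _ = _ := by field_simp
  · intro σ hσ x y hxy
    have hsC : hs σ (fun x => C⁻¹ * f x) x = C⁻¹ * hs σ f x := by
      simp only [hs]; rw [integral_const_mul]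
    have hσ2 : σ ^ 2 ≤ s ^ 2 := by have := hσ.1; have := hσ.2; gcongr
    have main : hs σ f x * hs σ g y ≤ C * (δ/2) ^ 2 := by
      refine le_trans ?_ small
      have hc := hs_nonneg hg0 y (s := σ)
      have hf1 := hf0 x1
      have hg1 := hg0 y1
      by_cases hcase : ∀ a, f a ≠ 0 → δ/4 ≤ ‖a - x‖
      · have a := hs_markov hf hf0 hx1 (by positivity : 0 < δ/4) σ x hcase
        have b := hs_le hg hg0 hy1 σ y
        calc hs σ f x * hs σ g y ≤ (f x1 * (m2 V * σ ^ 2 / (δ/4) ^ 2)) * g y1 := by gcongr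
          _ = (f x1 * g y1) * (m2 V * σ ^ 2 / (δ/4) ^ 2) := by ring
          _ ≤ _ := by gcongr
      · push Not at hcase
        obtain ⟨a0, ha0, ha1⟩ := hcase
        have hcase2 : ∀ b, g b ≠ 0 → δ/4 ≤ ‖b - y‖ := by
          intro b hb
          by_contra hcon
          push Not at hcon
          have h5 := hAB a0 (hfA _ ha0) b (hgB _ hb)
          have h6 : ‖a0 - b‖ ≤ ‖a0 - x‖ + ‖x - y‖ + ‖b - y‖ := by
            have : a0 - b = (a0 - x) + (x - y) - (b - y) := by abel
            rw [this]
            exact (norm_sub_le _ _).trans (by gcongr; exact norm_add_le _ _)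
          linarith
        have a := hs_markov hg hg0 hy1 (by positivity : 0 < δ/4) σ y hcase2
        have b := hs_le hf hf0 hx1 σ x
        calc hs σ f x * hs σ g y ≤ f x1 * (g y1 * (m2 V * σ ^ 2 / (δ/4) ^ 2)) := by gcongr
          _ = (f x1 * g y1) * (m2 V * σ ^ 2 / (δ/4) ^ 2) := by ring
          _ ≤ _ := by gcongr
    rw [hsC]
    calc C⁻¹ * hs σ f x * hs σ g y = C⁻¹ * (hs σ f x * hs σ g y) := by ring
      _ ≤ C⁻¹ * (C * (δ/2) ^ 2) := by gcongr
      _ = _ := by field_simp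

lemma Pou_nonneg {s : ℝ} {f : V → ℝ} (hf : ∀ x, 0 ≤ f x) (x : V) : 0 ≤ Pou s f x := hs_nonneg hf _

lemma flow_iter {A B : Set V} {δ D : ℝ} (hδ : 0 < δ) (hD : 0 < D)
    (hAB : ∀ x ∈ A, ∀ y ∈ B, δ ≤ ‖x - y‖) (hAB' : ∀ x ∈ A, ∀ y ∈ B, ‖x - y‖ ≤ D)
    {s : ℝ} (h0 : 0 < s) (h1 : s ≤ 1/2) (hsm : s * (8 * D * (m2 V + 1)) ≤ δ ^ 2)
    {χ ψ : V → ℝ} (hχ : Continuous χ) (hχc : HasCompactSupport χ) (hψ : Continuous ψ)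
    (hψc : HasCompactSupport ψ) (hχ0 : ∀ x, χ x ∈ Icc (0:ℝ) 1) (hψ0 : ∀ x, ψ x ∈ Icc (0:ℝ) 1)
    (hχA : ∀ x, χ x ≠ 0 → x ∈ A) (hψB : ∀ x, ψ x ≠ 0 → x ∈ B)
    {f g : V → ℝ} (hf : Continuous f) (hfc : HasCompactSupport f)
    (hg : Continuous g) (hgc : HasCompactSupport g) (hf0 : ∀ x, 0 ≤ f x) (hg0 : ∀ x, 0 ≤ g x)
    {C : ℝ} (hC : 0 < C) (hfg : ∀ x y, f x * g y ≤ C * ‖x - y‖ ^ 2) (m : ℕ) :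
    (∀ x, 0 ≤ (Tou s χ)^[m] f x) ∧ (∀ x, 0 ≤ (Tou s ψ)^[m] g x) ∧
    ∀ x y, (Tou s χ)^[m] f x * (Tou s ψ)^[m] g y ≤ C * (1 - s ^ 2) ^ m * ‖x - y‖ ^ 2 := by
  induction m with
  | zero => exact ⟨hf0, hg0, by simpa using hfg⟩
  | succ m ih =>
    obtain ⟨i1, i2, i3⟩ := ih
    obtain ⟨c1, c2⟩ := Tou_iter_cs (s := s) hχ hχc hf hfc m
    obtain ⟨c3, c4⟩ := Tou_iter_cs (s := s) hψ hψc hg hgc m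
    rw [Function.iterate_succ_apply', Function.iterate_succ_apply']
    set u := (Tou s χ)^[m] f
    set v := (Tou s ψ)^[m] g
    have n1 : ∀ x, 0 ≤ χ x * u x := fun x => mul_nonneg (hχ0 x).1 (i1 x)
    have n2 : ∀ x, 0 ≤ ψ x * v x := fun x => mul_nonneg (hψ0 x).1 (i2 x)
    have hs2 : 0 < 1 - s ^ 2 := by nlinarith
    refine ⟨fun x => mul_nonneg (hχ0 x).1 (Pou_nonneg n1 x), fun x => mul_nonneg (hψ0 x).1 (Pou_nonneg n2 x), ?_⟩
    intro x y
    by_cases hx : χ x = 0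
    · simp only [Tou, hx, zero_mul]; positivity
    by_cases hy : ψ y = 0
    · simp only [Tou, hy, zero_mul, mul_zero]; positivity
    have st := one_step hδ hD hAB hAB' h0 h1 hsm (f := fun x => χ x * u x) (g := fun x => ψ x * v x)
      (hχ.mul c1) hχc.mul_right (hψ.mul c3) hψc.mul_right n1 n2
      (fun x hx => hχA x (left_ne_zero_of_mul hx)) (fun x hx => hψB x (left_ne_zero_of_mul hx))
      (C := C * (1 - s ^ 2) ^ m) (by positivity)
      (fun x y => by
        refine le_trans ?_ (i3 x y)
        have a1 : χ x * u x ≤ u x := mul_le_of_le_one_left (i1 x) (hχ0 x).2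
        have a2 : ψ y * v y ≤ v y := mul_le_of_le_one_left (i2 y) (hψ0 y).2
        have := i1 x
        have := n2 y
        gcongr) x (hχA x hx) y (hψB y hy)
    unfold Tou
    have p1 := Pou_nonneg (s := s) n1 x
    have p2 := Pou_nonneg (s := s) n2 y
    have b1 : χ x * Pou s (fun x => χ x * u x) x ≤ Pou s (fun x => χ x * u x) x :=
      mul_le_of_le_one_left p1 (hχ0 x).2
    have b2 : ψ y * Pou s (fun x => ψ x * v x) y ≤ Pou s (fun x => ψ x * v x) y :=
      mul_le_of_le_one_left p2 (hψ0 y).2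
    have b3 : 0 ≤ ψ y * Pou s (fun x => ψ x * v x) y := mul_nonneg (hψ0 y).1 p2
    calc _ ≤ Pou s (fun x => χ x * u x) x * Pou s (fun x => ψ x * v x) y := by gcongr
      _ ≤ _ := st
      _ = _ := by ring

lemma step_lemma {f g : V → ℝ} (hf : Continuous f) (hfc : HasCompactSupport f)
    (hg : Continuous g) (hgc : HasCompactSupport g) (hf0 : ∀ x, 0 ≤ f x) (hg0 : ∀ x, 0 ≤ g x)
    (hdis : Disjoint (tsupport f) (tsupport g))
    (ha : 0 < ∫ x, f x ^ 2 ∂(gm V)) (hb : 0 < ∫ x, g x ^ 2 ∂(gm V)) :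
    ∀ᶠ s : ℝ in 𝓝[>] 0, (∫ x, Pou s f x * f x ∂(gm V)) * (∫ x, Pou s g x * g x ∂(gm V))
      ≤ (1 - s ^ 2) * ((∫ x, f x ^ 2 ∂(gm V)) * (∫ x, g x ^ 2 ∂(gm V))) := by
  set a := ∫ x, f x ^ 2 ∂(gm V) with hadef
  set b := ∫ x, g x ^ 2 ∂(gm V) with hbdef
  -- compact neighbourhoods
  obtain ⟨A, hA, hAcl, hAf, hAg⟩ := exists_compact_closed_between (K := tsupport f) hfc
    (isClosed_tsupport g).isOpen_compl hdis.subset_compl_right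
  obtain ⟨B, hB, hBcl, hBg, hBA⟩ := exists_compact_closed_between (K := tsupport g) hgc
    hAcl.isOpen_compl (subset_compl_comm.1 hAg)
  have hABd : Disjoint A B := subset_compl_iff_disjoint_left.1 hBA
  obtain ⟨χ, χ1, χ0, χc, χr⟩ := exists_continuous_one_zero_of_isCompact (s := tsupport f)
    (t := (interior A)ᶜ) hfc isOpen_interior.isClosed_compl (disjoint_compl_right_iff_subset.2 hAf)
  obtain ⟨ψ, ψ1, ψ0, ψc, ψr⟩ := exists_continuous_one_zero_of_isCompact (s := tsupport g)
    (t := (interior B)ᶜ) hgc isOpen_interior.isClosed_compl (disjoint_compl_right_iff_subset.2 hBg)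
  have hχA : ∀ x, χ x ≠ 0 → x ∈ A := by
    intro x hx; by_contra h
    exact hx (χ0 (fun h' => h (interior_subset h')))
  have hψB : ∀ x, ψ x ≠ 0 → x ∈ B := by
    intro x hx; by_contra h
    exact hx (ψ0 (fun h' => h (interior_subset h')))
  have hfA : ∀ x, f x ≠ 0 → x ∈ A := fun x hx => interior_subset (hAf (subset_tsupport _ hx))
  have hgB : ∀ x, g x ≠ 0 → x ∈ B := fun x hx => interior_subset (hBg (subset_tsupport _ hx))
  have hχf : ∀ x, χ x * f x = f x := by
    intro x
    by_cases h : f x = 0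
    · simp [h]
    · rw [χ1 (subset_tsupport _ h)]; simp
  have hψg : ∀ x, ψ x * g x = g x := by
    intro x
    by_cases h : g x = 0
    · simp [h]
    · rw [ψ1 (subset_tsupport _ h)]; simp
  -- distances
  obtain ⟨δ, hδ, hABδ⟩ : ∃ δ > 0, ∀ x ∈ A, ∀ y ∈ B, δ ≤ ‖x - y‖ := by
    rcases A.eq_empty_or_nonempty with h | h
    · exact ⟨1, one_pos, by simp [h]⟩
    rcases B.eq_empty_or_nonempty with h' | h'
    · exact ⟨1, one_pos, by simp [h']⟩
    obtain ⟨p, hp, hpm⟩ := (hA.prod hB).exists_isMinOn (h.prod h')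
      (f := fun p : V × V => ‖p.1 - p.2‖) (by fun_prop)
    refine ⟨‖p.1 - p.2‖, ?_, fun x hx y hy => hpm (show (x, y) ∈ A ×ˢ B from ⟨hx, hy⟩)⟩
    rw [gt_iff_lt, norm_pos_iff, sub_ne_zero]
    exact fun he => disjoint_left.1 hABd hp.1 (he ▸ hp.2)
  obtain ⟨D, hD, hABD⟩ : ∃ D > 0, ∀ x ∈ A, ∀ y ∈ B, ‖x - y‖ ≤ D := by
    obtain ⟨D, hD⟩ := (hA.prod hB).exists_bound_of_continuousOn
      (f := fun p : V × V => ‖p.1 - p.2‖) (by fun_prop)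
    refine ⟨|D| + 1, by positivity, fun x hx y hy => ?_⟩
    have := hD (x, y) ⟨hx, hy⟩
    rw [norm_norm] at this
    exact this.trans ((le_abs_self D).trans (by linarith))
  obtain ⟨Mf, hMf0, hMf⟩ := cs_bound hf hfc
  obtain ⟨Mg, hMg0, hMg⟩ := cs_bound hg hgc
  set C := Mf * Mg / δ ^ 2 with hCdef
  have hC : 0 < C := by positivity
  have hfg : ∀ x y, f x * g y ≤ C * ‖x - y‖ ^ 2 := by
    intro x y
    by_cases h1 : f x = 0
    · rw [h1, zero_mul]; positivity
    by_cases h2 : g y = 0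
    · rw [h2, mul_zero]; positivity
    have h3 := hABδ x (hfA x h1) y (hgB y h2)
    have h4 : f x * g y ≤ Mf * Mg :=
      mul_le_mul ((le_abs_self _).trans (hMf x)) ((le_abs_self _).trans (hMg y)) (hg0 y) hMf0.le
    calc f x * g y ≤ Mf * Mg := h4
      _ = C * δ ^ 2 := by rw [hCdef]; field_simp
      _ ≤ _ := by gcongr
  have hm2 := m2_nonneg (V := V)
  have ev1 : ∀ᶠ s : ℝ in 𝓝[>] 0, s < 1/2 := nhdsWithin_le_nhds (gt_mem_nhds (by norm_num))
  have ev2 : ∀ᶠ s : ℝ in 𝓝[>] 0, s < δ ^ 2 / (8 * D * (m2 V + 1)) :=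
    nhdsWithin_le_nhds (gt_mem_nhds (by positivity))
  filter_upwards [ev1, ev2, self_mem_nhdsWithin] with s hs1 hs2 hs0
  have hs0 : 0 < s := hs0
  rw [lt_div_iff₀ (by positivity)] at hs2
  have e1 : (∫ x, Pou s f x * f x ∂(gm V)) = ∫ x, Tou s χ f x * f x ∂(gm V) := by
    congr 1; ext x; simp only [Tou, hχf]; rw [mul_comm (χ x), mul_assoc, hχf]
  have e2 : (∫ x, Pou s g x * g x ∂(gm V)) = ∫ x, Tou s ψ g x * g x ∂(gm V) := by
    congr 1; ext x; simp only [Tou, hψg]; rw [mul_comm (ψ x), mul_assoc, hψg]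
  have hN0 : 0 ≤ ∫ x, Pou s f x * f x ∂(gm V) := integral_nonneg fun x => mul_nonneg (Pou_nonneg hf0 x) (hf0 x)
  have hM0 : 0 ≤ ∫ x, Pou s g x * g x ∂(gm V) := integral_nonneg fun x => mul_nonneg (Pou_nonneg hg0 x) (hg0 x)
  rw [e1] at hN0 ⊢
  rw [e2] at hM0 ⊢
  set N := ∫ x, Tou s χ f x * f x ∂(gm V) with hN
  set M := ∫ x, Tou s ψ g x * g x ∂(gm V) with hM
  have hc2 : 0 < 1 - s ^ 2 := by nlinarith
  -- bound for all powers
  set F := ∫ x, f x ∂(gm V)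
  set G := ∫ x, g x ∂(gm V)
  have hF : 0 ≤ F := integral_nonneg hf0
  have hG : 0 ≤ G := integral_nonneg hg0
  have bnd : ∀ k : ℕ, (a * b) * (N * M) ^ 2 ^ k ≤ (C * D ^ 2 * F * G) * ((1 - s ^ 2) * (a * b)) ^ 2 ^ k := by
    intro k
    obtain ⟨i1, i2, i3⟩ := flow_iter hδ hD hABδ hABD hs0 hs1.le hs2.le χ.continuous χc ψ.continuous ψc χr ψr
      hχA hψB hf hfc hg hgc hf0 hg0 hC hfg (2 ^ k)
    have p1 := power_ineq hs0 (by linarith) χ.continuous χc hf hfc ha hN0 k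
    have p2 := power_ineq hs0 (by linarith) ψ.continuous ψc hg hgc hb hM0 k
    obtain ⟨c1, c2⟩ := Tou_iter_cs (s := s) χ.continuous χc hf hfc (2 ^ k)
    obtain ⟨c3, c4⟩ := Tou_iter_cs (s := s) ψ.continuous ψc hg hgc (2 ^ k)
    set u := (Tou s χ)^[2 ^ k] f
    set v := (Tou s ψ)^[2 ^ k] g
    rw [← hadef, ← hN] at p1
    rw [← hbdef, ← hM] at p2
    set c2k := (1 - s ^ 2) ^ 2 ^ k
    have hc2k : 0 ≤ c2k := by positivity
    have q : ∀ x y, u x * f x * (v y * g y) ≤ C * c2k * D ^ 2 * (f x * g y) := by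
      intro x y
      by_cases h1 : f x = 0
      · simp [h1]
      by_cases h2 : g y = 0
      · simp [h2]
      have h3 := hABD x (hfA x h1) y (hgB y h2)
      have h4 := i3 x y
      have h5 := hf0 x
      have h6 := hg0 y
      calc u x * f x * (v y * g y) = (u x * v y) * (f x * g y) := by ring
        _ ≤ (C * c2k * ‖x - y‖ ^ 2) * (f x * g y) := by gcongr
        _ ≤ _ := by gcongr
    have iu : Integrable (fun x => u x * f x) (gm V) := gm_cs_int (c1.mul hf) c2.mul_right
    have iv : Integrable (fun x => v x * g x) (gm V) := gm_cs_int (c3.mul hg) c4.mul_right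
    have q1 : ∀ y, (∫ x, u x * f x ∂(gm V)) * (v y * g y) ≤ C * c2k * D ^ 2 * F * g y := by
      intro y
      have := integral_mono (iu.mul_const (v y * g y))
        ((gm_cs_int hf hfc).mul_const (C * c2k * D ^ 2 * g y)) (fun x => by have := q x y; simp only; linarith)
      rw [integral_mul_const, integral_mul_const] at this
      linarith
    have q2 : (∫ x, u x * f x ∂(gm V)) * (∫ y, v y * g y ∂(gm V)) ≤ C * c2k * D ^ 2 * F * G := by
      have := integral_mono (iv.const_mul (∫ x, u x * f x ∂(gm V)))
        ((gm_cs_int hg hgc).const_mul (C * c2k * D ^ 2 * F)) q1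
      rwa [integral_const_mul, integral_const_mul] at this
    have z1 : 0 ≤ a * N ^ 2 ^ k := by positivity
    have z2 : 0 ≤ b * M ^ 2 ^ k := by positivity
    calc (a * b) * (N * M) ^ 2 ^ k = (a * N ^ 2 ^ k) * (b * M ^ 2 ^ k) := by rw [mul_pow]; ring
      _ ≤ ((∫ x, u x * f x ∂(gm V)) * a ^ 2 ^ k) * ((∫ y, v y * g y ∂(gm V)) * b ^ 2 ^ k) :=
          mul_le_mul p1 p2 z2 (z1.trans p1)
      _ = ((∫ x, u x * f x ∂(gm V)) * (∫ y, v y * g y ∂(gm V))) * (a ^ 2 ^ k * b ^ 2 ^ k) := by ring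
      _ ≤ (C * c2k * D ^ 2 * F * G) * (a ^ 2 ^ k * b ^ 2 ^ k) := by gcongr
      _ = _ := by rw [mul_pow, mul_pow]; ring
  by_contra hcon
  push Not at hcon
  set q := N * M / ((1 - s ^ 2) * (a * b)) with hq
  have hden : 0 < (1 - s ^ 2) * (a * b) := by positivity
  have hq1 : 1 < q := (one_lt_div hden).2 hcon
  obtain ⟨k, hk⟩ := pow_unbounded_of_one_lt ((C * D ^ 2 * F * G) / (a * b)) hq1
  have h5 : q ^ k ≤ q ^ 2 ^ k := pow_le_pow_right₀ hq1.le (Nat.lt_two_pow_self).le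
  have h6 := bnd k
  have h7 : q ^ 2 ^ k ≤ (C * D ^ 2 * F * G) / (a * b) := by
    rw [le_div_iff₀ (by positivity), hq, div_pow, div_mul_eq_mul_div, div_le_iff₀ (by positivity)]
    linarith
  linarith

end OU

end ACFproof

namespace ACFproof

open Topology Module

section Energy

variable {V : Type*} [NormedAddCommGroup V] [InnerProductSpace ℝ V] [FiniteDimensional ℝ V]
  [MeasurableSpace V] [BorelSpace V]

lemma energy_id {f : V → ℝ} (hf : Continuous f) (hfc : HasCompactSupport f) {s : ℝ} (h0 : 0 < s)
    (h1 : s < 1) :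
    ∫ p : V × V, (f (√(1 - s ^ 2) • p.1 + s • p.2) - f p.1) ^ 2 ∂((gm V).prod (gm V))
      = 2 * ((∫ x, f x ^ 2 ∂(gm V)) - ∫ x, Pou s f x * f x ∂(gm V)) := by
  obtain ⟨M, hM0, hM⟩ := cs_bound hf hfc
  have hM2 : ∀ x, |f x ^ 2| ≤ M ^ 2 := fun x => by
    rw [abs_pow]; have := hM x; have := abs_nonneg (f x); gcongr
  rw [integral_prod]
  · have inner : ∀ x, ∫ z, (f (√(1 - s ^ 2) • x + s • z) - f x) ^ 2 ∂(gm V)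
        = Pou s (fun y => f y ^ 2) x - 2 * (Pou s f x * f x) + f x ^ 2 := by
      intro x
      have i1 : Integrable (fun z => f (√(1 - s ^ 2) • x + s • z) ^ 2) (gm V) :=
        bdd_integrable (hf.pow 2) hM2 (√(1 - s ^ 2) • x) s
      have i2 := bdd_integrable hf hM (√(1 - s ^ 2) • x) s
      have e0 : ∀ z, (f (√(1 - s ^ 2) • x + s • z) - f x) ^ 2 = f (√(1 - s ^ 2) • x + s • z) ^ 2
        - (2 * f x) * f (√(1 - s ^ 2) • x + s • z) + f x ^ 2 := by intro z; ring
      simp_rw [e0]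
      have i3 : Integrable (fun z => f (√(1 - s ^ 2) • x + s • z) ^ 2
        - (2 * f x) * f (√(1 - s ^ 2) • x + s • z)) (gm V) := i1.sub (i2.const_mul _)
      rw [integral_add i3 (integrable_const _), integral_sub i1 (i2.const_mul _), integral_const_mul]
      simp only [Pou, hs, integral_const, probReal_univ, one_smul]
      ring
    simp_rw [inner]
    have j1 : Integrable (fun x => f x ^ 2) (gm V) := gm_cs_int (hf.pow 2) (cs_sq hfc)
    have j2 : Integrable (fun x => Pou s f x * f x) (gm V) :=
      gm_cs_int ((Pou_cont hf hM s).mul hf) hfc.mul_left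
    have j3 : Integrable (fun x => Pou s (fun y => f y ^ 2) x) (gm V) := by
      refine Integrable.of_bound (Pou_cont (hf.pow 2) hM2 s).aestronglyMeasurable (M ^ 2) (ae_of_all _ fun x => ?_)
      rw [Real.norm_of_nonneg (Pou_nonneg (fun y => sq_nonneg _) x)]
      exact hs_le (hf.pow 2) (fun y => sq_nonneg _) (fun y => (le_abs_self _).trans (hM2 y)) _ _
    have e : ∫ x, Pou s (fun y => f y ^ 2) x ∂(gm V) = ∫ x, f x ^ 2 ∂(gm V) := by
      have := Pou_symm h0 h1 (hf.pow 2) (cs_sq hfc) (v := fun _ => (1:ℝ)) continuous_const (M := 1) (by simp)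
      simp only [Pou_one, mul_one] at this
      exact this
    have j4 : Integrable (fun x => Pou s (fun y => f y ^ 2) x - 2 * (Pou s f x * f x)) (gm V) :=
      j3.sub (j2.const_mul _)
    rw [integral_add j4 j1, integral_sub j3 (j2.const_mul _), integral_const_mul, e]
    ring
  · refine Integrable.of_bound (C := (2 * M) ^ 2) (Continuous.aestronglyMeasurable (by fun_prop)) (ae_of_all _ fun p => ?_)
    rw [norm_pow]
    have a := hM (√(1 - s ^ 2) • p.1 + s • p.2)
    have b := hM p.1
    gcongr
    rw [Real.norm_eq_abs]
    exact (abs_sub _ _).trans (by linarith)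

lemma energy_lim {f : V → ℝ} (hf : ContDiff ℝ 1 f) (hfc : HasCompactSupport f) :
    Tendsto (fun s : ℝ => (2 * ((∫ x, f x ^ 2 ∂(gm V)) - ∫ x, Pou s f x * f x ∂(gm V))) / s ^ 2)
      (𝓝[>] 0) (𝓝 (∫ x, ‖gradient f x‖ ^ 2 ∂(gm V))) := by
  obtain ⟨L, hL⟩ := hf.lipschitzWith_of_hasCompactSupport hfc (by simp)
  have hfd : ∀ x, HasFDerivAt f (fderiv ℝ f x) x := fun x => (hf.differentiable (by simp) x).hasFDerivAt
  have hgr : ∀ x z, fderiv ℝ f x z = ⟪gradient f x, z⟫ := fun x z => by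
    simp [gradient]
  have hgc : Continuous (gradient f) := by
    unfold gradient
    exact (LinearIsometryEquiv.continuous _).comp (hf.continuous_fderiv (by simp))
  have key : Tendsto (fun s : ℝ => ∫ p : V × V, ((f (√(1 - s ^ 2) • p.1 + s • p.2) - f p.1) / s) ^ 2 ∂((gm V).prod (gm V)))
      (𝓝[>] 0) (𝓝 (∫ p : V × V, ⟪gradient f p.1, p.2⟫ ^ 2 ∂((gm V).prod (gm V)))) := by
    have ib : Integrable (fun p : V × V => (L:ℝ) ^ 2 * (2 * ‖p.1‖ ^ 2 + 2 * ‖p.2‖ ^ 2)) ((gm V).prod (gm V)) := by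
      have i1 : Integrable (fun p : V × V => ‖p.1‖ ^ 2) ((gm V).prod (gm V)) := by
        simpa using (gm_sq_integrable (V := V)).mul_prod (integrable_const (μ := gm V) (1:ℝ))
      have i2 : Integrable (fun p : V × V => ‖p.2‖ ^ 2) ((gm V).prod (gm V)) := by
        simpa using (integrable_const (μ := gm V) (1:ℝ)).mul_prod (gm_sq_integrable (V := V))
      exact ((i1.const_mul 2).add (i2.const_mul 2)).const_mul _
    refine tendsto_integral_filter_of_dominated_convergence _ ?_ ?_ ib ?_
    · filter_upwards [self_mem_nhdsWithin] with s hs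
      have := hf.continuous
      exact Continuous.aestronglyMeasurable (by fun_prop)
    · have : ∀ᶠ s : ℝ in 𝓝[>] 0, s < 1 := nhdsWithin_le_nhds (gt_mem_nhds one_pos)
      filter_upwards [self_mem_nhdsWithin, this] with s hs hs1
      have hs : 0 < s := hs
      refine ae_of_all _ fun p => ?_
      have h1 : |f (√(1 - s ^ 2) • p.1 + s • p.2) - f p.1| ≤ L * (s * (‖p.1‖ + ‖p.2‖)) := by
        have := hL.dist_le_mul (√(1 - s ^ 2) • p.1 + s • p.2) p.1
        rw [Real.dist_eq, dist_eq_norm] at this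
        refine this.trans ?_
        gcongr
        have e : √(1 - s ^ 2) • p.1 + s • p.2 - p.1 = (√(1 - s ^ 2) - 1) • p.1 + s • p.2 := by
          rw [sub_smul, one_smul]; abel
        rw [e, mul_add]
        refine (norm_add_le _ _).trans ?_
        rw [norm_smul, norm_smul, Real.norm_of_nonneg hs.le]
        gcongr
        have a : 1 - s ≤ √(1 - s ^ 2) := Real.le_sqrt_of_sq_le (by nlinarith)
        have b : √(1 - s ^ 2) ≤ 1 := Real.sqrt_le_one.2 (by nlinarith)
        rw [Real.norm_eq_abs, abs_le]; constructor <;> linarith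
      rw [norm_pow, norm_div, Real.norm_eq_abs, Real.norm_of_nonneg hs.le]
      have h2 : |f (√(1 - s ^ 2) • p.1 + s • p.2) - f p.1| / s ≤ L * (‖p.1‖ + ‖p.2‖) := by
        rw [div_le_iff₀ hs]; linarith
      calc _ ≤ (L * (‖p.1‖ + ‖p.2‖)) ^ 2 := by gcongr
        _ = (L:ℝ) ^ 2 * (‖p.1‖ + ‖p.2‖) ^ 2 := by ring
        _ ≤ _ := by gcongr; nlinarith [sq_nonneg (‖p.1‖ - ‖p.2‖)]
    · refine ae_of_all _ fun p => ?_
      have hγ : HasDerivAt (fun s : ℝ => √(1 - s ^ 2) • p.1 + s • p.2) p.2 0 := by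
        have h1 : HasDerivAt (fun s : ℝ => √(1 - s ^ 2)) 0 0 := by
          have := ((hasDerivAt_pow 2 (0:ℝ)).const_sub 1).sqrt (by simp)
          simpa using this
        have := (h1.smul_const p.1).add ((hasDerivAt_id (0:ℝ)).smul_const p.2)
        rw [zero_smul, one_smul, zero_add] at this
        exact this
      have hz : √(1 - (0:ℝ) ^ 2) • p.1 + (0:ℝ) • p.2 = p.1 := by simp
      have hc : HasDerivAt (fun s : ℝ => f (√(1 - s ^ 2) • p.1 + s • p.2)) (fderiv ℝ f p.1 p.2) 0 := by
        have h2 : HasFDerivAt f (fderiv ℝ f p.1) (√(1 - (0:ℝ) ^ 2) • p.1 + (0:ℝ) • p.2) := by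
          rw [hz]; exact hfd p.1
        exact h2.comp_hasDerivAt (0:ℝ) hγ
      have ht := (hasDerivAt_iff_tendsto_slope.1 hc).mono_left
        (nhdsWithin_mono (0:ℝ) (fun t (ht : t ∈ Ioi 0) => ne_of_gt ht))
      rw [hgr] at ht
      refine (ht.pow 2).congr fun s => ?_
      rw [slope_def_field, hz, sub_zero]
  have e : ∫ p : V × V, ⟪gradient f p.1, p.2⟫ ^ 2 ∂((gm V).prod (gm V)) = ∫ x, ‖gradient f x‖ ^ 2 ∂(gm V) := by
    rw [integral_prod]
    · simp only [gm_inner_sq]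
    · have ib : Integrable (fun p : V × V => ‖gradient f p.1‖ ^ 2 * ‖p.2‖ ^ 2) ((gm V).prod (gm V)) := by
        refine Integrable.mul_prod (f := fun x => ‖gradient f x‖ ^ 2) (g := fun z : V => ‖z‖ ^ 2) ?_ gm_sq_integrable
        refine gm_cs_int (by fun_prop) ?_
        have h1 : HasCompactSupport (gradient f) := by
          unfold gradient
          exact (hfc.fderiv (𝕜 := ℝ)).comp_left (map_zero _)
        exact h1.comp_left (g := fun v : V => ‖v‖ ^ 2) (by simp)
      refine ib.mono' (Continuous.aestronglyMeasurable (by fun_prop)) (ae_of_all _ fun p => ?_)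
      rw [norm_pow, ← mul_pow]
      gcongr
      exact norm_inner_le_norm _ _
  rw [e] at key
  refine key.congr' ?_
  have : ∀ᶠ s : ℝ in 𝓝[>] 0, s < 1 := nhdsWithin_le_nhds (gt_mem_nhds one_pos)
  filter_upwards [self_mem_nhdsWithin, this] with s hs hs1
  rw [← energy_id hf.continuous hfc hs hs1, ← integral_div]
  congr 1; ext p; rw [div_pow]

/-- Gaussian Friedland-Hayman inequality for separated supports -/
lemma GI_sep {f g : V → ℝ} (hf : ContDiff ℝ 1 f) (hfc : HasCompactSupport f)
    (hg : ContDiff ℝ 1 g) (hgc : HasCompactSupport g) (hf0 : ∀ x, 0 ≤ f x) (hg0 : ∀ x, 0 ≤ g x)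
    (hdis : Disjoint (tsupport f) (tsupport g)) :
    2 * ((∫ x, f x ^ 2 ∂(gm V)) * (∫ x, g x ^ 2 ∂(gm V))) ≤
      (∫ x, ‖gradient f x‖ ^ 2 ∂(gm V)) * (∫ x, g x ^ 2 ∂(gm V))
      + (∫ x, f x ^ 2 ∂(gm V)) * (∫ x, ‖gradient g x‖ ^ 2 ∂(gm V)) := by
  set a := ∫ x, f x ^ 2 ∂(gm V) with ha
  set b := ∫ x, g x ^ 2 ∂(gm V) with hb
  have ha0 : 0 ≤ a := integral_nonneg fun x => sq_nonneg _
  have hb0 : 0 ≤ b := integral_nonneg fun x => sq_nonneg _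
  have hE0 : 0 ≤ ∫ x, ‖gradient f x‖ ^ 2 ∂(gm V) := integral_nonneg fun x => sq_nonneg _
  have hE1 : 0 ≤ ∫ x, ‖gradient g x‖ ^ 2 ∂(gm V) := integral_nonneg fun x => sq_nonneg _
  rcases ha0.eq_or_lt with h | h
  · rw [← h]; simp; positivity
  rcases hb0.eq_or_lt with h' | h'
  · rw [← h']; simp; positivity
  have l1 := energy_lim hf hfc
  have l2 := energy_lim hg hgc
  rw [← ha] at l1
  rw [← hb] at l2
  have st := step_lemma hf.continuous hfc hg.continuous hgc hf0 hg0 hdis h h'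
  have l3 : Tendsto (fun s : ℝ => s ^ 2) (𝓝[>] 0) (𝓝 0) := by
    have := (continuous_pow 2 (M := ℝ)).tendsto 0
    simp only [ne_eq, OfNat.ofNat_ne_zero, not_false_eq_true, zero_pow] at this
    exact this.mono_left nhdsWithin_le_nhds
  have l4 := ((l1.mul_const b).add (l2.const_mul a)).sub (((l1.mul l2).mul l3).mul_const (1/2))
  rw [mul_zero, zero_mul, sub_zero] at l4
  refine ge_of_tendsto l4 ?_
  filter_upwards [st, self_mem_nhdsWithin] with s hs hs0
  have hs0 : 0 < s := hs0
  rw [← ha, ← hb] at hs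
  set N := ∫ x, Pou s f x * f x ∂(gm V)
  set M := ∫ x, Pou s g x * g x ∂(gm V)
  have : 2 * (a - N) / s ^ 2 * b + a * (2 * (b - M) / s ^ 2) - 2 * (a - N) / s ^ 2 * (2 * (b - M) / s ^ 2) * s ^ 2 * (1 / 2)
      = 2 * (a * b - N * M) / s ^ 2 := by
    field_simp; ring
  rw [this, le_div_iff₀ (by positivity)]
  nlinarith

end Energy

end ACFproof

namespace ACFproof

open Topology Module

section Polar

variable {V : Type*} [NormedAddCommGroup V] [InnerProductSpace ℝ V] [FiniteDimensional ℝ V]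
  [MeasurableSpace V] [BorelSpace V]

/-- surface measure on the unit sphere -/
abbrev sg (V : Type*) [NormedAddCommGroup V] [InnerProductSpace ℝ V] [FiniteDimensional ℝ V]
  [MeasurableSpace V] [BorelSpace V] : Measure (sphere (0 : V) 1) := (volume : Measure V).toSphere

/-- spherical mean (unnormalized) -/
def sm (f : V → ℝ) (ρ : ℝ) : ℝ := ∫ θ : sphere (0 : V) 1, f (ρ • (θ : V)) ∂(sg V)

lemma polar {f : V → ℝ} (hf : Integrable f) (hd : 0 < finrank ℝ V) :
    ∫ x, f x = ∫ ρ in Ioi (0:ℝ), ρ ^ (finrank ℝ V - 1) * sm f ρ := by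
  have : Nontrivial V := Module.finrank_pos_iff.mp hd
  set μ : Measure V := volume
  have hmp := μ.measurePreserving_homeomorphUnitSphereProd
  have hemb := (homeomorphUnitSphereProd V).measurableEmbedding
  have key : ∀ x : ({0}ᶜ : Set V), f (((homeomorphUnitSphereProd V x).2 : ℝ) • ((homeomorphUnitSphereProd V x).1 : V)) = f x := by
    intro x
    have := congrArg Subtype.val ((homeomorphUnitSphereProd V).symm_apply_apply x)
    congr 1
  have hIntg : Integrable (fun p : sphere (0:V) 1 × Ioi (0:ℝ) => f ((p.2 : ℝ) • (p.1 : V)))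
      (μ.toSphere.prod (Measure.volumeIoiPow (finrank ℝ V - 1))) := by
    rw [← hmp.integrable_comp_emb hemb]
    have h1 : IntegrableOn f ({0}ᶜ) μ := hf.integrableOn
    rw [integrableOn_iff_comap_subtypeVal (by measurability)] at h1
    refine h1.congr (ae_of_all _ fun x => ?_)
    exact (key x).symm
  calc ∫ x, f x ∂μ = ∫ x : ({(0)}ᶜ : Set V), f x.1 ∂(μ.comap (↑)) := by
        rw [integral_subtype_comap (measurableSet_singleton _).compl fun x ↦ f x,
          restrict_compl_singleton]
    _ = ∫ p, f ((p.2 : ℝ) • (p.1 : V)) ∂μ.toSphere.prod (.volumeIoiPow (finrank ℝ V - 1)) := by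
        rw [← hmp.integral_comp hemb]
        exact integral_congr_ae (ae_of_all _ fun x => (key x).symm)
    _ = ∫ ρ : Ioi (0:ℝ), sm f ρ ∂(.volumeIoiPow (finrank ℝ V - 1)) := by
        rw [integral_prod_symm _ hIntg]
        rfl
    _ = _ := by
        simp only [Measure.volumeIoiPow, ENNReal.ofReal]
        rw [integral_withDensity_eq_integral_smul,
          integral_subtype_comap measurableSet_Ioi fun a ↦ Real.toNNReal (a ^ (finrank ℝ V - 1)) • sm f a,
          setIntegral_congr_fun measurableSet_Ioi fun x hx ↦ ?_]
        · rw [NNReal.smul_def, Real.coe_toNNReal _ (pow_nonneg hx.out.le _), smul_eq_mul]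
        · exact (measurable_subtype_coe.pow_const _).real_toNNReal

lemma sph_cont {F : ℝ → sphere (0:V) 1 → ℝ} (hF : Continuous F.uncurry) :
    Continuous (fun ρ => ∫ θ, F ρ θ ∂(sg V)) := by
  have := continuous_parametric_integral_of_continuous (μ := sg V) hF isCompact_univ
  simpa using this

lemma sph_integrable {F : sphere (0:V) 1 → ℝ} (hF : Continuous F) : Integrable F (sg V) :=
  hF.integrable_of_hasCompactSupport (HasCompactSupport.of_compactSpace F)

lemma sm_cont {f : V → ℝ} (hf : Continuous f) : Continuous (sm f) := by
  unfold sm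
  refine sph_cont (F := fun (ρ : ℝ) (θ : sphere (0:V) 1) => f (ρ • (θ:V))) ?_
  exact hf.comp (by fun_prop)

lemma sph_deriv {F F' : ℝ → sphere (0:V) 1 → ℝ} (hF : Continuous F.uncurry)
    (hF' : Continuous F'.uncurry) (h : ∀ ρ θ, HasDerivAt (fun ρ => F ρ θ) (F' ρ θ) ρ) (ρ : ℝ) :
    HasDerivAt (fun ρ => ∫ θ, F ρ θ ∂(sg V)) (∫ θ, F' ρ θ ∂(sg V)) ρ := by
  have hK : IsCompact (closedBall ρ 1 ×ˢ (univ : Set (sphere (0:V) 1))) :=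
    (isCompact_closedBall ρ 1).prod isCompact_univ
  obtain ⟨C, hC⟩ := hK.exists_bound_of_continuousOn hF'.continuousOn
  refine (hasDerivAt_integral_of_dominated_loc_of_deriv_le (F := F) (F' := F') (bound := fun _ => C)
    (s := ball ρ 1) (ball_mem_nhds _ one_pos) ?_ ?_ ?_ ?_ ?_ ?_).2
  · exact Eventually.of_forall fun x => Continuous.aestronglyMeasurable
      (hF.comp (by fun_prop : Continuous fun θ : sphere (0:V) 1 => (x, θ)))
  · exact sph_integrable (hF.comp (by fun_prop : Continuous fun θ : sphere (0:V) 1 => (ρ, θ)))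
  · exact Continuous.aestronglyMeasurable
      (hF'.comp (by fun_prop : Continuous fun θ : sphere (0:V) 1 => (ρ, θ)))
  · exact ae_of_all _ fun θ x hx => hC (x, θ) ⟨ball_subset_closedBall hx, mem_univ _⟩
  · exact integrable_const _
  · exact ae_of_all _ fun θ x _ => h x θ

/-- radial first derivative mean -/
def sm1 (w : V → ℝ) (ρ : ℝ) : ℝ := ∫ θ : sphere (0 : V) 1, fderiv ℝ w (ρ • (θ : V)) (θ:V) ∂(sg V)
/-- radial second derivative mean -/
def sm2 (w : V → ℝ) (ρ : ℝ) : ℝ :=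
  ∫ θ : sphere (0 : V) 1, fderiv ℝ (fderiv ℝ w) (ρ • (θ : V)) (θ:V) (θ:V) ∂(sg V)

lemma sm1_cont {w : V → ℝ} (hw : ContDiff ℝ 1 w) : Continuous (sm1 w) := by
  unfold sm1
  refine sph_cont (F := fun (ρ : ℝ) (θ : sphere (0:V) 1) => fderiv ℝ w (ρ • (θ : V)) (θ:V)) ?_
  have h1 := hw.continuous_fderiv one_ne_zero
  exact (h1.comp (by fun_prop : Continuous fun p : ℝ × sphere (0:V) 1 => p.1 • (p.2:V))).clm_apply (by fun_prop)

lemma fd_contDiff {w : V → ℝ} (hw : ContDiff ℝ 2 w) : ContDiff ℝ 1 (fderiv ℝ w) :=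
  hw.fderiv_right (by norm_num)

lemma sm2_cont {w : V → ℝ} (hw : ContDiff ℝ 2 w) : Continuous (sm2 w) := by
  unfold sm2
  refine sph_cont (F := fun (ρ : ℝ) (θ : sphere (0:V) 1) => fderiv ℝ (fderiv ℝ w) (ρ • (θ : V)) (θ:V) (θ:V)) ?_
  have h1 := (fd_contDiff hw).continuous_fderiv one_ne_zero
  exact ((h1.comp (by fun_prop : Continuous fun p : ℝ × sphere (0:V) 1 => p.1 • (p.2:V))).clm_apply
    (by fun_prop)).clm_apply (by fun_prop)

lemma sm_deriv {w : V → ℝ} (hw : ContDiff ℝ 1 w) (ρ : ℝ) : HasDerivAt (sm w) (sm1 w ρ) ρ := by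
  have h1 := hw.continuous_fderiv one_ne_zero
  refine sph_deriv (F := fun (ρ : ℝ) (θ : sphere (0:V) 1) => w (ρ • (θ : V))) (F' := fun (ρ : ℝ) (θ : sphere (0:V) 1) => fderiv ℝ w (ρ • (θ : V)) (θ:V)) ?_ ?_ ?_ ρ
  · exact hw.continuous.comp (by fun_prop)
  · exact (h1.comp (by fun_prop : Continuous fun p : ℝ × sphere (0:V) 1 => p.1 • (p.2:V))).clm_apply (by fun_prop)
  · intro ρ θ
    have h := (hw.differentiable one_ne_zero (ρ • (θ:V))).hasFDerivAt
    have h2 : HasDerivAt (fun ρ : ℝ => ρ • (θ:V)) (θ:V) ρ := by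
      simpa using (hasDerivAt_id ρ).smul_const (θ:V)
    exact h.comp_hasDerivAt ρ h2

lemma sm1_deriv {w : V → ℝ} (hw : ContDiff ℝ 2 w) (ρ : ℝ) : HasDerivAt (sm1 w) (sm2 w ρ) ρ := by
  have h0 := (fd_contDiff hw)
  have h1 := (fd_contDiff hw).continuous_fderiv one_ne_zero
  refine sph_deriv (F := fun (ρ : ℝ) (θ : sphere (0:V) 1) => fderiv ℝ w (ρ • (θ : V)) (θ:V)) (F' := fun (ρ : ℝ) (θ : sphere (0:V) 1) => fderiv ℝ (fderiv ℝ w) (ρ • (θ : V)) (θ:V) (θ:V)) ?_ ?_ ?_ ρ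
  · exact (h0.continuous.comp (by fun_prop : Continuous fun p : ℝ × sphere (0:V) 1 => p.1 • (p.2:V))).clm_apply (by fun_prop)
  · exact ((h1.comp (by fun_prop : Continuous fun p : ℝ × sphere (0:V) 1 => p.1 • (p.2:V))).clm_apply
      (by fun_prop)).clm_apply (by fun_prop)
  · intro ρ θ
    have h := (h0.differentiable one_ne_zero (ρ • (θ:V))).hasFDerivAt
    have h2 : HasDerivAt (fun ρ : ℝ => ρ • (θ:V)) (θ:V) ρ := by
      simpa using (hasDerivAt_id ρ).smul_const (θ:V)
    have h3 := h.comp_hasDerivAt ρ h2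
    exact h3.clm_apply (hasDerivAt_const ρ (θ:V)) |>.congr_deriv (by simp)

/-- Laplacian w.r.t. an orthonormal basis -/
def lapb {ι : Type*} [Fintype ι] (b : OrthonormalBasis ι ℝ V) (w : V → ℝ) (x : V) : ℝ :=
  ∑ i, fderiv ℝ (fun y => fderiv ℝ w y (b i)) x (b i)

lemma lapb_cont {ι : Type*} [Fintype ι] (b : OrthonormalBasis ι ℝ V) {w : V → ℝ} (hw : ContDiff ℝ 2 w) :
    Continuous (lapb b w) := by
  unfold lapb
  refine continuous_finsetSum _ fun i _ => ?_
  have h : ContDiff ℝ 1 (fun y => fderiv ℝ w y (b i)) := (fd_contDiff hw).clm_apply contDiff_const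
  exact (h.continuous_fderiv one_ne_zero).clm_apply continuous_const

lemma rad_smooth {η : ℝ → ℝ} (hη : ContDiff ℝ 1 η) (hs : tsupport η ⊆ Ioi 0) :
    ContDiff ℝ 1 (fun x : V => η ‖x‖) := by
  rw [contDiff_iff_contDiffAt]
  intro x
  by_cases hx : x = 0
  · subst hx
    have : (fun x : V => η ‖x‖) =ᶠ[𝓝 0] fun _ => 0 := by
      have h0 : (0:ℝ) ∉ tsupport η := fun h => lt_irrefl (0:ℝ) (mem_Ioi.mp (hs h))
      have h1 : ∀ᶠ t in 𝓝 (0:ℝ), η t = 0 := by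
        have := notMem_tsupport_iff_eventuallyEq.mp h0
        exact this
      have h2 : Tendsto (fun x : V => ‖x‖) (𝓝 0) (𝓝 0) := by
        simpa using (continuous_norm (E := V)).tendsto 0
      exact h2.eventually h1
    exact contDiffAt_const.congr_of_eventuallyEq this
  · exact hη.contDiffAt.comp x (contDiffAt_norm ℝ hx)

lemma rad_cs {η : ℝ → ℝ} (hc : HasCompactSupport η) : HasCompactSupport (fun x : V => η ‖x‖) := by
  obtain ⟨C, hC⟩ := hc.isCompact.isBounded.exists_norm_le
  refine HasCompactSupport.intro (isCompact_closedBall (0:V) C) fun x hx => ?_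
  by_contra h
  have := hC ‖x‖ (subset_tsupport _ h)
  simp at hx this
  linarith

lemma rad_fderiv {η : ℝ → ℝ} (hη : ContDiff ℝ 1 η) {x : V} (hx : x ≠ 0) (v : V) :
    fderiv ℝ (fun x : V => η ‖x‖) x v = deriv η ‖x‖ * (‖x‖⁻¹ * ⟪x, v⟫) := by
  have h1 : HasFDerivAt (fun x : V => ‖x‖) (‖x‖⁻¹ • innerSL ℝ x) x := by
    have hn : 0 < ‖x‖ := norm_pos_iff.mpr hx
    have h2 := (hasStrictFDerivAt_norm_sq x).hasFDerivAt.sqrt (by positivity)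
    have h3 : (fun y : V => √(‖y‖ ^ 2)) = fun y => ‖y‖ := by
      funext y; exact Real.sqrt_sq (norm_nonneg y)
    rw [h3] at h2
    refine h2.congr_fderiv ?_
    rw [Real.sqrt_sq hn.le]
    ext v
    simp
    field_simp
  have h4 := ((hη.differentiable one_ne_zero ‖x‖).hasDerivAt).comp_hasFDerivAt x h1
  have h5 : HasFDerivAt (fun x : V => η ‖x‖) (deriv η ‖x‖ • ‖x‖⁻¹ • innerSL ℝ x) x := h4
  rw [h5.fderiv]
  simp

lemma sph_lap {ι : Type*} [Fintype ι] (b : OrthonormalBasis ι ℝ V) (hd : 2 ≤ finrank ℝ V)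
    {w : V → ℝ} (hw : ContDiff ℝ 2 w) {ρ : ℝ} (hρ : 0 < ρ) :
    ρ * sm2 w ρ + ((finrank ℝ V : ℝ) - 1) * sm1 w ρ = ρ * sm (lapb b w) ρ := by
  obtain ⟨m, hm⟩ : ∃ m, finrank ℝ V = m + 2 := ⟨finrank ℝ V - 2, by omega⟩
  have hw1 : ContDiff ℝ 1 w := hw.of_le (by norm_num)
  set G : ℝ → ℝ := fun ρ => ρ ^ (m+1) * sm1 w ρ with hG
  set G' : ℝ → ℝ := fun ρ => ((m+1 : ℕ) : ℝ) * ρ ^ m * sm1 w ρ + ρ ^ (m+1) * sm2 w ρ with hG'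
  have hGd : ∀ ρ, HasDerivAt G (G' ρ) ρ := fun ρ => by
    have := (hasDerivAt_pow (m+1) ρ).mul (sm1_deriv hw ρ)
    exact this
  have c1 := sm1_cont hw1
  have c2 := sm2_cont hw
  have cL : Continuous (sm (lapb b w)) := sm_cont (lapb_cont b hw)
  have cG : Continuous G := by fun_prop
  have cG' : Continuous G' := by fun_prop
  have main : ∀ (η : ℝ → ℝ), ContDiff ℝ 1 η → HasCompactSupport η → tsupport η ⊆ Ioi 0 →
      ∫ x, η x * (x ^ (m+1) * sm (lapb b w) x - G' x) = 0 := by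
    intro η hη hc hs
    have hηc := hη.continuous
    have hη'c : Continuous (deriv η) := hη.continuous_deriv le_rfl
    have hz : ∀ t, t ≤ 0 → η t = 0 := fun t ht => by
      by_contra h
      exact absurd (hs (subset_tsupport _ h)) (by simpa using ht)
    have hz' : ∀ t, t ≤ 0 → deriv η t = 0 := fun t ht => by
      by_contra h
      exact absurd (hs (support_deriv_subset h)) (by simpa using ht)
    set H : V → ℝ := fun x => η ‖x‖ with hH
    have hHs : ContDiff ℝ 1 H := rad_smooth hη hs
    have hHc : HasCompactSupport H := rad_cs hc
    have hHf : ∀ v x, fderiv ℝ H x v = deriv η ‖x‖ * (‖x‖⁻¹ * ⟪x, v⟫) := fun v x => by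
      by_cases hx : x = 0
      · subst hx
        have : H =ᶠ[𝓝 0] fun _ => 0 := by
          have h0 : (0:ℝ) ∉ tsupport η := fun h => lt_irrefl (0:ℝ) (mem_Ioi.mp (hs h))
          have h1 : ∀ᶠ t in 𝓝 (0:ℝ), η t = 0 := notMem_tsupport_iff_eventuallyEq.mp h0
          have h2 : Tendsto (fun x : V => ‖x‖) (𝓝 0) (𝓝 0) := by
            simpa using (continuous_norm (E := V)).tendsto 0
          exact h2.eventually h1
        rw [this.fderiv_eq]
        simp
      · exact rad_fderiv hη hx v
    have hHfc : ∀ v, Continuous fun x => fderiv ℝ H x v := fun v =>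
      (hHs.continuous_fderiv one_ne_zero).clm_apply continuous_const
    have hHfs : ∀ v, HasCompactSupport fun x => fderiv ℝ H x v := fun v => hHc.fderiv_apply (𝕜 := ℝ) v
    have ibp : ∀ i, ∫ x, H x * fderiv ℝ (fun y => fderiv ℝ w y (b i)) x (b i)
        = - ∫ x, fderiv ℝ H x (b i) * fderiv ℝ w x (b i) := by
      intro i
      have h : ContDiff ℝ 1 (fun y => fderiv ℝ w y (b i)) := (fd_contDiff hw).clm_apply contDiff_const
      have hh : Continuous fun x => fderiv ℝ (fun y => fderiv ℝ w y (b i)) x (b i) :=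
        (h.continuous_fderiv one_ne_zero).clm_apply continuous_const
      refine integral_mul_fderiv_eq_neg_fderiv_mul_of_integrable (f := H) (g := fun y => fderiv ℝ w y (b i)) ?_ ?_ ?_ ?_ ?_
      · exact cs_integrable (hHfc _) (hHfs _) h.continuous
      · exact cs_integrable hHs.continuous hHc hh
      · exact cs_integrable hHs.continuous hHc h.continuous
      · exact fun x _ => hHs.differentiable one_ne_zero x
      · exact fun x _ => h.differentiable one_ne_zero x
    have hsum : ∫ x, H x * lapb b w x = - ∫ x, deriv η ‖x‖ * (‖x‖⁻¹ * fderiv ℝ w x x) := by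
      have e1 : ∀ x, H x * lapb b w x = ∑ i, H x * fderiv ℝ (fun y => fderiv ℝ w y (b i)) x (b i) := by
        intro x; rw [lapb, Finset.mul_sum]
      have e2 : ∀ x, deriv η ‖x‖ * (‖x‖⁻¹ * fderiv ℝ w x x) = ∑ i, fderiv ℝ H x (b i) * fderiv ℝ w x (b i) := by
        intro x
        conv_lhs => rw [show fderiv ℝ w x x = fderiv ℝ w x (∑ i, ⟪b i, x⟫ • b i) by rw [b.sum_repr']]
        rw [map_sum, Finset.mul_sum, Finset.mul_sum]
        refine Finset.sum_congr rfl fun i _ => ?_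
        rw [hHf, map_smul, real_inner_comm, smul_eq_mul]; ring
      simp_rw [e1, e2]
      rw [integral_finsetSum, integral_finsetSum, ← Finset.sum_neg_distrib]
      · exact Finset.sum_congr rfl fun i _ => ibp i
      · intro i _
        exact cs_integrable (hHfc _) (hHfs _) ((hw1.continuous_fderiv one_ne_zero).clm_apply continuous_const)
      · intro i _
        have h : ContDiff ℝ 1 (fun y => fderiv ℝ w y (b i)) := (fd_contDiff hw).clm_apply contDiff_const
        exact cs_integrable hHs.continuous hHc ((h.continuous_fderiv one_ne_zero).clm_apply continuous_const)
    have int2 : Integrable (fun x => deriv η ‖x‖ * (‖x‖⁻¹ * fderiv ℝ w x x)) := by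
      have e2 : ∀ x, deriv η ‖x‖ * (‖x‖⁻¹ * fderiv ℝ w x x) = ∑ i, fderiv ℝ H x (b i) * fderiv ℝ w x (b i) := by
        intro x
        conv_lhs => rw [show fderiv ℝ w x x = fderiv ℝ w x (∑ i, ⟪b i, x⟫ • b i) by rw [b.sum_repr']]
        rw [map_sum, Finset.mul_sum, Finset.mul_sum]
        refine Finset.sum_congr rfl fun i _ => ?_
        rw [hHf, map_smul, real_inner_comm, smul_eq_mul]; ring
      simp_rw [e2]
      refine integrable_finsetSum _ fun i _ => ?_
      exact cs_integrable (hHfc _) (hHfs _) ((hw1.continuous_fderiv one_ne_zero).clm_apply continuous_const)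
    rw [polar (cs_integrable hHs.continuous hHc (lapb_cont b hw)) (by omega), polar int2 (by omega)] at hsum
    have f1 : ∀ ρ ∈ Ioi (0:ℝ), ρ ^ (finrank ℝ V - 1) * sm (fun x => H x * lapb b w x) ρ
        = η ρ * (ρ ^ (m+1) * sm (lapb b w) ρ) := by
      intro ρ hρ
      have hρ : 0 < ρ := hρ
      have : sm (fun x => H x * lapb b w x) ρ = η ρ * sm (lapb b w) ρ := by
        unfold sm
        rw [← integral_const_mul]
        refine integral_congr_ae (ae_of_all _ fun θ => ?_)
        simp [hH, norm_smul, abs_of_pos hρ]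
      rw [this, hm]; simp; ring
    have f2 : ∀ ρ ∈ Ioi (0:ℝ), ρ ^ (finrank ℝ V - 1) * sm (fun x => deriv η ‖x‖ * (‖x‖⁻¹ * fderiv ℝ w x x)) ρ
        = deriv η ρ * G ρ := by
      intro ρ hρ
      have hρ : 0 < ρ := hρ
      have : sm (fun x => deriv η ‖x‖ * (‖x‖⁻¹ * fderiv ℝ w x x)) ρ = deriv η ρ * sm1 w ρ := by
        unfold sm sm1
        rw [← integral_const_mul]
        refine integral_congr_ae (ae_of_all _ fun θ => ?_)
        simp [norm_smul, abs_of_pos hρ, hρ.ne']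
      rw [this, hm]; simp [hG]; ring
    rw [setIntegral_congr_fun measurableSet_Ioi f1, setIntegral_congr_fun measurableSet_Ioi f2,
      setIntegral_eq_integral_of_forall_compl_eq_zero (fun x hx => by rw [hz x (by simpa using hx), zero_mul]),
      setIntegral_eq_integral_of_forall_compl_eq_zero (fun x hx => by rw [hz' x (by simpa using hx), zero_mul])] at hsum
    have hi : ∀ k : ℝ → ℝ, Continuous k → Integrable fun x => η x * k x := fun k hk =>
      (hηc.mul hk).integrable_of_hasCompactSupport hc.mul_right
    have ibp1 := integral_mul_deriv_eq_deriv_mul_of_integrable (u := η) (v := G) (u' := deriv η) (v' := G')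
      (fun x _ => (hη.differentiable one_ne_zero x).hasDerivAt) (fun x _ => hGd x) (hi _ cG')
      ((hη'c.mul cG).integrable_of_hasCompactSupport hc.deriv.mul_right) (hi _ cG)
    have cc : Continuous fun x => x ^ (m+1) * sm (lapb b w) x := by fun_prop
    simp_rw [mul_sub]
    rw [integral_sub (hi _ cc) (hi _ cG')]
    rw [hsum, ibp1]; ring
  have cc : Continuous fun x => x ^ (m+1) * sm (lapb b w) x - G' x := by fun_prop
  have hae := isOpen_Ioi.ae_eq_zero_of_integral_contDiff_smul_eq_zero (U := Ioi (0:ℝ)) (μ := volume)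
    (f := fun x => x ^ (m+1) * sm (lapb b w) x - G' x) (cc.locallyIntegrable.locallyIntegrableOn _)
    (fun g hg hgc hgs => main g (hg.of_le (by simp)) hgc hgs)
  have := Measure.eqOn_open_of_ae_eq (μ := volume) (U := Ioi (0:ℝ)) (f := fun x => x ^ (m+1) * sm (lapb b w) x - G' x) (g := fun _ => 0)
    ((ae_restrict_iff' measurableSet_Ioi).mpr hae) isOpen_Ioi cc.continuousOn continuousOn_const hρ
  simp only [hG'] at this
  rw [hm]
  have h0 : ρ ^ m ≠ 0 := by positivity
  apply mul_left_cancel₀ h0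
  push_cast at this ⊢
  rw [pow_succ] at this
  linarith

end Polar

end ACFproof

namespace ACFproof

open Topology Module

section Cutoff

/-- scaled cutoff -/
def chi (k ρ : ℝ) : ℝ := Real.smoothTransition (k * ρ - 1) * (1 - Real.smoothTransition (ρ / k - 1))

/-- `ρ` times derivative of the cutoff -/
def chi' (k ρ : ℝ) : ℝ := (k * ρ) * deriv Real.smoothTransition (k * ρ - 1) * (1 - Real.smoothTransition (ρ / k - 1))
  - Real.smoothTransition (k * ρ - 1) * ((ρ / k) * deriv Real.smoothTransition (ρ / k - 1))

lemma st_deriv (x : ℝ) : HasDerivAt Real.smoothTransition (deriv Real.smoothTransition x) x :=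
  ((Real.smoothTransition.contDiff (n := 1)).differentiable one_ne_zero x).hasDerivAt

lemma chi_smooth (k : ℝ) : ContDiff ℝ 1 (chi k) := by
  unfold chi
  have h := Real.smoothTransition.contDiff (n := 1)
  refine (h.comp (by fun_prop)).mul (contDiff_const.sub (h.comp (by fun_prop)))

lemma chi_deriv (k ρ : ℝ) : HasDerivAt (chi k)
    (k * deriv Real.smoothTransition (k * ρ - 1) * (1 - Real.smoothTransition (ρ / k - 1))
  - Real.smoothTransition (k * ρ - 1) * (k⁻¹ * deriv Real.smoothTransition (ρ / k - 1))) ρ := by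
  have h1 : HasDerivAt (fun ρ : ℝ => k * ρ - 1) k ρ := by
    simpa using ((hasDerivAt_id ρ).const_mul k).sub_const 1
  have h2 : HasDerivAt (fun ρ : ℝ => ρ / k - 1) (k⁻¹) ρ := by
    simpa using ((hasDerivAt_id ρ).div_const k).sub_const 1
  have h3 := (st_deriv (k * ρ - 1)).comp ρ h1
  have h4 := ((st_deriv (ρ / k - 1)).comp ρ h2).const_sub 1
  have h5 := h3.mul h4
  refine HasDerivAt.congr_deriv (f := chi k) h5 ?_
  simp only [Function.comp]
  ring

lemma st_deriv_zero {x : ℝ} (hx : x < 0 ∨ 1 < x) : deriv Real.smoothTransition x = 0 := by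
  rcases hx with hx | hx
  · have : Real.smoothTransition =ᶠ[𝓝 x] fun _ => 0 := by
      filter_upwards [gt_mem_nhds hx] with y hy
      exact Real.smoothTransition.zero_of_nonpos hy.le
    rw [this.deriv_eq]; simp
  · have : Real.smoothTransition =ᶠ[𝓝 x] fun _ => 1 := by
      filter_upwards [lt_mem_nhds hx] with y hy
      exact Real.smoothTransition.one_of_one_le hy.le
    rw [this.deriv_eq]; simp

lemma st_bound : ∃ M : ℝ, 0 ≤ M ∧ ∀ y : ℝ, |y * deriv Real.smoothTransition (y - 1)| ≤ M := by
  have hc : Continuous fun y : ℝ => y * deriv Real.smoothTransition (y - 1) := by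
    have := (Real.smoothTransition.contDiff (n := 1)).continuous_deriv le_rfl
    fun_prop
  obtain ⟨M, hM⟩ := (isCompact_Icc (a := (1:ℝ)) (b := 2)).exists_bound_of_continuousOn hc.continuousOn
  refine ⟨max M 0, le_max_right _ _, fun y => ?_⟩
  by_cases h : y ∈ Icc (1:ℝ) 2
  · exact (hM y h).trans (le_max_left _ _)
  · have : y - 1 < 0 ∨ 1 < y - 1 := by
      by_contra hh
      push Not at hh
      exact h ⟨by linarith [hh.1], by linarith [hh.2]⟩
    rw [st_deriv_zero this]; simp

lemma chi_abs (k ρ : ℝ) : |chi k ρ| ≤ 1 := by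
  have h1 := Real.smoothTransition.nonneg (k * ρ - 1)
  have h2 := Real.smoothTransition.le_one (k * ρ - 1)
  have h3 := Real.smoothTransition.nonneg (ρ / k - 1)
  have h4 := Real.smoothTransition.le_one (ρ / k - 1)
  rw [chi, abs_of_nonneg (mul_nonneg h1 (by linarith))]
  nlinarith

lemma chi'_abs : ∃ M : ℝ, 0 ≤ M ∧ ∀ k ρ : ℝ, |chi' k ρ| ≤ M := by
  obtain ⟨M, hM0, hM⟩ := st_bound
  refine ⟨M + M, by linarith, fun k ρ => ?_⟩
  have h1 := Real.smoothTransition.nonneg (k * ρ - 1)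
  have h2 := Real.smoothTransition.le_one (k * ρ - 1)
  have h3 := Real.smoothTransition.nonneg (ρ / k - 1)
  have h4 := Real.smoothTransition.le_one (ρ / k - 1)
  rw [chi']
  refine (abs_sub _ _).trans (add_le_add ?_ ?_)
  · rw [abs_mul]
    have : |1 - Real.smoothTransition (ρ / k - 1)| ≤ 1 := abs_le.mpr ⟨by linarith, by linarith⟩
    calc _ ≤ M * 1 := mul_le_mul (hM _) this (abs_nonneg _) hM0
      _ = M := mul_one _
  · rw [abs_mul]
    have : |Real.smoothTransition (k * ρ - 1)| ≤ 1 := abs_le.mpr ⟨by linarith, by linarith⟩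
    calc _ ≤ 1 * M := mul_le_mul this (hM _) (abs_nonneg _) zero_le_one
      _ = M := one_mul _

lemma chi_ev {ρ : ℝ} (hρ : 0 < ρ) : ∀ᶠ k : ℕ in atTop, chi (k+1) ρ = 1 ∧ chi' (k+1) ρ = 0 := by
  have t1 : Tendsto (fun k : ℕ => ((k:ℝ)+1)) atTop atTop :=
    tendsto_atTop_add_const_right _ _ tendsto_natCast_atTop_atTop
  filter_upwards [t1.eventually_gt_atTop (2/ρ), t1.eventually_gt_atTop ρ] with k h1 h2
  have hk : (0:ℝ) < k + 1 := by positivity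
  have a1 : 1 < (k+1) * ρ - 1 := by
    rw [div_lt_iff₀ hρ] at h1; linarith
  have a2 : ρ / (k+1) - 1 < 0 := by
    rw [sub_neg, div_lt_one hk]; exact h2
  constructor
  · rw [chi, Real.smoothTransition.one_of_one_le a1.le, Real.smoothTransition.zero_of_nonpos a2.le]; norm_num
  · rw [chi', st_deriv_zero (Or.inr a1), st_deriv_zero (Or.inl a2)]; norm_num

/-- approximating profile -/
def phik (α k ρ : ℝ) : ℝ := ρ ^ α * chi k ρ

lemma phik_zero {α k : ℝ} (hk : 0 < k) {ρ : ℝ} (h : ρ ∉ Icc (1/k) (2*k)) : phik α k ρ = 0 := by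
  have : ρ < 1/k ∨ 2 * k < ρ := by
    by_contra hh; push Not at hh; exact h hh
  rw [phik, chi]
  rcases this with h | h
  · rw [Real.smoothTransition.zero_of_nonpos]; · ring
    rw [lt_div_iff₀ hk] at h; linarith
  · rw [Real.smoothTransition.one_of_one_le (x := ρ / k - 1)]; · ring
    rw [le_sub_iff_add_le, le_div_iff₀ hk]; linarith

lemma phik_tsupport {α k : ℝ} (hk : 0 < k) : tsupport (phik α k) ⊆ Icc (1/k) (2*k) :=
  closure_minimal (fun x hx => by by_contra h; exact hx (phik_zero hk h)) isClosed_Icc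

lemma phik_ts {α k : ℝ} (hk : 0 < k) : tsupport (phik α k) ⊆ Ioi 0 := fun x hx => by
  have := (phik_tsupport hk hx).1
  exact lt_of_lt_of_le (by positivity) this

lemma phik_cs {α k : ℝ} (hk : 0 < k) : HasCompactSupport (phik α k) :=
  HasCompactSupport.of_support_subset_isCompact isCompact_Icc ((subset_tsupport _).trans (phik_tsupport hk))

lemma phik_smooth {α k : ℝ} (hk : 0 < k) : ContDiff ℝ 1 (phik α k) := by
  rw [contDiff_iff_contDiffAt]
  intro x
  by_cases hx : 0 < x
  · exact (contDiffAt_id.rpow_const_of_ne hx.ne').mul (chi_smooth k).contDiffAt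
  · have : phik α k =ᶠ[𝓝 x] fun _ => 0 := by
      filter_upwards [gt_mem_nhds (show x < 1/k from lt_of_le_of_lt (not_lt.mp hx) (by positivity))] with y hy
      exact phik_zero hk (fun h => absurd h.1 (not_le.mpr hy))
    exact contDiffAt_const.congr_of_eventuallyEq this

lemma phik_deriv {α k ρ : ℝ} (hρ : 0 < ρ) :
    deriv (phik α k) ρ = ρ ^ (α - 1) * (α * chi k ρ + chi' k ρ) := by
  have h1 := (Real.hasDerivAt_rpow_const (p := α) (Or.inl hρ.ne')).mul (chi_deriv k ρ)
  have h2 : HasDerivAt (phik α k) _ ρ := h1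
  rw [h2.deriv, chi', Real.rpow_sub_one hρ.ne']
  field_simp

lemma mom_int {s : ℝ} (hs : -1 < s) :
    IntegrableOn (fun ρ : ℝ => ρ ^ s * Real.exp (-(1/2) * ρ ^ 2)) (Ioi 0) :=
  integrableOn_rpow_mul_exp_neg_mul_sq (by norm_num) hs

/-- Gaussian moments -/
def mom (s : ℝ) : ℝ := ∫ ρ in Ioi (0:ℝ), ρ ^ s * Real.exp (-(1/2) * ρ ^ 2)

lemma mom_eq {s : ℝ} (hs : -1 < s) : mom s = (1/2) ^ (-(s+1)/2) * (1/2) * Real.Gamma ((s+1)/2) := by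
  rw [mom, ← integral_rpow_mul_exp_neg_mul_rpow (p := 2) (q := s) (b := 1/2) (by norm_num) hs (by norm_num)]
  simp

lemma mom_pos {s : ℝ} (hs : -1 < s) : 0 < mom s := by
  rw [mom_eq hs]
  have := Real.Gamma_pos_of_pos (s := (s+1)/2) (by linarith)
  positivity

lemma mom_rec {s : ℝ} (hs : -1 < s) : mom (s + 2) = (s + 1) * mom s := by
  rw [mom_eq hs, mom_eq (by linarith), show (s + 2 + 1)/2 = (s+1)/2 + 1 by ring,
    Real.Gamma_add_one (by intro h; linarith), show -(s+2+1)/2 = -(s+1)/2 - 1 by ring,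
    Real.rpow_sub_one (by norm_num)]
  ring

lemma mom_lim {s : ℝ} (hs : -1 < s) {h : ℕ → ℝ → ℝ} (hc : ∀ k, Continuous (h k)) {M c : ℝ}
    (hM : ∀ k ρ, |h k ρ| ≤ M) (hl : ∀ ρ, 0 < ρ → ∀ᶠ k in atTop, h k ρ = c) :
    Tendsto (fun k => ∫ ρ in Ioi (0:ℝ), ρ ^ s * Real.exp (-(1/2) * ρ ^ 2) * h k ρ ^ 2) atTop (𝓝 (c ^ 2 * mom s)) := by
  have e : c ^ 2 * mom s = ∫ ρ in Ioi (0:ℝ), ρ ^ s * Real.exp (-(1/2) * ρ ^ 2) * c ^ 2 := by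
    rw [integral_mul_const, mom]; ring
  rw [e]
  refine tendsto_integral_of_dominated_convergence (fun ρ => ρ ^ s * Real.exp (-(1/2) * ρ ^ 2) * M ^ 2) ?_ ?_ ?_ ?_
  · intro k
    exact (mom_int hs).aestronglyMeasurable.mul ((hc k).pow 2).aestronglyMeasurable
  · exact (mom_int hs).mul_const _
  · intro k
    refine (ae_restrict_iff' measurableSet_Ioi).mpr (ae_of_all _ fun ρ hρ => ?_)
    have h1 : 0 ≤ ρ ^ s * Real.exp (-(1/2) * ρ ^ 2) := mul_nonneg (Real.rpow_nonneg (le_of_lt hρ) _) (Real.exp_pos _).le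
    rw [norm_mul, Real.norm_of_nonneg h1, norm_pow, Real.norm_eq_abs]
    gcongr
    exact hM k ρ
  · refine (ae_restrict_iff' measurableSet_Ioi).mpr (ae_of_all _ fun ρ hρ => ?_)
    refine Tendsto.congr' ?_ tendsto_const_nhds
    filter_upwards [hl ρ hρ] with k hk
    rw [hk]

/-- weighted radial energies -/
def e1 (m : ℕ) (φ : ℝ → ℝ) : ℝ := ∫ ρ in Ioi (0:ℝ), ρ ^ (m+1) * (Real.exp (-(1/2) * ρ ^ 2) * φ ρ ^ 2)
/-- weighted radial energies -/
def e0 (m : ℕ) (φ : ℝ → ℝ) : ℝ := ∫ ρ in Ioi (0:ℝ), ρ ^ (m+1) * (Real.exp (-(1/2) * ρ ^ 2) * (φ ρ / ρ) ^ 2)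

lemma chi'_cont (k : ℝ) : Continuous (chi' k) := by
  have h1 := (Real.smoothTransition.contDiff (n := 1)).continuous_deriv le_rfl
  have h2 := Real.smoothTransition.continuous
  unfold chi'
  fun_prop

lemma approx_e1 (m : ℕ) {α : ℝ} (hα : 0 < α) :
    Tendsto (fun k : ℕ => e1 m (phik α (k+1))) atTop (𝓝 ((2*α+m) * mom (2*α+m-1))) := by
  have hm : (0:ℝ) ≤ m := Nat.cast_nonneg m
  have := mom_lim (s := 2*α+m+1) (by linarith) (h := fun k ρ => chi (k+1) ρ) (fun k => (chi_smooth _).continuous)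
    (M := 1) (c := 1) (fun k ρ => chi_abs _ _) (fun ρ hρ => (chi_ev hρ).mono fun k h => h.1)
  have e : 1 ^ 2 * mom (2*α+m+1) = (2*α+m) * mom (2*α+m-1) := by
    rw [show 2*α+m+1 = (2*α+m-1)+2 by ring, mom_rec (by linarith)]; ring
  rw [e] at this
  refine this.congr fun k => setIntegral_congr_fun measurableSet_Ioi fun ρ hρ => ?_
  have hρ : 0 < ρ := hρ
  have : ρ ^ (2*α+m+1) = ρ ^ (m+1) * (ρ ^ α) ^ 2 := by
    rw [← Real.rpow_natCast (ρ ^ α) 2, ← Real.rpow_mul hρ.le, ← Real.rpow_natCast, ← Real.rpow_add hρ]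
    congr 1; push_cast; ring
  simp only [phik, this]; ring

lemma approx_e0 (m : ℕ) {α : ℝ} (hα : 0 < α) :
    Tendsto (fun k : ℕ => e0 m (phik α (k+1))) atTop (𝓝 (mom (2*α+m-1))) := by
  have hm : (0:ℝ) ≤ m := Nat.cast_nonneg m
  have := mom_lim (s := 2*α+m-1) (by linarith) (h := fun k ρ => chi (k+1) ρ) (fun k => (chi_smooth _).continuous)
    (M := 1) (c := 1) (fun k ρ => chi_abs _ _) (fun ρ hρ => (chi_ev hρ).mono fun k h => h.1)
  rw [one_pow, one_mul] at this
  refine this.congr fun k => setIntegral_congr_fun measurableSet_Ioi fun ρ hρ => ?_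
  have hρ : 0 < ρ := hρ
  have : ρ ^ (2*α+m-1) = ρ ^ (m+1) * (ρ ^ (α-1)) ^ 2 := by
    rw [← Real.rpow_natCast (ρ ^ (α-1)) 2, ← Real.rpow_mul hρ.le, ← Real.rpow_natCast, ← Real.rpow_add hρ]
    congr 1; push_cast; ring
  simp only [phik, this, Real.rpow_sub_one hρ.ne']; field_simp

lemma approx_e' (m : ℕ) {α : ℝ} (hα : 0 < α) :
    Tendsto (fun k : ℕ => e1 m (deriv (phik α (k+1)))) atTop (𝓝 (α ^ 2 * mom (2*α+m-1))) := by
  have hm : (0:ℝ) ≤ m := Nat.cast_nonneg m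
  obtain ⟨M, hM0, hM⟩ := chi'_abs
  have := mom_lim (s := 2*α+m-1) (by linarith) (h := fun k ρ => α * chi (k+1) ρ + chi' (k+1) ρ)
    (fun k => ((chi_smooth _).continuous.const_mul α |>.add (chi'_cont _)))
    (M := α + M) (c := α) (fun k ρ => ?_) (fun ρ hρ => (chi_ev hρ).mono fun k h => by rw [h.1, h.2]; ring)
  · refine this.congr fun k => setIntegral_congr_fun measurableSet_Ioi fun ρ hρ => ?_
    have hρ : 0 < ρ := hρ
    have : ρ ^ (2*α+m-1) = ρ ^ (m+1) * (ρ ^ (α-1)) ^ 2 := by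
      rw [← Real.rpow_natCast (ρ ^ (α-1)) 2, ← Real.rpow_mul hρ.le, ← Real.rpow_natCast, ← Real.rpow_add hρ]
      congr 1; push_cast; ring
    simp only [phik_deriv hρ, this]; ring
  · refine (abs_add_le _ _).trans (add_le_add ?_ (hM _ _))
    rw [abs_mul, abs_of_pos hα]
    calc α * |chi (k+1) ρ| ≤ α * 1 := by gcongr; exact chi_abs _ _
      _ = α := mul_one _

end Cutoff

end ACFproof

namespace ACFproof

open Topology Module

section Hom

variable {V : Type*} [NormedAddCommGroup V] [InnerProductSpace ℝ V] [FiniteDimensional ℝ V]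
  [MeasurableSpace V] [BorelSpace V]

/-- radial extension with profile -/
def hx (φ : ℝ → ℝ) (r : ℝ) (U : V → ℝ) (x : V) : ℝ := φ ‖x‖ * U ((r / ‖x‖) • x)

/-- tangential energy density -/
def tg (U : V → ℝ) (r : ℝ) (θ : V) : ℝ := r ^ 2 * (‖gradient U (r • θ)‖ ^ 2 - (fderiv ℝ U (r • θ) θ) ^ 2)

lemma hx_zero {φ : ℝ → ℝ} (hs : tsupport φ ⊆ Ioi 0) (r : ℝ) (U : V → ℝ) :
    hx φ r U =ᶠ[𝓝 0] fun _ => 0 := by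
  have h0 : (0:ℝ) ∉ tsupport φ := fun h => lt_irrefl (0:ℝ) (mem_Ioi.mp (hs h))
  have h1 : ∀ᶠ t in 𝓝 (0:ℝ), φ t = 0 := notMem_tsupport_iff_eventuallyEq.mp h0
  have h2 : Tendsto (fun x : V => ‖x‖) (𝓝 0) (𝓝 0) := by
    simpa using (continuous_norm (E := V)).tendsto 0
  filter_upwards [h2.eventually h1] with x hx'
  rw [hx, hx', zero_mul]

lemma hx_smooth {φ : ℝ → ℝ} (hφ : ContDiff ℝ 1 φ) (hs : tsupport φ ⊆ Ioi 0) (r : ℝ) {U : V → ℝ}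
    (hU : ContDiff ℝ 1 U) : ContDiff ℝ 1 (hx φ r U) := by
  rw [contDiff_iff_contDiffAt]
  intro x
  by_cases h : x = 0
  · subst h
    exact contDiffAt_const.congr_of_eventuallyEq (hx_zero hs r U)
  · have hn : ContDiffAt ℝ 1 (fun x : V => ‖x‖) x := contDiffAt_norm ℝ h
    refine (hφ.contDiffAt.comp x hn).mul (hU.contDiffAt.comp x ?_)
    exact (contDiffAt_const.div hn (norm_ne_zero_iff.mpr h)).smul contDiffAt_id

lemma hx_cs {φ : ℝ → ℝ} (hc : HasCompactSupport φ) (r : ℝ) (U : V → ℝ) : HasCompactSupport (hx φ r U) :=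
  (rad_cs (V := V) hc).mul_right

lemma hx_tsupport {φ : ℝ → ℝ} (hs : tsupport φ ⊆ Ioi 0) (r : ℝ) {U : V → ℝ} {P : Set V}
    (hP : IsClosed P) (hUP : ∀ x, x ∉ P → U x = 0) {x : V} (hx' : x ∈ tsupport (hx φ r U)) :
    x ≠ 0 ∧ (r / ‖x‖) • x ∈ P := by
  have h0 : x ≠ 0 := by
    rintro rfl
    exact notMem_tsupport_iff_eventuallyEq.mpr (hx_zero hs r U) hx'
  refine ⟨h0, ?_⟩
  have hc : ContinuousAt (fun x : V => (r / ‖x‖) • x) x := by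
    have : ‖x‖ ≠ 0 := norm_ne_zero_iff.mpr h0
    fun_prop (disch := assumption)
  have h1 : (r / ‖x‖) • x ∈ closure P := by
    have h2 := hc.continuousWithinAt (s := Function.support (hx φ r U)).mem_closure_image hx'
    refine closure_mono ?_ h2
    rintro _ ⟨y, hy, rfl⟩
    by_contra hh
    exact hy (by rw [hx, hUP _ hh, mul_zero])
  rwa [hP.closure_eq] at h1

lemma norm_fderiv {x : V} (h : x ≠ 0) : HasFDerivAt (fun x : V => ‖x‖) (‖x‖⁻¹ • innerSL ℝ x) x := by
  have hn : 0 < ‖x‖ := norm_pos_iff.mpr h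
  have h2 := (hasStrictFDerivAt_norm_sq x).hasFDerivAt.sqrt (by positivity)
  have h3 : (fun y : V => √(‖y‖ ^ 2)) = fun y => ‖y‖ := by
    funext y; exact Real.sqrt_sq (norm_nonneg y)
  rw [h3] at h2
  refine h2.congr_fderiv ?_
  rw [Real.sqrt_sq hn.le]
  ext v
  simp
  field_simp

lemma fderiv_grad {U : V → ℝ} {x : V} (hU : DifferentiableAt ℝ U x) (v : V) :
    fderiv ℝ U x v = ⟪gradient U x, v⟫ := by
  have := hU.hasGradientAt.hasFDerivAt.fderiv
  rw [this]; simp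

lemma hx_grad {φ : ℝ → ℝ} (hφ : ContDiff ℝ 1 φ) (r : ℝ) {U : V → ℝ}
    (hU : ContDiff ℝ 1 U) {ρ : ℝ} (hρ : 0 < ρ) {θ : V} (hθ : ‖θ‖ = 1) :
    ‖gradient (hx φ r U) (ρ • θ)‖ ^ 2 = (deriv φ ρ) ^ 2 * U (r • θ) ^ 2 + (φ ρ / ρ) ^ 2 * tg U r θ := by
  set x := ρ • θ with hx'
  have hnx : ‖x‖ = ρ := by rw [hx', norm_smul, hθ, mul_one, Real.norm_of_nonneg hρ.le]
  have hx0 : x ≠ 0 := by rw [← norm_ne_zero_iff, hnx]; exact hρ.ne'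
  have hrx : (r / ‖x‖) • x = r • θ := by rw [hnx, hx', smul_smul]; congr 1; field_simp
  have h1 := norm_fderiv hx0
  have h2 := ((hφ.differentiable one_ne_zero ‖x‖).hasDerivAt).comp_hasFDerivAt x h1
  have h3 : HasFDerivAt (fun x : V => r / ‖x‖) ((-(r / ‖x‖^2)) • (‖x‖⁻¹ • innerSL ℝ x)) x := by
    have hd : HasDerivAt (fun t : ℝ => r / t) (-(r / ‖x‖^2)) ‖x‖ := by
      have := (hasDerivAt_inv (norm_ne_zero_iff.mpr hx0)).const_mul r
      simp only [← div_eq_mul_inv] at this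
      exact this.congr_deriv (by ring)
    exact hd.comp_hasFDerivAt x h1
  have h4 : HasFDerivAt (fun x : V => (r / ‖x‖) • x) _ x := h3.smul (hasFDerivAt_id x)
  have h5 := HasFDerivAt.comp (g := U) (f := fun x : V => (r / ‖x‖) • x) x ((hU.differentiable one_ne_zero ((r / ‖x‖) • x)).hasFDerivAt) h4
  have h6 := h2.mul h5
  set g := gradient U (r • θ) with hg
  have hgr : HasGradientAt (hx φ r U) ((deriv φ ρ * U (r • θ)) • θ + (φ ρ * (r / ρ)) • (g - ⟪g, θ⟫ • θ)) x := by
    rw [hasGradientAt_iff_hasFDerivAt]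
    refine HasFDerivAt.congr_fderiv (f := hx φ r U) h6 ?_
    ext v
    have hrx2 : (r / ρ) • x = r • θ := by rw [← hnx]; exact hrx
    simp only [Function.comp, hnx, hrx2]
    simp only [_root_.add_apply, _root_.smul_apply, ContinuousLinearMap.comp_apply,
      ContinuousLinearMap.smulRight_apply, ContinuousLinearMap.id_apply, innerSL_apply_apply, smul_eq_mul,
      InnerProductSpace.toDual_apply_apply, map_add, map_smul]
    rw [fderiv_grad (hU.differentiable one_ne_zero _), fderiv_grad (hU.differentiable one_ne_zero _), ← hg]
    simp only [hx', inner_add_left, inner_sub_left, inner_smul_left, inner_smul_right, RCLike.conj_to_real]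
    field_simp
    ring
  rw [hgr.gradient]
  have ho : ⟪θ, g - ⟪g, θ⟫ • θ⟫ = 0 := by
    rw [inner_sub_right, inner_smul_right, real_inner_self_eq_norm_sq, hθ, real_inner_comm]; ring
  rw [norm_add_sq_real, inner_smul_left, inner_smul_right, ho, norm_smul, norm_smul, hθ, mul_pow, mul_pow]
  have hn : ‖g - ⟪g, θ⟫ • θ‖ ^ 2 = ‖g‖ ^ 2 - ⟪g, θ⟫ ^ 2 := by
    rw [norm_sub_sq_real, inner_smul_right, norm_smul, hθ, mul_one, Real.norm_eq_abs, sq_abs]; ring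
  rw [hn, tg, ← hg, fderiv_grad (hU.differentiable one_ne_zero _), ← hg]
  simp only [Real.norm_eq_abs, sq_abs]
  field_simp
  simp
  ring

lemma gm_polar {F : V → ℝ} (hF : Continuous F) (hFc : HasCompactSupport F) {m : ℕ} (hm : finrank ℝ V = m + 2) :
    ∫ x, F x ∂(gm V) = gc V * ∫ ρ in Ioi (0:ℝ), ρ ^ (m+1) * (Real.exp (-(1/2) * ρ ^ 2) * sm F ρ) := by
  rw [gm_integral]
  have e : ∀ x, gc V * gw x * F x = gc V * (F x * gw x) := fun x => by ring
  simp_rw [e]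
  rw [integral_const_mul, polar (cs_integrable hF hFc gw_cont) (by omega), hm]
  congr 1
  refine setIntegral_congr_fun measurableSet_Ioi fun ρ hρ => ?_
  have hρ : 0 < ρ := hρ
  have : sm (fun x => F x * gw x) ρ = Real.exp (-(1/2) * ρ ^ 2) * sm F ρ := by
    unfold sm
    rw [← integral_const_mul]
    refine integral_congr_ae (ae_of_all _ fun θ => ?_)
    simp [gw, norm_smul, abs_of_pos hρ]; ring
  simp only [this]
  rfl

lemma tg_cont {U : V → ℝ} (hU : ContDiff ℝ 1 U) (r : ℝ) : Continuous (tg U r) := by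
  have h1 := hU.continuous_fderiv one_ne_zero
  have h2 : Continuous (gradient U) := by
    unfold gradient
    exact (LinearIsometryEquiv.continuous _).comp h1
  unfold tg
  have h3 : Continuous fun θ : V => fderiv ℝ U (r • θ) θ := (h1.comp (by fun_prop)).clm_apply continuous_id
  fun_prop

lemma hx_sq {φ : ℝ → ℝ} (hφ : ContDiff ℝ 1 φ) (hc : HasCompactSupport φ) (hs : tsupport φ ⊆ Ioi 0) (r : ℝ) {U : V → ℝ}
    (hU : ContDiff ℝ 1 U) {m : ℕ} (hm : finrank ℝ V = m + 2) :
    ∫ x, hx φ r U x ^ 2 ∂(gm V) = gc V * (e1 m φ * ∫ θ : sphere (0:V) 1, U (r • (θ:V)) ^ 2 ∂(sg V)) := by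
  rw [gm_polar (F := fun x => hx φ r U x ^ 2) ((hx_smooth hφ hs r hU).continuous.pow 2) (cs_sq (hx_cs hc r U)) hm, e1, ← integral_mul_const]
  congr 1
  refine setIntegral_congr_fun measurableSet_Ioi fun ρ hρ => ?_
  have hρ : 0 < ρ := hρ
  have : sm (fun x => hx φ r U x ^ 2) ρ = φ ρ ^ 2 * ∫ θ : sphere (0:V) 1, U (r • (θ:V)) ^ 2 ∂(sg V) := by
    unfold sm
    rw [← integral_const_mul]
    refine integral_congr_ae (ae_of_all _ fun θ => ?_)
    have : r / ρ * ρ = r := by field_simp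
    simp [hx, norm_smul, abs_of_pos hρ, smul_smul, this]; ring
  simp only [this]; ring

lemma hx_en {φ : ℝ → ℝ} (hφ : ContDiff ℝ 1 φ) (hc : HasCompactSupport φ) (hs : tsupport φ ⊆ Ioi 0) (r : ℝ) {U : V → ℝ}
    (hU : ContDiff ℝ 1 U) {m : ℕ} (hm : finrank ℝ V = m + 2) :
    ∫ x, ‖gradient (hx φ r U) x‖ ^ 2 ∂(gm V) = gc V * (e1 m (deriv φ) * (∫ θ : sphere (0:V) 1, U (r • (θ:V)) ^ 2 ∂(sg V))
      + e0 m φ * ∫ θ : sphere (0:V) 1, tg U r θ ∂(sg V)) := by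
  have hsm := hx_smooth hφ hs r hU
  have h2 : Continuous (gradient (hx φ r U)) := by
    unfold gradient
    exact (LinearIsometryEquiv.continuous _).comp (hsm.continuous_fderiv one_ne_zero)
  have h3 : HasCompactSupport (fun x => ‖gradient (hx φ r U) x‖ ^ 2) := by
    have h4 := (hx_cs hc r U).fderiv (𝕜 := ℝ)
    have : HasCompactSupport (gradient (hx φ r U)) := by
      unfold gradient
      exact h4.comp_left (by simp)
    exact this.comp_left (g := fun v : V => ‖v‖ ^ 2) (by simp)
  rw [gm_polar (by fun_prop) h3 hm]
  have hφc := hφ.continuous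
  have hφ'c : Continuous (deriv φ) := hφ.continuous_deriv le_rfl
  have hcd : ∀ s : ℝ, Continuous fun ρ : ℝ => ρ := fun s => continuous_id
  have i1 : IntegrableOn (fun ρ : ℝ => ρ ^ (m+1) * (Real.exp (-(1/2) * ρ ^ 2) * deriv φ ρ ^ 2)) (Ioi 0) := by
    refine Integrable.integrableOn (Continuous.integrable_of_hasCompactSupport (by fun_prop) ?_)
    exact HasCompactSupport.mul_left (HasCompactSupport.mul_left (hc.deriv.comp_left (g := fun t : ℝ => t ^ 2) (by simp)))
  have hdc : Continuous fun ρ => φ ρ / ρ := by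
    rw [continuous_iff_continuousAt]
    intro ρ
    by_cases h : 0 < ρ
    · exact hφc.continuousAt.div continuousAt_id h.ne'
    · have h0 : ρ ∉ tsupport φ := fun hh => h (hs hh)
      have h1 : ∀ᶠ t in 𝓝 ρ, φ t = 0 := notMem_tsupport_iff_eventuallyEq.mp h0
      refine (continuousAt_const (y := (0:ℝ))).congr ?_
      filter_upwards [h1] with t ht
      rw [ht, zero_div]
  have i2 : IntegrableOn (fun ρ : ℝ => ρ ^ (m+1) * (Real.exp (-(1/2) * ρ ^ 2) * (φ ρ / ρ) ^ 2)) (Ioi 0) := by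
    refine Integrable.integrableOn (Continuous.integrable_of_hasCompactSupport (by fun_prop) ?_)
    refine HasCompactSupport.mul_left (HasCompactSupport.mul_left ?_)
    have : HasCompactSupport fun ρ => φ ρ / ρ := by
      simp only [div_eq_mul_inv]; exact hc.mul_right
    exact this.comp_left (g := fun t : ℝ => t ^ 2) (by simp)
  rw [e1, e0, ← integral_mul_const, ← integral_mul_const, ← integral_add (i1.mul_const _) (i2.mul_const _)]
  congr 1
  refine setIntegral_congr_fun measurableSet_Ioi fun ρ hρ => ?_
  have hρ : 0 < ρ := hρ
  have cU := hU.continuous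
  have : sm (fun x => ‖gradient (hx φ r U) x‖ ^ 2) ρ = deriv φ ρ ^ 2 * (∫ θ : sphere (0:V) 1, U (r • (θ:V)) ^ 2 ∂(sg V))
      + (φ ρ / ρ) ^ 2 * ∫ θ : sphere (0:V) 1, tg U r θ ∂(sg V) := by
    unfold sm
    rw [← integral_const_mul, ← integral_const_mul, ← integral_add]
    · refine integral_congr_ae (ae_of_all _ fun θ => ?_)
      exact hx_grad hφ r hU hρ (by simp)
    · exact (sph_integrable (by fun_prop)).const_mul _
    · exact (sph_integrable ((tg_cont hU r).comp continuous_subtype_val)).const_mul _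
  simp only [this]; ring

/-- The sharp separation inequality for spherical characteristic exponents. -/
lemma star {U W : V → ℝ} (hU : ContDiff ℝ 1 U) (hW : ContDiff ℝ 1 W) (hU0 : ∀ x, 0 ≤ U x) (hW0 : ∀ x, 0 ≤ W x)
    {P Q : Set V} (hP : IsClosed P) (hQ : IsClosed Q) (hUP : ∀ x, x ∉ P → U x = 0) (hWQ : ∀ x, x ∉ Q → W x = 0)
    {r : ℝ} (hr : 0 < r) (hPQ : ∀ x, ‖x‖ = r → x ∈ P → x ∉ Q) {m : ℕ} (hm : finrank ℝ V = m + 2)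
    {a b A B α β : ℝ} (ha : a = ∫ θ : sphere (0:V) 1, U (r • (θ:V)) ^ 2 ∂(sg V))
    (hb : b = ∫ θ : sphere (0:V) 1, W (r • (θ:V)) ^ 2 ∂(sg V))
    (hA : A = ∫ θ : sphere (0:V) 1, tg U r θ ∂(sg V)) (hB : B = ∫ θ : sphere (0:V) 1, tg W r θ ∂(sg V))
    (ha0 : 0 < a) (hb0 : 0 < b) (hα : 0 < α) (hβ : 0 < β) (hAα : A ≤ α * (α + m) * a) (hBβ : B ≤ β * (β + m) * b) :
    2 ≤ α + β := by
  have key : ∀ k : ℕ, 2 * ((e1 m (phik α (k+1)) * a) * (e1 m (phik β (k+1)) * b)) ≤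
      (e1 m (deriv (phik α (k+1))) * a + e0 m (phik α (k+1)) * A) * (e1 m (phik β (k+1)) * b) +
      (e1 m (phik α (k+1)) * a) * (e1 m (deriv (phik β (k+1))) * b + e0 m (phik β (k+1)) * B) := by
    intro k
    have hk : (0:ℝ) < k + 1 := by positivity
    have s1 := phik_smooth (α := α) hk
    have s2 := phik_smooth (α := β) hk
    have t1 := phik_ts (α := α) hk
    have t2 := phik_ts (α := β) hk
    have c1 := phik_cs (α := α) hk
    have c2 := phik_cs (α := β) hk
    have nn : ∀ (γ ρ : ℝ), 0 ≤ ρ → 0 ≤ phik γ (k+1) ρ := fun γ ρ hρ => by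
      unfold phik chi
      have := Real.smoothTransition.nonneg ((k+1) * ρ - 1)
      have := Real.smoothTransition.le_one (ρ / (k+1) - 1)
      exact mul_nonneg (Real.rpow_nonneg hρ _) (mul_nonneg (by assumption) (by linarith))
    have g := GI_sep (f := hx (phik α (k+1)) r U) (g := hx (phik β (k+1)) r W) (hx_smooth s1 t1 r hU) (hx_cs c1 r U)
      (hx_smooth s2 t2 r hW) (hx_cs c2 r W) (fun x => mul_nonneg (nn _ _ (norm_nonneg x)) (hU0 _))
      (fun x => mul_nonneg (nn _ _ (norm_nonneg x)) (hW0 _)) ?_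
    · rw [hx_sq s1 c1 t1 r hU hm, hx_sq s2 c2 t2 r hW hm, hx_en s1 c1 t1 r hU hm, hx_en s2 c2 t2 r hW hm,
        ← ha, ← hb, ← hA, ← hB] at g
      have hg : 0 < gc V := gc_pos
      refine le_of_mul_le_mul_left ?_ (mul_pos hg hg)
      linarith
    · rw [Set.disjoint_left]
      intro x hx1 hx2
      have q1 := hx_tsupport t1 r hP hUP hx1
      have q2 := hx_tsupport t2 r hQ hWQ hx2
      refine hPQ _ ?_ q1.2 q2.2
      have : ‖x‖ ≠ 0 := norm_ne_zero_iff.mpr q1.1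
      rw [norm_smul, norm_div, norm_norm, Real.norm_of_nonneg hr.le]
      field_simp
  have l1 := approx_e1 m hα
  have l2 := approx_e1 m hβ
  have l3 := approx_e' m hα
  have l4 := approx_e' m hβ
  have l5 := approx_e0 m hα
  have l6 := approx_e0 m hβ
  have lim := le_of_tendsto_of_tendsto' (((l1.mul_const a).mul (l2.mul_const b)).const_mul 2)
    ((((l3.mul_const a).add (l5.mul_const A)).mul (l2.mul_const b)).add
      ((l1.mul_const a).mul ((l4.mul_const b).add (l6.mul_const B)))) key
  have hm0 : (0:ℝ) ≤ m := Nat.cast_nonneg m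
  have p1 : 0 < mom (2*α+m-1) := mom_pos (by linarith)
  have p2 : 0 < mom (2*β+m-1) := mom_pos (by linarith)
  set X := mom (2*α+m-1)
  set Y := mom (2*β+m-1)
  have w1 : 0 < 2*α+m := by linarith
  have w2 : 0 < 2*β+m := by linarith
  have b1 : α^2 * X * a + X * A ≤ α * ((2*α+m) * X * a) := by
    have := mul_le_mul_of_nonneg_left hAα p1.le
    linarith
  have b2 : β^2 * Y * b + Y * B ≤ β * ((2*β+m) * Y * b) := by
    have := mul_le_mul_of_nonneg_left hBβ p2.le
    linarith
  have z1 : 0 < (2*α+m) * X * a := by positivity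
  have z2 : 0 < (2*β+m) * Y * b := by positivity
  have c1 := mul_le_mul_of_nonneg_right b1 z2.le
  have c2 := mul_le_mul_of_nonneg_left b2 z1.le
  refine le_of_mul_le_mul_right ?_ (mul_pos z1 z2)
  linarith

end Hom

end ACFproof

namespace ACFproof

open Topology Module

section Smooth

variable {V : Type*} [NormedAddCommGroup V] [InnerProductSpace ℝ V] [FiniteDimensional ℝ V]
  [MeasurableSpace V] [BorelSpace V]

lemma grad_cont {U : V → ℝ} (hU : ContDiff ℝ 1 U) : Continuous (gradient U) := by
  unfold gradient
  exact (LinearIsometryEquiv.continuous _).comp (hU.continuous_fderiv one_ne_zero)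

/-- radial energy density -/
def Jd (U : V → ℝ) (ρ : ℝ) : ℝ := ρ * sm (fun x => ‖gradient U x‖ ^ 2) ρ
/-- weighted energy -/
def Ie (U : V → ℝ) (r : ℝ) : ℝ := ∫ ρ in (0:ℝ)..r, Jd U ρ

lemma Jd_cont {U : V → ℝ} (hU : ContDiff ℝ 1 U) : Continuous (Jd U) := by
  unfold Jd
  have := sm_cont ((grad_cont hU).norm.pow 2)
  exact continuous_id.mul this

lemma Ie_deriv {U : V → ℝ} (hU : ContDiff ℝ 1 U) (r : ℝ) : HasDerivAt (Ie U) (Jd U r) r :=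
  intervalIntegral.integral_hasDerivAt_right ((Jd_cont hU).intervalIntegrable _ _)
    ((Jd_cont hU).stronglyMeasurableAtFilter _ _) (Jd_cont hU).continuousAt

lemma inv_int {m : ℕ} (hm : finrank ℝ V = m + 2) (r : ℝ) :
    IntegrableOn (fun x : V => 1 / ‖x‖ ^ m) (ball 0 r) := by
  have hp : 0 < finrank ℝ V := by omega
  have : Nontrivial V := Module.finrank_pos_iff.mp hp
  rw [integrableOn_fun_norm_addHaar (f := fun t : ℝ => 1 / t ^ m) (μ := (volume : Measure V)), hm]
  have : IntegrableOn (fun y : ℝ => y) (Ioo 0 r) :=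
    (continuous_id.integrableOn_Icc (a := 0) (b := r)).mono_set Ioo_subset_Icc_self
  refine this.congr_fun (fun y hy => ?_) measurableSet_Ioo
  have : y ≠ 0 := hy.1.ne'
  simp only [smul_eq_mul, Nat.add_succ_sub_one, pow_succ]
  field_simp

lemma ball_int {U : V → ℝ} (hU : ContDiff ℝ 1 U) {m : ℕ} (hm : finrank ℝ V = m + 2) {r : ℝ} (hr : 0 < r) :
    ∫ x in ball (0:V) r, ‖gradient U x‖ ^ 2 / ‖x‖ ^ m = Ie U r := by
  have hc := grad_cont hU
  obtain ⟨C, hC⟩ := (isCompact_closedBall (0:V) r).exists_bound_of_continuousOn (hc.norm.pow 2).continuousOn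
  have hIntg : IntegrableOn (fun x => ‖gradient U x‖ ^ 2 / ‖x‖ ^ m) (ball (0:V) r) := by
    refine Integrable.mono' ((inv_int hm r).const_mul C) ?_ ?_
    · have : Measurable fun x : V => ‖gradient U x‖ ^ 2 / ‖x‖ ^ m :=
        ((hc.norm.pow 2).measurable).div ((continuous_norm.pow m).measurable)
      exact this.aestronglyMeasurable
    · refine (ae_restrict_iff' measurableSet_ball).mpr (ae_of_all _ fun x hx => ?_)
      rw [norm_div, norm_pow, norm_norm, norm_pow, norm_norm, mul_one_div]
      gcongr
      have := hC x (ball_subset_closedBall hx)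
      simpa using this
  rw [← integral_indicator measurableSet_ball, polar ((integrable_indicator_iff measurableSet_ball).mpr hIntg) (by omega),
    Ie, intervalIntegral.integral_of_le hr.le, integral_Ioc_eq_integral_Ioo,
    ← integral_indicator measurableSet_Ioi, ← integral_indicator measurableSet_Ioo]
  congr 1
  funext ρ
  by_cases h0 : 0 < ρ
  · rw [indicator_of_mem (show ρ ∈ Ioi (0:ℝ) from h0)]
    by_cases h1 : ρ < r
    · rw [indicator_of_mem (show ρ ∈ Ioo 0 r from ⟨h0, h1⟩), Jd]
      have : sm ((ball (0:V) r).indicator fun x => ‖gradient U x‖ ^ 2 / ‖x‖ ^ m) ρ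
          = (1 / ρ ^ m) * sm (fun x => ‖gradient U x‖ ^ 2) ρ := by
        unfold sm
        rw [← integral_const_mul]
        refine integral_congr_ae (ae_of_all _ fun θ => ?_)
        have hn : ‖ρ • (θ:V)‖ = ρ := by simp [norm_smul, abs_of_pos h0]
        simp only
        rw [indicator_of_mem (by simp [norm_smul, abs_of_pos h0, h1]), hn]; ring
      rw [this, hm]
      simp only [Nat.add_succ_sub_one, pow_succ]
      field_simp
    · rw [indicator_of_notMem (fun h : ρ ∈ Ioo 0 r => h1 h.2)]
      have : sm ((ball (0:V) r).indicator fun x => ‖gradient U x‖ ^ 2 / ‖x‖ ^ m) ρ = 0 := by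
        unfold sm
        refine integral_eq_zero_of_ae (ae_of_all _ fun θ => ?_)
        exact indicator_of_notMem (by simpa [norm_smul, abs_of_pos h0] using h1) _
      rw [this, mul_zero]
  · rw [indicator_of_notMem (fun h : ρ ∈ Ioi 0 => h0 h), indicator_of_notMem (fun h : ρ ∈ Ioo 0 r => h0 h.1)]

lemma Ie_nonneg {U : V → ℝ} {r : ℝ} (hr : 0 ≤ r) : 0 ≤ Ie U r := by
  refine intervalIntegral.integral_nonneg hr fun ρ hρ => mul_nonneg hρ.1 ?_
  exact integral_nonneg fun θ => by positivity

lemma Jd_nonneg {U : V → ℝ} {r : ℝ} (hr : 0 ≤ r) : 0 ≤ Jd U r :=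
  mul_nonneg hr (integral_nonneg fun θ => by positivity)

lemma K_ineq {ι : Type*} [Fintype ι] (b : OrthonormalBasis ι ℝ V) {U : V → ℝ} (hU : ContDiff ℝ 2 U) {m : ℕ} (hm : finrank ℝ V = m + 2)
    {R : ℝ} (hL : ∀ x ∈ ball (0:V) R, 2 * ‖gradient U x‖ ^ 2 ≤ lapb b (fun x => U x ^ 2) x) {r : ℝ} (hr : 0 < r)
    (hrR : r < R) :
    2 * Ie U r ≤ r * sm1 (fun x => U x ^ 2) r + m * sm (fun x => U x ^ 2) r := by
  set w : V → ℝ := fun x => U x ^ 2 with hw'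
  have hw : ContDiff ℝ 2 w := hU.pow 2
  have hw1 : ContDiff ℝ 1 w := hw.of_le (by norm_num)
  have hU1 : ContDiff ℝ 1 U := hU.of_le (by norm_num)
  set D : ℝ → ℝ := fun ρ => ρ * sm1 w ρ + m * sm w ρ - 2 * Ie U ρ with hD
  have hDd : ∀ ρ, HasDerivAt D (1 * sm1 w ρ + ρ * sm2 w ρ + m * sm1 w ρ - 2 * Jd U ρ) ρ := fun ρ =>
    (((hasDerivAt_id ρ).mul (sm1_deriv hw ρ)).add ((sm_deriv hw1 ρ).const_mul (m:ℝ))).sub ((Ie_deriv hU1 ρ).const_mul 2)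
  have hmono : MonotoneOn D (Icc 0 r) := by
    refine monotoneOn_of_deriv_nonneg (convex_Icc 0 r) (fun x _ => (hDd x).continuousAt.continuousWithinAt)
      (fun x _ => (hDd x).differentiableAt.differentiableWithinAt) ?_
    intro ρ hρ
    rw [interior_Icc] at hρ
    rw [(hDd ρ).deriv]
    have h1 := sph_lap b (by omega) hw hρ.1
    have h2 : 2 * sm (fun x => ‖gradient U x‖ ^ 2) ρ ≤ sm (lapb b w) ρ := by
      unfold sm
      rw [← integral_const_mul]
      refine integral_mono ?_ ?_ fun θ => ?_
      · exact (sph_integrable (((grad_cont hU1).norm.pow 2).comp (by fun_prop : Continuous fun θ : sphere (0:V) 1 => ρ • (θ:V)))).const_mul _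
      · exact sph_integrable ((lapb_cont b hw).comp (by fun_prop : Continuous fun θ : sphere (0:V) 1 => ρ • (θ:V)))
      · refine hL _ ?_
        simp [norm_smul, abs_of_pos hρ.1]; linarith [hρ.2]
    have h3 := mul_le_mul_of_nonneg_left h2 hρ.1.le
    rw [hm] at h1
    push_cast at h1
    unfold Jd
    linarith
  have h := hmono ⟨le_rfl, hr.le⟩ ⟨hr.le, le_rfl⟩ hr.le
  have h0 : 0 ≤ D 0 := by
    simp only [hD, Ie, intervalIntegral.integral_same, zero_mul, mul_zero, sub_zero, zero_add]
    refine mul_nonneg (Nat.cast_nonneg m) (integral_nonneg fun θ => by positivity)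
  have := h0.trans h
  simp only [hD] at this
  linarith

lemma tg_nonneg {U : V → ℝ} (hU : ContDiff ℝ 1 U) (r : ℝ) (θ : sphere (0:V) 1) : 0 ≤ tg U r θ := by
  unfold tg
  rw [fderiv_grad (hU.differentiable one_ne_zero _)]
  have h1 := abs_real_inner_le_norm (gradient U (r • (θ:V))) θ
  rw [show ‖(θ:V)‖ = 1 by simp, mul_one] at h1
  have := sq_le_sq' (abs_le.mp h1).1 (abs_le.mp h1).2
  exact mul_nonneg (sq_nonneg _) (by linarith)

/-- differential inequality at one radius -/
lemma one_radius {ι : Type*} [Fintype ι] (b : OrthonormalBasis ι ℝ V) {U : V → ℝ} (hU : ContDiff ℝ 2 U) {m : ℕ} (hm : finrank ℝ V = m + 2)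
    {R : ℝ} (hL : ∀ x ∈ ball (0:V) R, 2 * ‖gradient U x‖ ^ 2 ≤ lapb b (fun x => U x ^ 2) x) {r : ℝ} (hr : 0 < r)
    (hrR : r < R) {a A : ℝ} (ha : a = ∫ θ : sphere (0:V) 1, U (r • (θ:V)) ^ 2 ∂(sg V))
    (hA : A = ∫ θ : sphere (0:V) 1, tg U r θ ∂(sg V)) :
    (a = 0 → Ie U r = 0) ∧ (∀ α : ℝ, 0 ≤ α → α * (α + m) * a = A → 2 * α * Ie U r ≤ r * Jd U r) := by
  have hU1 : ContDiff ℝ 1 U := hU.of_le (by norm_num)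
  have hK := K_ineq b hU hm hL hr hrR
  have cU : Continuous fun θ : sphere (0:V) 1 => U (r • (θ:V)) := hU.continuous.comp (by fun_prop)
  have cF : Continuous fun θ : sphere (0:V) 1 => fderiv ℝ U (r • (θ:V)) θ :=
    ((hU1.continuous_fderiv one_ne_zero).comp (by fun_prop)).clm_apply (by fun_prop)
  have e1 : sm1 (fun x => U x ^ 2) r = ∫ θ : sphere (0:V) 1, 2 * U (r • (θ:V)) * fderiv ℝ U (r • (θ:V)) θ ∂(sg V) := by
    unfold sm1
    refine integral_congr_ae (ae_of_all _ fun θ => ?_)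
    have h1 := ((hU1.differentiable one_ne_zero (r • (θ:V))).hasFDerivAt).pow 2
    have h2 : HasFDerivAt (fun x => U x ^ 2) _ (r • (θ:V)) := h1
    simp only
    rw [h2.fderiv]
    simp
  have e2 : sm (fun x => U x ^ 2) r = a := by rw [ha]; rfl
  rw [e1, e2] at hK
  constructor
  · intro h0
    have hz : ∀ θ : sphere (0:V) 1, U (r • (θ:V)) ^ 2 = 0 := by
      have hc : Continuous fun θ : sphere (0:V) 1 => U (r • (θ:V)) ^ 2 := cU.pow 2
      have h1 := (integral_eq_zero_iff_of_nonneg (fun θ : sphere (0:V) 1 => sq_nonneg (U (r • (θ:V)))) (sph_integrable hc)).mp (ha.symm.trans h0)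
      have h2 := (Continuous.ae_eq_iff_eq (μ := sg V) hc continuous_const).mp h1
      exact fun θ => congrFun h2 θ
    have : ∫ θ : sphere (0:V) 1, 2 * U (r • (θ:V)) * fderiv ℝ U (r • (θ:V)) θ ∂(sg V) = 0 := by
      refine integral_eq_zero_of_ae (ae_of_all _ fun θ => ?_)
      have := hz θ
      rw [pow_eq_zero_iff two_ne_zero] at this
      simp [this]
    rw [this, h0] at hK
    have := Ie_nonneg (U := U) hr.le
    linarith
  · intro α hα hroot
    have hq := mul_le_mul_of_nonneg_left hK hα
    have hJ : r * Jd U r = (∫ θ : sphere (0:V) 1, (r * fderiv ℝ U (r • (θ:V)) θ) ^ 2 ∂(sg V)) + A := by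
      have iA : Integrable (fun θ : sphere (0:V) 1 => tg U r θ) (sg V) := sph_integrable ((tg_cont hU1 r).comp continuous_subtype_val)
      have iP : Integrable (fun θ : sphere (0:V) 1 => (r * fderiv ℝ U (r • (θ:V)) θ) ^ 2) (sg V) := sph_integrable (by fun_prop)
      rw [hA, ← integral_add iP iA, Jd, sm,
        ← mul_assoc, ← integral_const_mul]
      refine integral_congr_ae (ae_of_all _ fun θ => ?_)
      simp only [tg]; ring
    have hp : 0 ≤ ∫ θ : sphere (0:V) 1, (r * fderiv ℝ U (r • (θ:V)) θ - α * U (r • (θ:V))) ^ 2 ∂(sg V) :=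
      integral_nonneg fun θ => sq_nonneg _
    have hexp : ∫ θ : sphere (0:V) 1, (r * fderiv ℝ U (r • (θ:V)) θ - α * U (r • (θ:V))) ^ 2 ∂(sg V)
        = (∫ θ : sphere (0:V) 1, (r * fderiv ℝ U (r • (θ:V)) θ) ^ 2 ∂(sg V))
          - (α * r) * (∫ θ : sphere (0:V) 1, 2 * U (r • (θ:V)) * fderiv ℝ U (r • (θ:V)) θ ∂(sg V)) + α ^ 2 * a := by
      rw [ha, ← integral_const_mul, ← integral_const_mul, ← integral_sub, ← integral_add]
      · refine integral_congr_ae (ae_of_all _ fun θ => ?_)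
        simp only; ring
      · exact sph_integrable (by fun_prop)
      · exact sph_integrable (by fun_prop)
      · exact sph_integrable (by fun_prop)
      · exact sph_integrable (by fun_prop)
    rw [hexp] at hp
    rw [hJ, ← hroot]
    linarith

lemma root_exists {a A : ℝ} (m : ℕ) (ha : 0 < a) (hA : 0 ≤ A) : ∃ α : ℝ, 0 ≤ α ∧ α * (α + m) * a = A := by
  have hm : (0:ℝ) ≤ m := Nat.cast_nonneg m
  have h0 : 0 ≤ (m:ℝ) ^ 2 + 4 * (A / a) := by positivity
  refine ⟨(√((m:ℝ)^2 + 4 * (A/a)) - m)/2, ?_, ?_⟩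
  · have : (m:ℝ) ≤ √((m:ℝ)^2 + 4 * (A/a)) := Real.le_sqrt_of_sq_le (by have : 0 ≤ A / a := by positivity
                                                                       linarith)
    linarith
  · have h1 := Real.sq_sqrt h0
    set s := √((m:ℝ)^2 + 4 * (A/a))
    have : (s - m)/2 * ((s-m)/2 + m) = A / a := by nlinarith
    rw [this]; field_simp

/-- Monotonicity for smooth segregated pairs. -/
lemma smooth_ACF {ι : Type*} [Fintype ι] (b : OrthonormalBasis ι ℝ V) {m : ℕ} (hm : finrank ℝ V = m + 2)
    {U W : V → ℝ} (hU : ContDiff ℝ 2 U) (hW : ContDiff ℝ 2 W) (hU0 : ∀ x, 0 ≤ U x) (hW0 : ∀ x, 0 ≤ W x)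
    {P Q : Set V} (hP : IsClosed P) (hQ : IsClosed Q) (hUP : ∀ x, x ∉ P → U x = 0) (hWQ : ∀ x, x ∉ Q → W x = 0)
    {R : ℝ} (hPQ : ∀ x ∈ ball (0:V) R, x ∈ P → x ∉ Q)
    (hLU : ∀ x ∈ ball (0:V) R, 2 * ‖gradient U x‖ ^ 2 ≤ lapb b (fun x => U x ^ 2) x)
    (hLW : ∀ x ∈ ball (0:V) R, 2 * ‖gradient W x‖ ^ 2 ≤ lapb b (fun x => W x ^ 2) x)
    {r₁ r₂ : ℝ} (h1 : 0 < r₁) (h12 : r₁ ≤ r₂) (h2 : r₂ < R) :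
    1 / r₁ ^ 4 * (∫ x in ball (0:V) r₁, ‖gradient U x‖ ^ 2 / ‖x‖ ^ m) * (∫ x in ball (0:V) r₁, ‖gradient W x‖ ^ 2 / ‖x‖ ^ m)
    ≤ 1 / r₂ ^ 4 * (∫ x in ball (0:V) r₂, ‖gradient U x‖ ^ 2 / ‖x‖ ^ m) * (∫ x in ball (0:V) r₂, ‖gradient W x‖ ^ 2 / ‖x‖ ^ m) := by
  have hU1 : ContDiff ℝ 1 U := hU.of_le (by norm_num)
  have hW1 : ContDiff ℝ 1 W := hW.of_le (by norm_num)
  rw [ball_int hU1 hm h1, ball_int hW1 hm h1, ball_int hU1 hm (h1.trans_le h12), ball_int hW1 hm (h1.trans_le h12)]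
  have main : ∀ r, 0 < r → r < R → 4 * (Ie U r * Ie W r) ≤ r * (Jd U r * Ie W r + Ie U r * Jd W r) := by
    intro r hr hrR
    obtain ⟨zU, kU⟩ := one_radius b hU hm hLU hr hrR rfl rfl
    obtain ⟨zW, kW⟩ := one_radius b hW hm hLW hr hrR rfl rfl
    set a := ∫ θ : sphere (0:V) 1, U (r • (θ:V)) ^ 2 ∂(sg V) with ha
    set c := ∫ θ : sphere (0:V) 1, W (r • (θ:V)) ^ 2 ∂(sg V) with hc
    set A := ∫ θ : sphere (0:V) 1, tg U r θ ∂(sg V) with hA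
    set B := ∫ θ : sphere (0:V) 1, tg W r θ ∂(sg V) with hB
    have IU := Ie_nonneg (U := U) hr.le
    have IW := Ie_nonneg (U := W) hr.le
    have JU := Jd_nonneg (U := U) hr.le
    have JW := Jd_nonneg (U := W) hr.le
    have ha0 : 0 ≤ a := integral_nonneg fun θ => sq_nonneg _
    have hc0 : 0 ≤ c := integral_nonneg fun θ => sq_nonneg _
    have hA0 : 0 ≤ A := integral_nonneg fun θ => tg_nonneg hU1 r θ
    have hB0 : 0 ≤ B := integral_nonneg fun θ => tg_nonneg hW1 r θ
    rcases ha0.eq_or_lt with h | h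
    · rw [zU h.symm]; simp; positivity
    rcases hc0.eq_or_lt with h' | h'
    · rw [zW h'.symm]; simp; positivity
    obtain ⟨α, hα, rα⟩ := root_exists m h hA0
    obtain ⟨β, hβ, rβ⟩ := root_exists m h' hB0
    have hm0 : (0:ℝ) ≤ m := Nat.cast_nonneg m
    have sum : 2 ≤ α + β := by
      refine le_of_forall_pos_le_add fun ε hε => ?_
      have := star hU1 hW1 hU0 hW0 hP hQ hUP hWQ hr (fun x hx => hPQ x (by simpa [hx] using hrR)) hm ha hc hA hB h h'
        (α := α + ε/2) (β := β + ε/2) (by linarith) (by linarith)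
        (by rw [← rα]; gcongr <;> linarith) (by rw [← rβ]; gcongr <;> linarith)
      linarith
    have g1 := mul_le_mul_of_nonneg_right (kU α hα rα) IW
    have g2 := mul_le_mul_of_nonneg_right (kW β hβ rβ) IU
    have g3 := mul_le_mul_of_nonneg_right sum (mul_nonneg IU IW)
    linarith
  set Φ : ℝ → ℝ := fun r => 1 / r ^ 4 * Ie U r * Ie W r with hΦ
  have hd : ∀ r, 0 < r → HasDerivAt Φ ((r * (Jd U r * Ie W r + Ie U r * Jd W r) - 4 * (Ie U r * Ie W r)) / r ^ 5) r := by
    intro r hr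
    have d1 : HasDerivAt (fun r : ℝ => 1 / r ^ 4) (-4 / r ^ 5) r := by
      have := (hasDerivAt_pow 4 r).inv (by positivity)
      have h2 : (fun r : ℝ => 1 / r ^ 4) = (fun r : ℝ => r ^ 4)⁻¹ := by funext t; simp
      rw [h2]
      refine this.congr_deriv ?_
      push_cast
      field_simp
    have d2 := (d1.mul (Ie_deriv hU1 r)).mul (Ie_deriv hW1 r)
    refine HasDerivAt.congr_deriv (f := Φ) d2 ?_
    simp only [Pi.mul_apply]
    field_simp
    ring
  have hmono : MonotoneOn Φ (Icc r₁ r₂) := by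
    refine monotoneOn_of_deriv_nonneg (convex_Icc _ _) (fun x hx => (hd x (h1.trans_le hx.1)).continuousAt.continuousWithinAt)
      (fun x hx => ?_) ?_
    · rw [interior_Icc] at hx
      exact (hd x (h1.trans hx.1)).differentiableAt.differentiableWithinAt
    · intro x hx
      rw [interior_Icc] at hx
      have hx0 := h1.trans hx.1
      rw [(hd x hx0).deriv]
      have := main x hx0 (hx.2.trans h2)
      exact div_nonneg (by linarith) (by positivity)
  exact hmono ⟨le_rfl, h12⟩ ⟨h12, le_rfl⟩ h12

end Smooth

end ACFproof

namespace ACFproof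

open Topology Module
open scoped Convolution

section Moll

variable {V : Type*} [NormedAddCommGroup V] [InnerProductSpace ℝ V] [FiniteDimensional ℝ V]
  [MeasurableSpace V] [BorelSpace V]

/-- mollification -/
def mol (ρ u : V → ℝ) : V → ℝ := ρ ⋆[ContinuousLinearMap.lsmul ℝ ℝ, volume] u

lemma mol_apply (ρ u : V → ℝ) (x : V) : mol ρ u x = ∫ t, ρ t * u (x - t) := by
  simp [mol, convolution_def]

lemma mol_contDiff {ρ u : V → ℝ} {k : ℕ∞} (hρ : ContDiff ℝ k ρ) (hc : HasCompactSupport ρ) (hu : Continuous u) :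
    ContDiff ℝ k (mol ρ u) :=
  hc.contDiff_convolution_left _ hρ hu.locallyIntegrable

lemma mol_fderiv {ρ u : V → ℝ} (hρ : ContDiff ℝ 1 ρ) (hc : HasCompactSupport ρ) (hu : Continuous u) (x v : V) :
    fderiv ℝ (mol ρ u) x v = mol (fun t => fderiv ℝ ρ t v) u x := by
  have h := hc.hasFDerivAt_convolution_left (ContinuousLinearMap.lsmul ℝ ℝ) (μ := volume) hρ hu.locallyIntegrable x
  have h2 : HasFDerivAt (mol ρ u) _ x := h
  rw [h2.fderiv, mol, convolution_def, convolution_def, ContinuousLinearMap.integral_apply]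
  · simp
  · have hex : ConvolutionExistsAt (fderiv ℝ ρ) u x
        ((ContinuousLinearMap.lsmul ℝ ℝ : ℝ →L[ℝ] ℝ →L[ℝ] ℝ).precompL V) volume :=
      HasCompactSupport.convolutionExists_left _ (hc.fderiv (𝕜 := ℝ)) (hρ.continuous_fderiv one_ne_zero) hu.locallyIntegrable x
    exact hex

lemma mol_lap {ι : Type*} [Fintype ι] (b : OrthonormalBasis ι ℝ V) {ρ u : V → ℝ} (hρ : ContDiff ℝ 2 ρ) (hc : HasCompactSupport ρ)
    (hu : Continuous u) (x : V) : lapb b (mol ρ u) x = mol (lapb b ρ) u x := by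
  have hρ1 : ContDiff ℝ 1 ρ := hρ.of_le (by norm_num)
  have hd : ∀ i, ContDiff ℝ 1 (fun t => fderiv ℝ ρ t (b i)) := fun i => (fd_contDiff hρ).clm_apply contDiff_const
  have hdc : ∀ i, HasCompactSupport (fun t => fderiv ℝ ρ t (b i)) := fun i => hc.fderiv_apply ℝ (b i)
  have hd2 : ∀ i, Continuous (fun t => fderiv ℝ (fun y => fderiv ℝ ρ y (b i)) t (b i)) := fun i =>
    ((hd i).continuous_fderiv one_ne_zero).clm_apply continuous_const
  unfold lapb
  have : ∀ i, (fun y => fderiv ℝ (mol ρ u) y (b i)) = mol (fun t => fderiv ℝ ρ t (b i)) u := fun i => by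
    funext y; exact mol_fderiv hρ1 hc hu y (b i)
  simp_rw [this]
  simp_rw [mol_fderiv (hd _) (hdc _) hu]
  simp_rw [mol_apply]
  rw [← integral_finsetSum]
  · simp_rw [Finset.sum_mul]
  · intro i _
    refine Continuous.integrable_of_hasCompactSupport ((hd2 i).mul (hu.comp (by fun_prop))) ?_
    exact ((hdc i).fderiv_apply ℝ (b i)).mul_right

lemma lapb_refl {ι : Type*} [Fintype ι] (b : OrthonormalBasis ι ℝ V) {ρ : V → ℝ} (hρ : ContDiff ℝ 2 ρ) (x y : V) :
    lapb b (fun y => ρ (x - y)) y = lapb b ρ (x - y) := by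
  have key : ∀ (f : V → ℝ) (y v : V), Differentiable ℝ f → fderiv ℝ (fun y => f (x - y)) y v = - fderiv ℝ f (x - y) v := by
    intro f y v hf
    have h1 : HasFDerivAt (fun y => x - y) (-ContinuousLinearMap.id ℝ V) y := (hasFDerivAt_id y).const_sub x
    have h2 := (hf (x - y)).hasFDerivAt.comp y h1
    have h3 : HasFDerivAt (fun y => f (x - y)) _ y := h2
    rw [h3.fderiv]; simp
  unfold lapb
  refine Finset.sum_congr rfl fun i _ => ?_
  simp_rw [key ρ _ _ (hρ.differentiable two_ne_zero)]
  rw [fderiv_fun_neg]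
  have := key (fun z => fderiv ℝ ρ z (b i)) y (b i) (((fd_contDiff hρ).clm_apply contDiff_const).differentiable one_ne_zero)
  simp only [neg_apply]
  rw [this, neg_neg]

/-- Mollification of a subharmonic function is subharmonic. -/
lemma mol_sub {ι : Type*} [Fintype ι] (b : OrthonormalBasis ι ℝ V) {u v : V → ℝ}
    (hsub : ∀ φ : V → ℝ, ContDiff ℝ (⊤ : ℕ∞) φ → HasCompactSupport φ → tsupport φ ⊆ ball 0 1 →
      (∀ x, 0 ≤ φ x) → 0 ≤ ∫ x in ball (0:V) 1, u x * lapb b φ x)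
    (hv : Continuous v) {R' : ℝ} (hR' : R' < 1) (huv : EqOn u v (closedBall 0 R'))
    (φ : ContDiffBump (0:V)) {x : V} (hx : ‖x‖ + φ.rOut ≤ R') : 0 ≤ lapb b (mol (φ.normed volume) v) x := by
  have hρ : ContDiff ℝ (⊤ : ℕ∞) (φ.normed (volume : Measure V)) := φ.contDiff_normed
  have hc : HasCompactSupport (φ.normed (volume : Measure V)) := φ.hasCompactSupport_normed
  have h0 : ∀ t, 0 ≤ φ.normed (volume : Measure V) t := fun t => φ.nonneg_normed t
  have hts := φ.tsupport_normed_eq (μ := (volume : Measure V))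
  set ρ := φ.normed (volume : Measure V)
  have hρ2 : ContDiff ℝ 2 ρ := φ.contDiff_normed (n := 2)
  rw [mol_lap b hρ2 hc hv, mol_apply]
  have hsupp : ∀ z, lapb b ρ z ≠ 0 → z ∈ closedBall (0:V) φ.rOut := by
    intro z hz
    by_contra hcon
    apply hz
    rw [← hts] at hcon
    refine Finset.sum_eq_zero fun i _ => ?_
    have h1 : ρ =ᶠ[𝓝 z] 0 := notMem_tsupport_iff_eventuallyEq.mp hcon
    have h2 : (fun y => fderiv ℝ ρ y (b i)) =ᶠ[𝓝 z] fun y => (0:ℝ) := by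
      filter_upwards [h1.eventuallyEq_nhds] with y hy
      rw [hy.fderiv_eq]; simp
    rw [h2.fderiv_eq]; simp
  have hbig := hsub (fun y => ρ (x - y)) (hρ.comp (by fun_prop)) ?_ ?_ (fun y => h0 _)
  · have e : ∫ t, lapb b ρ t * v (x - t) = ∫ y in ball (0:V) 1, u y * lapb b (fun y => ρ (x - y)) y := by
      rw [← integral_sub_left_eq_self (fun t => lapb b ρ t * v (x - t)) volume x, ← integral_indicator measurableSet_ball]
      refine integral_congr_ae (ae_of_all _ fun y => ?_)
      simp only [sub_sub_cancel]
      by_cases h : lapb b ρ (x - y) = 0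
      · rw [h, zero_mul]
        by_cases hy : y ∈ ball (0:V) 1
        · rw [indicator_of_mem hy, lapb_refl b hρ2, h, mul_zero]
        · rw [indicator_of_notMem hy]
      · have h1 := hsupp _ h
        have h2 : ‖y‖ ≤ R' := by
          have h3 : ‖x - y‖ ≤ φ.rOut := by simpa using h1
          have h4 : ‖y‖ ≤ ‖x‖ + ‖x - y‖ := by
            have := norm_sub_le x (x - y); rwa [sub_sub_cancel] at this
          linarith
        rw [indicator_of_mem (by simpa using h2.trans_lt hR'), lapb_refl b hρ2, huv (by simpa using h2)]; ring
    rw [e]; exact hbig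
  · exact hc.comp_homeomorph (Homeomorph.subLeft x)
  · intro y hy
    have h1 : tsupport (fun y => ρ (x - y)) ⊆ (fun y => x - y) ⁻¹' tsupport ρ := 
      tsupport_comp_subset_preimage ρ (by fun_prop)
    have h2 := h1 hy
    rw [hts] at h2
    have h3 : ‖x - y‖ ≤ φ.rOut := by simpa using h2
    have h4 : ‖y‖ ≤ ‖x‖ + ‖x - y‖ := by
      have := norm_sub_le x (x - y); rwa [sub_sub_cancel] at this
    have : ‖y‖ < 1 := by linarith
    simpa using this

/-- derivative of the mollification of a Lipschitz function -/
lemma mol_grad {K : ℝ≥0} {v : V → ℝ} (hv : LipschitzWith K v) (φ : ContDiffBump (0:V)) (x : V) :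
    fderiv ℝ (mol (φ.normed volume) v) x
      = (φ.normed volume ⋆[ContinuousLinearMap.lsmul ℝ ℝ, volume] (fderiv ℝ v)) x := by
  have hρc := φ.continuous_normed (μ := (volume : Measure V))
  have hc : HasCompactSupport (φ.normed (volume : Measure V)) := φ.hasCompactSupport_normed
  have hi := φ.integrable_normed (μ := (volume : Measure V))
  set ρ := φ.normed (volume : Measure V)
  have hae : ∀ᵐ t : V, DifferentiableAt ℝ v (x - t) := by
    have := hv.ae_differentiableAt (μ := (volume : Measure V))
    exact (Measure.measurePreserving_sub_left (volume : Measure V) x).quasiMeasurePreserving.ae this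
  have key := hasFDerivAt_integral_of_dominated_loc_of_lip (μ := (volume : Measure V)) (𝕜 := ℝ)
    (F := fun x t => ρ t * v (x - t)) (F' := fun t => ρ t • fderiv ℝ v (x - t)) (x₀ := x) (s := univ)
    (bound := fun t => ρ t * K) univ_mem
    (Eventually.of_forall fun y => (hρc.mul (hv.continuous.comp (by fun_prop))).aestronglyMeasurable)
    ((hρc.mul (hv.continuous.comp (by fun_prop))).integrable_of_hasCompactSupport hc.mul_right)
    (hρc.aestronglyMeasurable.smul ((measurable_fderiv ℝ v).comp (by fun_prop : Measurable fun t => x - t)).aestronglyMeasurable)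
    (ae_of_all _ fun t => ?_) (hi.mul_const _) ?_
  · have h2 : mol ρ v = fun x => ∫ t, ρ t * v (x - t) := funext fun y => mol_apply ρ v y
    rw [h2, key.2.fderiv, convolution_def]
    simp
  · refine LipschitzWith.lipschitzOnWith (LipschitzWith.of_dist_le_mul fun y z => ?_)
    have h1 := hv.dist_le_mul (y - t) (z - t)
    rw [dist_sub_right] at h1
    rw [Real.dist_eq, ← mul_sub, abs_mul, ← Real.dist_eq]
    simp only [Real.coe_nnabs, abs_mul, NNReal.abs_eq]
    rw [mul_assoc]
    gcongr
  · filter_upwards [hae] with t ht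
    have h1 : HasFDerivAt (fun y => v (y - t)) (fderiv ℝ v (x - t)) x := by
      rw [hasFDerivAt_comp_sub]; exact ht.hasFDerivAt
    exact h1.const_mul (ρ t)

lemma mol_grad_le {K : ℝ≥0} {v : V → ℝ} (hv : LipschitzWith K v) (φ : ContDiffBump (0:V)) (x : V) :
    ‖fderiv ℝ (mol (φ.normed volume) v) x‖ ≤ K := by
  rw [mol_grad hv, convolution_def]
  have hi := φ.integrable_normed (μ := (volume : Measure V))
  calc _ ≤ ∫ t, φ.normed volume t * (K:ℝ) := by
        refine norm_integral_le_of_norm_le (hi.mul_const _) (ae_of_all _ fun t => ?_)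
        simp only [ContinuousLinearMap.lsmul_apply, norm_smul, Real.norm_eq_abs, abs_of_nonneg (φ.nonneg_normed t)]
        exact mul_le_mul_of_nonneg_left (norm_fderiv_le_of_lipschitz ℝ hv) (φ.nonneg_normed t)
    _ = K := by rw [integral_mul_const, φ.integral_normed, one_mul]

lemma mol_close {K : ℝ≥0} {v : V → ℝ} (hv : LipschitzWith K v) (φ : ContDiffBump (0:V)) (x : V) :
    |mol (φ.normed volume) v x - v x| ≤ K * φ.rOut := by
  rw [← Real.dist_eq]
  refine φ.dist_normed_convolution_le hv.continuous.aestronglyMeasurable fun y hy => ?_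
  refine (hv.dist_le_mul y x).trans ?_
  gcongr
  exact (mem_ball.mp hy).le

end Moll

end ACFproof

namespace ACFproof

open Topology Module
open scoped Convolution

section Cut

/-- primitive of the smooth transition -/
def gT (s : ℝ) : ℝ := ∫ t in (0:ℝ)..s, Real.smoothTransition t

lemma gT_deriv (s : ℝ) : HasDerivAt gT (Real.smoothTransition s) s :=
  intervalIntegral.integral_hasDerivAt_right (Real.smoothTransition.continuous.intervalIntegrable _ _)
    (Real.smoothTransition.continuous.stronglyMeasurableAtFilter _ _) Real.smoothTransition.continuousAt

lemma gT_contDiff : ContDiff ℝ 2 gT := by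
  have h : ContDiff ℝ (1 + 1) gT := by
    rw [contDiff_succ_iff_deriv]
    refine ⟨fun s => (gT_deriv s).differentiableAt, by simp, ?_⟩
    rw [show deriv gT = Real.smoothTransition from funext fun s => (gT_deriv s).deriv]
    exact Real.smoothTransition.contDiff (n := 1)
  have e : (1 + 1 : WithTop ℕ∞) = 2 := by norm_num
  rwa [e] at h

lemma gT_of_nonpos {s : ℝ} (hs : s ≤ 0) : gT s = 0 := by
  unfold gT
  rw [intervalIntegral.integral_symm, neg_eq_zero]
  rw [intervalIntegral.integral_congr (g := fun _ => (0:ℝ))]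
  · simp
  · intro t ht
    rw [uIcc_of_le hs] at ht
    exact Real.smoothTransition.zero_of_nonpos ht.2

lemma gT_nonneg (s : ℝ) : 0 ≤ gT s := by
  rcases le_total s 0 with h | h
  · rw [gT_of_nonpos h]
  · exact intervalIntegral.integral_nonneg h fun t _ => Real.smoothTransition.nonneg t

/-- truncation -/
def ps (δ t : ℝ) : ℝ := δ * gT ((t - δ) / δ)
/-- its derivative -/
def ps1 (δ t : ℝ) : ℝ := Real.smoothTransition ((t - δ) / δ)

lemma ps_deriv {δ : ℝ} (hδ : 0 < δ) (t : ℝ) : HasDerivAt (ps δ) (ps1 δ t) t := by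
  have h1 : HasDerivAt (fun t : ℝ => (t - δ) / δ) (1 / δ) t := ((hasDerivAt_id t).sub_const δ).div_const δ
  have h2 := ((gT_deriv ((t - δ) / δ)).comp t h1).const_mul δ
  refine HasDerivAt.congr_deriv (f := ps δ) h2 ?_
  unfold ps1; field_simp

lemma ps_contDiff (δ : ℝ) : ContDiff ℝ 2 (ps δ) :=
  contDiff_const.mul (gT_contDiff.comp ((contDiff_id.sub contDiff_const).div_const δ))

lemma ps1_contDiff (δ : ℝ) : ContDiff ℝ 1 (ps1 δ) :=
  (Real.smoothTransition.contDiff (n := 1)).comp ((contDiff_id.sub contDiff_const).div_const δ)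

lemma ps1_mono {δ : ℝ} (hδ : 0 < δ) : Monotone (ps1 δ) := fun s t h =>
  Real.smoothTransition.monotone (by gcongr)

lemma ps_nonneg {δ : ℝ} (hδ : 0 < δ) (t : ℝ) : 0 ≤ ps δ t := mul_nonneg hδ.le (gT_nonneg _)
lemma ps1_nonneg (δ t : ℝ) : 0 ≤ ps1 δ t := Real.smoothTransition.nonneg _
lemma ps1_le (δ t : ℝ) : ps1 δ t ≤ 1 := Real.smoothTransition.le_one _
lemma ps_zero {δ : ℝ} (hδ : 0 < δ) {t : ℝ} (h : t < δ) : ps δ t = 0 := by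
  unfold ps
  rw [gT_of_nonpos (div_nonpos_of_nonpos_of_nonneg (by linarith) hδ.le), mul_zero]
lemma ps1_one {δ : ℝ} (hδ : 0 < δ) {t : ℝ} (h : 2 * δ ≤ t) : ps1 δ t = 1 :=
  Real.smoothTransition.one_of_one_le (by rw [le_div_iff₀ hδ]; linarith)

end Cut

section Approx

variable {V : Type*} [NormedAddCommGroup V] [InnerProductSpace ℝ V] [FiniteDimensional ℝ V]
  [MeasurableSpace V] [BorelSpace V]

lemma norm_gradient (U : V → ℝ) (x : V) : ‖gradient U x‖ = ‖fderiv ℝ U x‖ := by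
  unfold gradient; simp

lemma comp_norm {δ : ℝ} (hδ : 0 < δ) {v : V → ℝ} (hv : ContDiff ℝ 2 v) (x : V) :
    ‖gradient (fun x => ps δ (v x)) x‖ = ps1 δ (v x) * ‖fderiv ℝ v x‖ := by
  have h1 := (ps_deriv hδ (v x)).comp_hasFDerivAt x (hv.differentiable two_ne_zero x).hasFDerivAt
  have h2 : HasFDerivAt (fun x => ps δ (v x)) _ x := h1
  rw [norm_gradient, h2.fderiv, norm_smul, Real.norm_eq_abs, abs_of_nonneg (ps1_nonneg _ _)]

lemma comp_lap {ι : Type*} [Fintype ι] (b : OrthonormalBasis ι ℝ V) {δ : ℝ} (hδ : 0 < δ) {v : V → ℝ} (hv : ContDiff ℝ 2 v) (x : V)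
    (hL : 0 ≤ lapb b v x) :
    2 * ‖gradient (fun x => ps δ (v x)) x‖ ^ 2 ≤ lapb b (fun x => ps δ (v x) ^ 2) x := by
  have hvd : Differentiable ℝ v := hv.differentiable two_ne_zero
  set q := deriv (ps1 δ) (v x) with hq
  have hq0 : 0 ≤ q := (ps1_mono hδ).deriv_nonneg
  have hqd : HasDerivAt (ps1 δ) q (v x) := ((ps1_contDiff δ).differentiable one_ne_zero _).hasDerivAt
  have hH : ∀ t, HasDerivAt (fun t => ps δ t ^ 2) (2 * ps δ t * ps1 δ t) t := fun t => by
    have := (ps_deriv hδ t).pow 2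
    refine HasDerivAt.congr_deriv (f := fun t => ps δ t ^ 2) this ?_
    simp
  have hH2 : HasDerivAt (fun t => 2 * ps δ t * ps1 δ t) (2 * ps1 δ (v x) * ps1 δ (v x) + 2 * ps δ (v x) * q) (v x) :=
    ((ps_deriv hδ (v x)).const_mul 2).mul hqd
  have e1 : ∀ i, fderiv ℝ (fun y => fderiv ℝ (fun x => ps δ (v x) ^ 2) y (b i)) x (b i)
      = (2 * ps1 δ (v x) * ps1 δ (v x) + 2 * ps δ (v x) * q) * (fderiv ℝ v x (b i)) ^ 2
        + 2 * ps δ (v x) * ps1 δ (v x) * fderiv ℝ (fun y => fderiv ℝ v y (b i)) x (b i) := by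
    intro i
    have h1 : (fun y => fderiv ℝ (fun x => ps δ (v x) ^ 2) y (b i))
        = fun y => 2 * ps δ (v y) * ps1 δ (v y) * fderiv ℝ v y (b i) := by
      funext y
      have h := (hH (v y)).comp_hasFDerivAt y (hvd y).hasFDerivAt
      have h2 : HasFDerivAt (fun x => ps δ (v x) ^ 2) _ y := h
      rw [h2.fderiv]; simp
    have hd : DifferentiableAt ℝ (fun y => fderiv ℝ v y (b i)) x :=
      ((fd_contDiff hv).clm_apply contDiff_const).differentiable one_ne_zero x
    have h3 := (hH2.comp_hasFDerivAt x (hvd x).hasFDerivAt).mul hd.hasFDerivAt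
    have h4 : HasFDerivAt (fun y => 2 * ps δ (v y) * ps1 δ (v y) * fderiv ℝ v y (b i)) _ x := h3
    rw [h1, h4.fderiv]
    simp
    ring
  have e2 : lapb b (fun x => ps δ (v x) ^ 2) x
      = (2 * ps1 δ (v x) * ps1 δ (v x) + 2 * ps δ (v x) * q) * ‖fderiv ℝ v x‖ ^ 2
        + 2 * ps δ (v x) * ps1 δ (v x) * lapb b v x := by
    have h5 : ‖fderiv ℝ v x‖ ^ 2 = ∑ i, (fderiv ℝ v x (b i)) ^ 2 := by
      rw [← norm_gradient, ← b.sum_sq_norm_inner_left (gradient v x)]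
      refine Finset.sum_congr rfl fun i _ => ?_
      rw [fderiv_grad (hvd x)]; simp
    rw [h5, lapb, Finset.sum_congr rfl fun i _ => e1 i, Finset.sum_add_distrib, ← Finset.mul_sum, ← Finset.mul_sum]
    rfl
  rw [comp_norm hδ hv, e2]
  have n1 := ps_nonneg hδ (v x)
  have n2 := ps1_nonneg δ (v x)
  have n3 : 0 ≤ 2 * ps δ (v x) * q * ‖fderiv ℝ v x‖ ^ 2 := by positivity
  have n4 : 0 ≤ 2 * ps δ (v x) * ps1 δ (v x) * lapb b v x := by positivity
  nlinarith

/-- Smooth approximation of one function. -/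
lemma approx {ι : Type*} [Fintype ι] (b : OrthonormalBasis ι ℝ V) {m : ℕ} (hm : finrank ℝ V = m + 2) {u : V → ℝ}
    (hlip : ∀ x ∈ ball (0:V) 1, ∃ (K : ℝ≥0) (ε : ℝ), 0 < ε ∧ ball x ε ⊆ ball (0:V) 1 ∧ LipschitzOnWith K u (ball x ε))
    (h0 : ∀ x ∈ ball (0:V) 1, 0 ≤ u x)
    (hsub : ∀ φ : V → ℝ, ContDiff ℝ (⊤ : ℕ∞) φ → HasCompactSupport φ → tsupport φ ⊆ ball 0 1 →
      (∀ x, 0 ≤ φ x) → 0 ≤ ∫ x in ball (0:V) 1, u x * lapb b φ x)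
    {R : ℝ} (hR : R < 1) :
    ∃ (U : ℕ → V → ℝ) (P : ℕ → Set V), (∀ k, ContDiff ℝ 2 (U k)) ∧ (∀ k x, 0 ≤ U k x) ∧ (∀ k, IsClosed (P k)) ∧
      (∀ k x, x ∉ P k → U k x = 0) ∧ (∀ k, ∀ x ∈ ball (0:V) R, x ∈ P k → 0 < u x) ∧
      (∀ k, ∀ x ∈ ball (0:V) R, 2 * ‖gradient (U k) x‖ ^ 2 ≤ lapb b (fun x => U k x ^ 2) x) ∧
      ∀ r ≤ R, Tendsto (fun k => ∫ x in ball (0:V) r, ‖gradient (U k) x‖ ^ 2 / ‖x‖ ^ m) atTop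
        (𝓝 (∫ x in ball (0:V) r, ‖gradient u x‖ ^ 2 / ‖x‖ ^ m)) := by
  obtain ⟨R', hRR', hR'⟩ := exists_between hR
  have hsubset : closedBall (0:V) R' ⊆ ball 0 1 := closedBall_subset_ball hR'
  have hll : LocallyLipschitzOn (closedBall (0:V) R') u := by
    intro x hx
    obtain ⟨K, ε, hε, -, h⟩ := hlip x (hsubset hx)
    exact ⟨K, ball x ε, mem_nhdsWithin_of_mem_nhds (ball_mem_nhds x hε), h⟩
  obtain ⟨K, hK⟩ := hll.exists_lipschitzOnWith_of_compact (isCompact_closedBall _ _)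
  obtain ⟨v, hv, huv⟩ := hK.extend_real
  set ε : ℕ → ℝ := fun k => (R' - R) / (k + 1) with hε
  have hεpos : ∀ k, 0 < ε k := fun k => div_pos (by linarith) (by positivity)
  have hεle : ∀ k, ε k ≤ R' - R := fun k => div_le_self (by linarith) (by simp)
  have hε0 : Tendsto ε atTop (𝓝 0) := by
    have := tendsto_one_div_add_atTop_nhds_zero_nat.const_mul (R' - R)
    simpa [hε, div_eq_mul_inv] using this
  set φ : ℕ → ContDiffBump (0:V) := fun k => ⟨ε k / 2, ε k, half_pos (hεpos k), half_lt_self (hεpos k)⟩ with hφ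
  have hφr : ∀ k, (φ k).rOut = ε k := fun k => rfl
  set δ : ℕ → ℝ := fun k => (K + 1) * ε k with hδ
  have hδpos : ∀ k, 0 < δ k := fun k => by have := hεpos k; positivity
  have hδ0 : Tendsto δ atTop (𝓝 0) := by simpa using hε0.const_mul ((K:ℝ) + 1)
  set w : ℕ → V → ℝ := fun k => mol ((φ k).normed volume) v with hw
  have hwc : ∀ k, ContDiff ℝ 2 (w k) := fun k =>
    mol_contDiff (k := 2) ((φ k).contDiff_normed) (φ k).hasCompactSupport_normed hv.continuous
  have hwv : ∀ k x, |w k x - v x| ≤ K * ε k := fun k x => mol_close hv (φ k) x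
  have hwl : ∀ k x, ‖fderiv ℝ (w k) x‖ ≤ K := fun k x => mol_grad_le hv (φ k) x
  refine ⟨fun k x => ps (δ k) (w k x), fun k => {x | δ k ≤ w k x}, fun k => (ps_contDiff _).comp (hwc k),
    fun k x => ps_nonneg (hδpos k) _, fun k => isClosed_le continuous_const (hwc k).continuous,
    fun k x hx => ps_zero (hδpos k) (not_le.mp hx), ?_, ?_, ?_⟩
  · intro k x hx hxP
    have hx1 : x ∈ closedBall (0:V) R' := ball_subset_closedBall (ball_subset_ball hRR'.le hx)
    rw [huv hx1]
    have h1 := (abs_le.mp (hwv k x)).2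
    have h2 : (K + 1) * ε k ≤ w k x := hxP
    have := hεpos k
    nlinarith
  · intro k x hx
    refine comp_lap b (hδpos k) (hwc k) x (mol_sub b hsub hv.continuous hR' huv (φ k) ?_)
    have : ‖x‖ < R := by simpa using hx
    have := hεle k
    rw [hφr]; linarith
  · intro r hr
    have hfi : LocallyIntegrable (fderiv ℝ v) (volume : Measure V) := by
      have hb : ∀ x, ‖fderiv ℝ v x‖ ≤ K := fun x => norm_fderiv_le_of_lipschitz ℝ hv
      have hc : LocallyIntegrable (fun _ : V => (K:ℝ)) (volume : Measure V) := continuous_const.locallyIntegrable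
      exact hc.mono (measurable_fderiv ℝ v).aestronglyMeasurable (ae_of_all _ fun x => by simpa using hb x)
    have hae := ContDiffBump.ae_convolution_tendsto_right_of_locallyIntegrable (μ := (volume : Measure V)) (φ := φ) (l := atTop) (K := 2)
      hε0 (Eventually.of_forall fun k => by simp only [hφ]; linarith) hfi
    refine tendsto_integral_of_dominated_convergence (fun x => (K:ℝ) ^ 2 * (1 / ‖x‖ ^ m)) (fun k => ?_)
      ((inv_int hm r).const_mul _) (fun k => ?_) ?_
    · have hU : ContDiff ℝ 1 (fun x => ps (δ k) (w k x)) := ((ps_contDiff _).comp (hwc k)).of_le (by norm_num)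
      have : Measurable fun x : V => ‖gradient (fun x => ps (δ k) (w k x)) x‖ ^ 2 / ‖x‖ ^ m :=
        (((grad_cont hU).norm.pow 2).measurable).div ((continuous_norm.pow m).measurable)
      exact this.aestronglyMeasurable
    · refine ae_of_all _ fun x => ?_
      rw [norm_div, norm_pow, norm_norm, norm_pow, norm_norm, mul_one_div, comp_norm (hδpos k) (hwc k)]
      have hn := mul_nonneg (ps1_nonneg (δ k) (w k x)) (norm_nonneg (fderiv ℝ (w k) x))
      refine div_le_div_of_nonneg_right (pow_le_pow_left₀ hn ?_ 2) (by positivity)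
      calc _ ≤ 1 * (K:ℝ) := mul_le_mul (ps1_le _ _) (hwl k x) (norm_nonneg _) zero_le_one
        _ = K := one_mul _
    · rw [ae_restrict_iff' measurableSet_ball]
      filter_upwards [hae] with x hx hxr
      refine Tendsto.div_const (Tendsto.pow ?_ 2) _
      simp_rw [comp_norm (hδpos _) (hwc _)]
      have hxR : ‖x‖ < R := by have : ‖x‖ < r := by simpa using hxr
                               linarith
      have hev : u =ᶠ[𝓝 x] v := by
        filter_upwards [(isOpen_ball (x := (0:V)) (ε := R')).mem_nhds (by simpa using hxR.trans hRR')] with y hy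
        exact huv (ball_subset_closedBall hy)
      have hx1 : x ∈ ball (0:V) 1 := by simpa using hxR.trans hR
      have hlim : Tendsto (fun k => ‖fderiv ℝ (w k) x‖) atTop (𝓝 ‖fderiv ℝ v x‖) := by
        have h1 : ∀ k, fderiv ℝ (w k) x = ((φ k).normed volume ⋆[ContinuousLinearMap.lsmul ℝ ℝ, volume] (fderiv ℝ v)) x :=
          fun k => mol_grad hv (φ k) x
        simp_rw [h1]
        exact hx.norm
      rw [norm_gradient, hev.fderiv_eq]
      rcases (h0 x hx1).eq_or_lt with h | h
      · have hmin : IsLocalMin v x := by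
          filter_upwards [hev, isOpen_ball.mem_nhds hx1] with y hy hy1
          rw [← hy, ← hev.eq_of_nhds, ← h]
          exact h0 y hy1
        rw [hmin.fderiv_eq_zero, norm_zero] at hlim ⊢
        refine squeeze_zero (fun k => mul_nonneg (ps1_nonneg _ _) (norm_nonneg _)) (fun k => ?_) hlim
        exact mul_le_of_le_one_left (norm_nonneg _) (ps1_le _ _)
      · refine hlim.congr' ?_
        rw [hev.eq_of_nhds] at h
        have hlt : ∀ᶠ k in atTop, 2 * δ k + K * ε k < v x := by
          have : Tendsto (fun k => 2 * δ k + K * ε k) atTop (𝓝 0) := by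
            simpa using (hδ0.const_mul 2).add (hε0.const_mul (K:ℝ))
          exact this.eventually_lt_const h
        filter_upwards [hlt] with k hk
        have := (abs_le.mp (hwv k x)).1
        rw [ps1_one (hδpos k) (by linarith), one_mul]

end Approx

end ACFproof

/-- **Alt–Caffarelli–Friedman monotonicity formula.** If `u₊, u₋` are continuous, locally
Lipschitz, nonnegative, subharmonic on `B₁` with `u₊·u₋ = 0`, then
`Φ(r) = r⁻⁴ (∫_{B_r} |∇u₊|²/|x|^{n-2}) (∫_{B_r} |∇u₋|²/|x|^{n-2})` is nondecreasing on `(0,1)`. -/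
theorem ACF_monotonicity (n : ℕ) (up um : E (n + 2) → ℝ)
    (hupc : ContinuousOn up (B1 (n + 2))) (humc : ContinuousOn um (B1 (n + 2)))
    (huplip : ∀ x ∈ B1 (n + 2), ∃ (K : ℝ≥0) (ε : ℝ), 0 < ε ∧ ball x ε ⊆ B1 (n + 2) ∧
      LipschitzOnWith K up (ball x ε))
    (humlip : ∀ x ∈ B1 (n + 2), ∃ (K : ℝ≥0) (ε : ℝ), 0 < ε ∧ ball x ε ⊆ B1 (n + 2) ∧
      LipschitzOnWith K um (ball x ε))
    (hup0 : ∀ x ∈ B1 (n + 2), 0 ≤ up x) (hum0 : ∀ x ∈ B1 (n + 2), 0 ≤ um x)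
    (hprod : ∀ x ∈ B1 (n + 2), up x * um x = 0)
    (hsubp : SubharmonicOn (B1 (n + 2)) up) (hsubm : SubharmonicOn (B1 (n + 2)) um) :
    ∀ r₁ r₂ : ℝ, 0 < r₁ → r₁ ≤ r₂ → r₂ < 1 →
      ACF (n + 2) up um r₁ ≤ ACF (n + 2) up um r₂ := by
  intro r₁ r₂ h1 h12 h2
  obtain ⟨R, hr2, hR⟩ := exists_between h2
  have hm : Module.finrank ℝ (E (n + 2)) = n + 2 := by simp
  have hlap : ∀ φ : E (n + 2) → ℝ, ACFproof.lapb (EuclideanSpace.basisFun (Fin (n + 2)) ℝ) φ = lap φ := by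
    intro φ; funext x; simp [ACFproof.lapb, lap]
  have conv : ∀ u : E (n + 2) → ℝ, SubharmonicOn (B1 (n + 2)) u →
      ∀ φ : E (n + 2) → ℝ, ContDiff ℝ (⊤ : ℕ∞) φ → HasCompactSupport φ → tsupport φ ⊆ ball 0 1 →
      (∀ x, 0 ≤ φ x) → 0 ≤ ∫ x in ball (0 : E (n + 2)) 1, u x * ACFproof.lapb (EuclideanSpace.basisFun (Fin (n + 2)) ℝ) φ x := by
    intro u hu φ a b c d
    rw [hlap]
    exact hu φ a b c d
  obtain ⟨U, P, hU, hU0, hP, hUP, hPu, hLU, hlU⟩ := ACFproof.approx _ hm huplip hup0 (conv up hsubp) hR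
  obtain ⟨W, Q, hW, hW0, hQ, hWQ, hQu, hLW, hlW⟩ := ACFproof.approx _ hm humlip hum0 (conv um hsubm) hR
  have hA : ∀ r, r ≤ R → Tendsto (fun k => 1 / r ^ 4 * (∫ x in ball (0 : E (n + 2)) r, ‖gradient (U k) x‖ ^ 2 / ‖x‖ ^ n)
      * (∫ x in ball (0 : E (n + 2)) r, ‖gradient (W k) x‖ ^ 2 / ‖x‖ ^ n)) atTop (nhds (ACF (n + 2) up um r)) := by
    intro r hr
    exact ((hlU r hr).const_mul _).mul (hlW r hr)
  refine le_of_tendsto_of_tendsto' (hA r₁ (h12.trans hr2.le)) (hA r₂ hr2.le) fun k => ?_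
  refine ACFproof.smooth_ACF (EuclideanSpace.basisFun (Fin (n + 2)) ℝ) hm (hU k) (hW k) (hU0 k) (hW0 k) (hP k) (hQ k)
    (hUP k) (hWQ k) (R := R) ?_ (hLU k) (hLW k) h1 h12 hr2
  intro x hx hxP hxQ
  have a := hPu k x hx hxP
  have b := hQu k x hx hxQ
  have c := hprod x (ball_subset_ball hR.le hx)
  exact (mul_pos a b).ne' c
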